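/- Assume the Riemann hypothesis: every nontrivial zero of the Riemann zeta function ζ(s) has real part 1/2. Assume moreover that all nontrivial zeros of ζ are simple and that there exists θ with 1 ≤ θ < 3 − √3 such that ∑_{0<γ≤T} |ζ′(1/2+iγ)|^{−2} ≪ T^θ. Let α ∈ (0,1], let 0 < b < min(1/2, α), and let 0 < ε < 1/2 − b. Then for all x > 1 and T ≥ 1, M_α(x) = 1/ζ(α) + ∑_{|γ|≤T} x^{ρ−α}/((ρ−α) ζ′(ρ)) + O(x^{1−α} log x / T + x^{1−α}/(T^{1−ε} log x) + x^{1/2−α} (T^{θ−2} log T)^{1/2} + x^{b−α}), where M_α(x) = ∑_{n≤x} μ(n)/n^α and ρ = 1/2 + iγ ranges over the nontrivial zeros of ζ with |γ| ≤ T. -/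

import Mathlib

open MeasureTheory Filter Topology

/-- `M_α(x) = ∑_{n ≤ x} μ(n)/n^α`, the weighted summatory function of the Möbius
function. -/
noncomputable def Mweight (α x : ℝ) : ℝ :=
  ∑ n ∈ Finset.Icc 1 ⌊x⌋₊, (ArithmeticFunction.moebius n : ℝ) / (n : ℝ) ^ α

namespace MobiusExplicit

open Complex Set

/-- The function `{t} 𝟙_{t > 1}`. -/
noncomputable def fractTail (t : ℝ) : ℂ := (Ioi (1 : ℝ)).indicator (fun u ↦ ((Int.fract u : ℝ) : ℂ)) t

lemma norm_fractTail_le (t : ℝ) : ‖fractTail t‖ ≤ 1 := by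
  unfold fractTail
  by_cases h : t ∈ Ioi (1 : ℝ)
  · rw [indicator_of_mem h, norm_real, Real.norm_of_nonneg (Int.fract_nonneg t)]
    exact (Int.fract_lt_one t).le
  · simp [indicator_of_notMem h]

lemma measurable_fractTail : Measurable fractTail :=
  (measurable_ofReal.comp measurable_fract).indicator measurableSet_Ioi

lemma locallyIntegrableOn_fractTail : LocallyIntegrableOn fractTail (Ioi 0) := by
  have : LocallyIntegrable fractTail := by
    refine (locallyIntegrable_const (1 : ℝ)).mono measurable_fractTail.aestronglyMeasurable ?_
    exact ae_of_all _ fun t ↦ by simpa using norm_fractTail_le t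
  exact this.locallyIntegrableOn _

lemma fractTail_isBigO_atTop : fractTail =O[atTop] fun x : ℝ ↦ x ^ (-(0 : ℝ)) := by
  refine Asymptotics.IsBigO.of_bound 1 (Eventually.of_forall fun t ↦ ?_)
  simpa using norm_fractTail_le t

lemma fractTail_isBigO_zero (b : ℝ) : fractTail =O[𝓝[>] 0] fun x : ℝ ↦ x ^ (-b) := by
  refine Asymptotics.IsBigO.of_bound 1 ?_
  have : Iio (1 : ℝ) ∈ 𝓝[>] (0 : ℝ) := mem_nhdsWithin_of_mem_nhds (Iio_mem_nhds one_pos)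
  filter_upwards [this] with t ht
  have : fractTail t = 0 := indicator_of_notMem (by simpa using (le_of_lt ht)) _
  simp [this]

lemma mellinConvergent_fractTail {s : ℂ} (hs : 0 < s.re) : MellinConvergent fractTail (-s) :=
  mellinConvergent_of_isBigO_rpow (a := 0) (b := -s.re - 1) locallyIntegrableOn_fractTail
    fractTail_isBigO_atTop (by simpa using hs) (fractTail_isBigO_zero _) (by simp)

lemma differentiableAt_mellin_fractTail {s : ℂ} (hs : 0 < s.re) :
    DifferentiableAt ℂ (mellin fractTail) (-s) :=
  mellin_differentiableAt_of_isBigO_rpow (a := 0) (b := -s.re - 1) locallyIntegrableOn_fractTail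
    fractTail_isBigO_atTop (by simpa using hs) (fractTail_isBigO_zero _) (by simp)

lemma mellin_fractTail_eq (s : ℂ) :
    mellin fractTail (-s) = ∫ t in Ioi (1 : ℝ), ((Int.fract t : ℝ) : ℂ) * (t : ℂ) ^ (-(s + 1)) := by
  have h : ∀ t : ℝ, (t : ℂ) ^ (-s - 1) • fractTail t =
      (Ioi (1 : ℝ)).indicator (fun t : ℝ ↦ ((Int.fract t : ℝ) : ℂ) * (t : ℂ) ^ (-(s + 1))) t := by
    intro t
    unfold fractTail
    by_cases h : t ∈ Ioi (1 : ℝ)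
    · rw [indicator_of_mem h, indicator_of_mem h, smul_eq_mul, mul_comm, neg_add']
    · simp [indicator_of_notMem h]
  rw [mellin, funext h, setIntegral_indicator measurableSet_Ioi]
  congr 2
  simp

lemma norm_mellin_fractTail_le {s : ℂ} (hs : 0 < s.re) :
    ‖mellin fractTail (-s)‖ ≤ 1 / s.re := by
  rw [mellin_fractTail_eq]
  have hI : ∫ t in Ioi (1 : ℝ), t ^ (-(s.re + 1)) = 1 / s.re := by
    rw [integral_Ioi_rpow_of_lt (by linarith) one_pos]
    simp
  rw [← hI]
  refine norm_integral_le_of_norm_le (integrableOn_Ioi_rpow_of_lt (by linarith) one_pos) ?_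
  refine (ae_restrict_iff' measurableSet_Ioi).mpr (ae_of_all _ fun t ht ↦ ?_)
  have ht0 : 0 < t := one_pos.trans ht
  rw [norm_mul, norm_cpow_eq_rpow_re_of_pos ht0, norm_real,
    Real.norm_of_nonneg (Int.fract_nonneg t)]
  have : (-(s + 1)).re = -(s.re + 1) := by simp
  rw [this]
  exact mul_le_of_le_one_left (by positivity) (Int.fract_lt_one t).le

lemma riemannZeta_eq_of_one_lt_re {s : ℂ} (hs : 1 < s.re) :
    riemannZeta s = s / (s - 1) - s * mellin fractTail (-s) := by
  have hs0 : 0 < s.re := by linarith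
  have hs1 : s - 1 ≠ 0 := fun h ↦ by
    have := congrArg re h; simp at this; linarith
  have h1 : LSeries 1 s = s * ∫ t in Ioi (1 : ℝ), (∑ k ∈ Finset.Icc 1 ⌊t⌋₊, (1 : ℕ → ℂ) k) *
      (t : ℂ) ^ (-(s + 1)) := by
    refine LSeries_eq_mul_integral 1 zero_le_one hs (LSeriesSummable_one_iff.mpr hs) ?_
    exact Asymptotics.IsBigO.of_bound 1 (Eventually.of_forall fun n ↦ by simp)
  have h2 : ∀ t ∈ Ioi (1 : ℝ), (∑ k ∈ Finset.Icc 1 ⌊t⌋₊, (1 : ℕ → ℂ) k) * (t : ℂ) ^ (-(s + 1)) =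
      (t : ℂ) ^ (-s) - ((Int.fract t : ℝ) : ℂ) * (t : ℂ) ^ (-(s + 1)) := by
    intro t ht
    have ht0 : 0 < t := one_pos.trans ht
    have e1 : (∑ k ∈ Finset.Icc 1 ⌊t⌋₊, (1 : ℕ → ℂ) k) = (⌊t⌋₊ : ℂ) := by simp
    have e2 : ((⌊t⌋₊ : ℝ) : ℂ) = (t : ℂ) - ((Int.fract t : ℝ) : ℂ) := by
      rw [natCast_floor_eq_intCast_floor ht0.le, ← Int.self_sub_fract]; push_cast; ring
    have e3 : (t : ℂ) ^ (-s) = t * (t : ℂ) ^ (-(s + 1)) := by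
      have : -s = 1 + (-(s + 1)) := by ring
      rw [this, cpow_add _ _ (by exact_mod_cast ht0.ne'), cpow_one]
    rw [e1, ← ofReal_natCast, e2, e3]; ring
  rw [← LSeries_one_eq_riemannZeta hs, h1, setIntegral_congr_fun measurableSet_Ioi h2,
    integral_sub, mellin_fractTail_eq, integral_Ioi_cpow_of_lt (by simpa using hs) one_pos]
  · have : -s + 1 ≠ 0 := fun h ↦ hs1 (by linear_combination -h)
    simp only [ofReal_one, one_cpow]
    field_simp
    ring
  · exact integrableOn_Ioi_cpow_of_lt (by simpa using hs) one_pos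
  · have := mellinConvergent_fractTail hs0
    rw [MellinConvergent] at this
    refine ((this.mono_set (Ioi_subset_Ioi zero_le_one)).congr_fun ?_ measurableSet_Ioi)
    intro t ht
    simp only [fractTail]
    rw [indicator_of_mem ht, smul_eq_mul, mul_comm, neg_add']

/-- The analytic continuation of `ζ` to the right half-plane by partial summation. -/
lemma riemannZeta_eq_of_re_pos {s : ℂ} (hs : 0 < s.re) (hs1 : s ≠ 1) :
    riemannZeta s = s / (s - 1) - s * mellin fractTail (-s) := by
  have hopen : IsOpen {z : ℂ | 0 < z.re} := isOpen_lt continuous_const continuous_re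
  have hconv : Convex ℝ {z : ℂ | 0 < z.re} := convex_halfSpace_re_gt 0
  have hf : AnalyticOnNhd ℂ riemannZeta₁ {z : ℂ | 0 < z.re} :=
    differentiable_riemannZeta₁.differentiableOn.analyticOnNhd hopen
  have hg : AnalyticOnNhd ℂ (fun z ↦ z - (z - 1) * (z * mellin fractTail (-z)))
      {z : ℂ | 0 < z.re} := by
    refine DifferentiableOn.analyticOnNhd (fun z hz ↦ ?_) hopen
    have h := (differentiableAt_mellin_fractTail hz).comp z differentiable_neg.differentiableAt
    have h' : DifferentiableAt ℂ (fun z ↦ mellin fractTail (-z)) z := h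
    exact (by fun_prop : DifferentiableAt ℂ
      (fun z ↦ z - (z - 1) * (z * mellin fractTail (-z))) z).differentiableWithinAt
  have h2 : (2 : ℂ) ∈ {z : ℂ | 0 < z.re} := by simp
  have key := hf.eqOn_of_preconnected_of_eventuallyEq hg hconv.isPreconnected h2 ?_ hs
  · have hs1' : s - 1 ≠ 0 := sub_ne_zero.mpr hs1
    rw [riemannZeta_eq_inv_sub_mul hs1, key]
    field_simp
  · have : {z : ℂ | 1 < z.re} ∈ 𝓝 (2 : ℂ) :=
      (isOpen_lt continuous_const continuous_re).mem_nhds (by simp)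
    filter_upwards [this] with z hz
    have hz1 : z ≠ 1 := fun h ↦ by simp [h] at hz
    have hz1' : z - 1 ≠ 0 := sub_ne_zero.mpr hz1
    have e1 := riemannZeta_eq_inv_sub_mul hz1
    rw [riemannZeta_eq_of_one_lt_re hz] at e1
    field_simp at e1
    linear_combination -e1

lemma norm_riemannZeta_le {s : ℂ} (hs : 1 / 4 ≤ s.re) (hs1 : 1 / 4 ≤ ‖s - 1‖) :
    ‖riemannZeta s‖ ≤ 8 * ‖s‖ := by
  have h0 : 0 < s.re := by linarith
  have hne : s ≠ 1 := fun h ↦ by norm_num [h] at hs1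
  rw [riemannZeta_eq_of_re_pos h0 hne]
  have e1 : ‖s / (s - 1)‖ ≤ 4 * ‖s‖ := by
    rw [norm_div, div_le_iff₀ (by linarith)]
    nlinarith [norm_nonneg s]
  have e2 : ‖s * mellin fractTail (-s)‖ ≤ ‖s‖ * 4 := by
    rw [norm_mul]
    gcongr
    refine (norm_mellin_fractTail_le h0).trans ?_
    rw [div_le_iff₀ h0]; linarith
  linarith [norm_sub_le (s / (s - 1)) (s * mellin fractTail (-s))]

lemma riemannZeta_one_half_ne_zero : riemannZeta (1 / 2) ≠ 0 := by
  have h0 : (0 : ℝ) < (1 / 2 : ℂ).re := by norm_num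
  have hne : (1 / 2 : ℂ) ≠ 1 := by norm_num
  rw [riemannZeta_eq_of_re_pos h0 hne, mellin_fractTail_eq]
  have hcast : ∀ t ∈ Ioi (1 : ℝ), ((Int.fract t : ℝ) : ℂ) * (t : ℂ) ^ (-((1 / 2 : ℂ) + 1)) =
      ((Int.fract t * t ^ (-((1 / 2 : ℝ) + 1)) : ℝ) : ℂ) := by
    intro t ht
    have ht0 : (0 : ℝ) ≤ t := (one_pos.trans ht).le
    rw [ofReal_mul, ofReal_cpow ht0]
    norm_num
  rw [setIntegral_congr_fun measurableSet_Ioi hcast, integral_complex_ofReal]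
  have hpos : 0 ≤ ∫ t in Ioi (1 : ℝ), Int.fract t * t ^ (-((1 / 2 : ℝ) + 1)) := by
    refine setIntegral_nonneg measurableSet_Ioi fun t ht ↦ ?_
    have ht0 : (0 : ℝ) ≤ t := (one_pos.trans ht).le
    have := Int.fract_nonneg t
    positivity
  intro h
  have h' := congrArg re h
  set J := ∫ t in Ioi (1 : ℝ), Int.fract t * t ^ (-((1 / 2 : ℝ) + 1))
  have : (1 / 2 : ℂ) / (1 / 2 - 1) - 1 / 2 * ((J : ℝ) : ℂ) = ((-1 - J / 2 : ℝ) : ℂ) := by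
    push_cast; ring
  rw [this, ofReal_re, zero_re] at h'
  linarith

lemma norm_Gamma_le_Gamma_re {s : ℂ} (hs : 0 < s.re) : ‖Gamma s‖ ≤ Real.Gamma s.re := by
  rw [Gamma_eq_integral hs, Real.Gamma_eq_integral hs, GammaIntegral]
  refine norm_integral_le_of_norm_le (Real.GammaIntegral_convergent hs) ?_
  refine (ae_restrict_iff' measurableSet_Ioi).mpr (ae_of_all _ fun t ht ↦ ?_)
  rw [norm_mul, norm_cpow_eq_rpow_re_of_pos ht, norm_real, Real.norm_of_nonneg (Real.exp_pos _).le]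
  simp

lemma norm_Gamma_le_two {s : ℂ} (h1 : 1 ≤ s.re) (h3 : s.re ≤ 3) : ‖Gamma s‖ ≤ 2 := by
  refine (norm_Gamma_le_Gamma_re (by linarith)).trans ?_
  have h := Real.convexOn_Gamma.le_max_of_mem_Icc (x := 1) (y := 3) (z := s.re)
    (by simp) (by simp) ⟨h1, h3⟩
  have h3' : Real.Gamma 3 = 2 := by
    rw [show (3 : ℝ) = ((2 : ℕ) : ℝ) + 1 by norm_num, Real.Gamma_nat_eq_factorial]
    norm_num [Nat.factorial]
  rw [Real.Gamma_one, h3'] at h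
  simpa using h

lemma norm_sin_le_exp (z : ℂ) : ‖sin z‖ ≤ Real.exp |z.im| := by
  have h1 : ‖exp (-z * I)‖ ≤ Real.exp |z.im| := by
    rw [norm_exp]; gcongr; simpa using le_abs_self z.im
  have h2 : ‖exp (z * I)‖ ≤ Real.exp |z.im| := by
    rw [norm_exp]; gcongr; simpa using neg_le_abs z.im
  have h3 := norm_sub_le (exp (-z * I)) (exp (z * I))
  rw [sin, norm_div, norm_mul, norm_I, mul_one]
  simp only [norm_ofNat]
  linarith

lemma abs_sinh_im_le_norm_cos (z : ℂ) : |Real.sinh z.im| ≤ ‖cos z‖ := by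
  have h : ‖cos z‖ ^ 2 = Real.cos z.re ^ 2 + Real.sinh z.im ^ 2 := by
    have e : cos z = ((Real.cos z.re * Real.cosh z.im : ℝ) : ℂ) +
        ((-(Real.sin z.re * Real.sinh z.im) : ℝ) : ℂ) * I := by
      rw [cos_eq]; push_cast; ring
    rw [e, Complex.sq_norm, normSq_add_mul_I]
    nlinarith [Real.cosh_sq z.im, Real.sin_sq_add_cos_sq z.re]
  refine abs_le_of_sq_le_sq ?_ (norm_nonneg _)
  rw [h]
  nlinarith [sq_nonneg (Real.cos z.re)]

lemma norm_Gamma_ge {s : ℂ} (h1 : 1 / 2 ≤ s.re) (h2 : s.re ≤ 2) (h3 : 1 ≤ |s.im|) :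
    Real.exp (-Real.pi * |s.im|) ≤ ‖Gamma s‖ := by
  have him : s.im ≠ 0 := fun h ↦ by norm_num [h] at h3
  have ha : 1 - s ≠ 0 := fun h ↦ him (by have := congrArg im h; simpa using this)
  have hb : 2 - s ≠ 0 := fun h ↦ him (by have := congrArg im h; simpa using this)
  have na : 1 ≤ ‖1 - s‖ := h3.trans (by simpa using abs_im_le_norm (1 - s))
  have nb : 1 ≤ ‖2 - s‖ := h3.trans (by simpa using abs_im_le_norm (2 - s))
  have e1 : Gamma (3 - s) = (2 - s) * ((1 - s) * Gamma (1 - s)) := by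
    rw [← Gamma_add_one _ ha, show 1 - s + 1 = 2 - s by ring, ← Gamma_add_one _ hb]
    congr 1; ring
  have e2 : ‖Gamma (1 - s)‖ ≤ 2 := by
    have h := norm_Gamma_le_two (s := 3 - s) (by simp; linarith) (by simp; linarith)
    rw [e1, norm_mul, norm_mul] at h
    have : ‖Gamma (1 - s)‖ ≤ ‖2 - s‖ * (‖1 - s‖ * ‖Gamma (1 - s)‖) := by
      calc ‖Gamma (1 - s)‖ = 1 * (1 * ‖Gamma (1 - s)‖) := by ring
        _ ≤ _ := by gcongr
    linarith
  have e3 := norm_sin_le_exp (Real.pi * s)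
  have him' : (Real.pi * s).im = Real.pi * s.im := by simp
  rw [him', abs_mul, abs_of_pos Real.pi_pos] at e3
  have e4 := congrArg norm (Gamma_mul_Gamma_one_sub s)
  have hsin : sin (Real.pi * s) ≠ 0 := by
    intro h
    rw [sin_eq_zero_iff] at h
    obtain ⟨k, hk⟩ := h
    have := congrArg im hk
    simp at this
    exact him this
  rw [norm_mul, norm_div, norm_real, Real.norm_of_nonneg Real.pi_pos.le,
    eq_div_iff (norm_ne_zero_iff.mpr hsin)] at e4
  have hpi := Real.pi_gt_three
  have e5 : Real.pi ≤ ‖Gamma s‖ * 2 * Real.exp (Real.pi * |s.im|) := by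
    calc Real.pi = ‖Gamma s‖ * ‖Gamma (1 - s)‖ * ‖sin (Real.pi * s)‖ := e4.symm
      _ ≤ _ := by gcongr
  rw [neg_mul, Real.exp_neg, inv_le_iff_one_le_mul₀ (Real.exp_pos _)]
  linarith

lemma norm_two_pi_cpow_ge {s : ℂ} (h2 : s.re ≤ 2) : 1 / 64 ≤ ‖(2 * Real.pi : ℂ) ^ (-s)‖ := by
  have h : (2 * Real.pi : ℂ) = ((2 * Real.pi : ℝ) : ℂ) := by push_cast; rfl
  have hpi := Real.pi_gt_three
  have hpi' := Real.pi_lt_four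
  rw [h, norm_cpow_eq_rpow_re_of_pos (by positivity), neg_re]
  calc (1 : ℝ) / 64 ≤ (2 * Real.pi) ^ (-2 : ℝ) := by
        rw [Real.rpow_neg (by positivity), one_div]
        gcongr
        norm_num
        nlinarith
    _ ≤ _ := by
        apply Real.rpow_le_rpow_of_exponent_le <;> linarith

lemma riemannZeta_one_sub' {s : ℂ} (h1 : 0 < s.re) (hs1 : s ≠ 1) :
    riemannZeta (1 - s) = 2 * (2 * Real.pi) ^ (-s) * Gamma s * cos (Real.pi * s / 2) *
      riemannZeta s := by
  refine riemannZeta_one_sub (fun n h ↦ ?_) hs1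
  rw [h] at h1
  simp at h1
  have : (0 : ℝ) ≤ n := n.cast_nonneg
  linarith

/-- The functional equation transports lower bounds from the right to the left half of the strip,
with an exponential loss. -/
lemma norm_riemannZeta_one_sub_ge {s : ℂ} (h1 : 1 / 2 ≤ s.re) (h2 : s.re ≤ 2) (h3 : 1 ≤ |s.im|) :
    1 / 32 * Real.exp (-Real.pi * |s.im|) * ‖riemannZeta s‖ ≤ ‖riemannZeta (1 - s)‖ := by
  have hs1 : s ≠ 1 := fun h ↦ by norm_num [h] at h3
  rw [riemannZeta_one_sub' (by linarith) hs1]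
  simp only [norm_mul, norm_ofNat]
  have hcos : 1 ≤ ‖cos (Real.pi * s / 2)‖ := by
    refine le_trans ?_ (abs_sinh_im_le_norm_cos _)
    have him : (Real.pi * s / 2).im = Real.pi / 2 * s.im := by
      have : (Real.pi * s / 2) = ((Real.pi / 2 : ℝ) : ℂ) * s := by push_cast; ring
      rw [this, im_ofReal_mul]
    rw [him, Real.abs_sinh]
    refine le_trans ?_ (Real.self_le_sinh_iff.mpr (abs_nonneg _))
    rw [abs_mul, abs_of_pos (by positivity)]
    nlinarith [Real.pi_gt_three]
  have hG := norm_Gamma_ge h1 h2 h3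
  have hp := norm_two_pi_cpow_ge h2
  calc 1 / 32 * Real.exp (-Real.pi * |s.im|) * ‖riemannZeta s‖
      = 2 * (1 / 64) * Real.exp (-Real.pi * |s.im|) * 1 * ‖riemannZeta s‖ := by ring
    _ ≤ _ := by gcongr

lemma re_mem_of_riemannZeta_eq_zero {s : ℂ} (hs : -1 ≤ s.re) (h : riemannZeta s = 0) :
    0 < s.re ∧ s.re < 1 := by
  refine ⟨?_, ?_⟩
  · by_contra! hre
    have hne : s ≠ 0 := by rintro rfl; norm_num [riemannZeta_zero] at h
    have hw1 : 1 - s ≠ 1 := fun h' ↦ hne (by linear_combination -h')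
    have hwre : 1 ≤ (1 - s).re := by simp; linarith
    have hfe := riemannZeta_one_sub' (s := 1 - s) (by linarith) hw1
    rw [sub_sub_cancel, h] at hfe
    have hz := riemannZeta_ne_zero_of_one_le_re hwre
    have hG : Gamma (1 - s) ≠ 0 := Gamma_ne_zero_of_re_pos (by linarith)
    have hp : (2 * Real.pi : ℂ) ^ (-(1 - s)) ≠ 0 := by
      have := norm_two_pi_cpow_ge (s := 1 - s) (by simp; linarith)
      intro h0
      rw [h0] at this
      norm_num at this
    have hcos : cos (Real.pi * (1 - s) / 2) = 0 := by
      by_contra hc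
      exact (mul_ne_zero (mul_ne_zero (mul_ne_zero (mul_ne_zero two_ne_zero hp) hG) hc) hz) hfe.symm
    rw [cos_eq_zero_iff] at hcos
    obtain ⟨k, hk⟩ := hcos
    have hpi : (Real.pi : ℂ) ≠ 0 := ofReal_ne_zero.mpr Real.pi_ne_zero
    have hk' : 1 - s = 2 * k + 1 := by
      have : (Real.pi : ℂ) * (1 - s) = Real.pi * (2 * k + 1) := by linear_combination 2 * hk
      exact mul_left_cancel₀ hpi this
    have hre' := congrArg re hk'
    simp at hre'
    have hk0 : (k : ℝ) < 1 := by linarith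
    have hk1 : (-1 : ℝ) < k := by linarith
    have : k = 0 := by
      have h1 : k < 1 := by exact_mod_cast hk0
      have h2 : -1 < k := by exact_mod_cast hk1
      omega
    apply hw1
    rw [hk', this]; simp
  · by_contra! hre
    exact riemannZeta_ne_zero_of_one_le_re hre h

lemma norm_LSeries_moebius_le {s : ℂ} (hs : 2 ≤ s.re) :
    ‖LSeries (fun n ↦ ((ArithmeticFunction.moebius n : ℤ) : ℂ)) s‖ ≤ 2 := by
  have h1 : LSeries (fun n ↦ ((ArithmeticFunction.moebius n : ℤ) : ℂ)) s =
      ∑' n, LSeries.term (fun n ↦ ((ArithmeticFunction.moebius n : ℤ) : ℂ)) s n := rfl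
  have hsum : HasSum (fun n : ℕ ↦ 1 / (n : ℝ) ^ 2) (Real.pi ^ 2 / 6) := hasSum_zeta_two
  have hpi : Real.pi ^ 2 / 6 ≤ 2 := by nlinarith [Real.pi_lt_d2, Real.pi_gt_three]
  rw [h1]
  refine (tsum_of_norm_bounded hsum fun n ↦ ?_).trans hpi
  rcases eq_or_ne n 0 with rfl | hn
  · simp
  rw [LSeries.term_of_ne_zero hn, norm_div, norm_natCast_cpow_of_pos (Nat.pos_of_ne_zero hn)]
  have hn1 : (1 : ℝ) ≤ n := by exact_mod_cast Nat.one_le_iff_ne_zero.mpr hn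
  gcongr
  · have := ArithmeticFunction.abs_moebius_le_one (n := n)
    rw [norm_intCast]
    exact_mod_cast this
  · rw [← Real.rpow_natCast]
    exact Real.rpow_le_rpow_of_exponent_le hn1 (by simpa using hs)

lemma riemannZeta_mul_LSeries_moebius {s : ℂ} (hs : 1 < s.re) :
    riemannZeta s * LSeries (fun n ↦ ((ArithmeticFunction.moebius n : ℤ) : ℂ)) s = 1 := by
  rw [← ArithmeticFunction.LSeries_zeta_mul_Lseries_moebius hs,
    ArithmeticFunction.LSeries_zeta_eq_riemannZeta hs]

lemma norm_riemannZeta_ge {s : ℂ} (hs : 2 ≤ s.re) : 1 / 2 ≤ ‖riemannZeta s‖ := by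
  have h := congrArg norm (riemannZeta_mul_LSeries_moebius (s := s) (by linarith))
  rw [norm_mul, norm_one] at h
  nlinarith [norm_LSeries_moebius_le hs, norm_nonneg (riemannZeta s)]

lemma sinh_le_two_mul_mul_cosh {u : ℝ} (hu : 0 ≤ u) : Real.sinh u ≤ 2 * u * Real.cosh u := by
  have h1 : 1 - 2 * u ≤ Real.exp (-(2 * u)) := by linarith [Real.add_one_le_exp (-(2 * u))]
  have h2 : Real.exp (-u) = Real.exp u * Real.exp (-(2 * u)) := by rw [← Real.exp_add]; ring_nf
  have h3 : (1 - 2 * u) * Real.exp u ≤ Real.exp (-u) := by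
    rw [h2, mul_comm]; gcongr
  rw [Real.sinh_eq, Real.cosh_eq]
  nlinarith [Real.exp_pos u, Real.exp_pos (-u), mul_nonneg hu (Real.exp_pos (-u)).le]

lemma norm_Gamma_mul_cosh_ge (t : ℝ) :
    1 / 2 ≤ ‖Gamma (1 + t * I)‖ * Real.cosh (Real.pi * t / 2) := by
  rcases eq_or_ne t 0 with rfl | ht
  · norm_num
  have htI : (t : ℂ) * I ≠ 0 := mul_ne_zero (ofReal_ne_zero.mpr ht) I_ne_zero
  have e1 := Gamma_mul_Gamma_one_sub (t * I)
  have e2 : Gamma (1 + t * I) = t * I * Gamma (t * I) := by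
    rw [add_comm, Gamma_add_one _ htI]
  have e3 : ‖Gamma (1 - t * I)‖ = ‖Gamma (1 + t * I)‖ := by
    rw [← norm_conj (Gamma (1 + t * I)), ← Gamma_conj]
    congr 2
    simp [sub_eq_add_neg]
  have e4 : sin (Real.pi * (t * I)) = ((Real.sinh (Real.pi * t) : ℝ) : ℂ) * I := by
    rw [← mul_assoc, ← ofReal_mul, sin_mul_I]; push_cast; rfl
  have hpt : Real.pi * t ≠ 0 := mul_ne_zero Real.pi_ne_zero ht
  have hsinh : Real.sinh (Real.pi * t) ≠ 0 := by simpa using hpt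
  have e5 := congrArg norm e1
  rw [norm_mul, e3, e4, norm_div, norm_mul, norm_I, norm_real, norm_real, mul_one,
    eq_div_iff (by simpa using hpt)] at e5
  have e6 : ‖Gamma (1 + t * I)‖ = |t| * ‖Gamma (t * I)‖ := by
    rw [e2, norm_mul, norm_mul, norm_I, norm_real, mul_one, Real.norm_eq_abs]
  set G := ‖Gamma (1 + t * I)‖
  set u := |Real.pi * t / 2| with hu
  have hG0 : 0 ≤ G := norm_nonneg _
  have hupos : 0 < u := by
    rw [hu, abs_pos]; exact div_ne_zero hpt two_ne_zero
  have e7 : |Real.sinh (Real.pi * t)| = 2 * Real.sinh u * Real.cosh u := by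
    rw [Real.abs_sinh, ← Real.sinh_two_mul, hu, show |Real.pi * t| = 2 * |Real.pi * t / 2| by
      rw [abs_div]; norm_num; ring]
  have e8 : G ^ 2 * |Real.sinh (Real.pi * t)| = 2 * u := by
    have hu2 : 2 * u = |t| * Real.pi := by
      rw [hu, abs_div, abs_mul, abs_of_pos Real.pi_pos]; norm_num; ring
    rw [Real.norm_eq_abs, Real.norm_eq_abs, abs_of_pos Real.pi_pos] at e5
    rw [hu2]
    linear_combination (G * |Real.sinh (Real.pi * t)|) * e6 + |t| * e5
  have e9 : Real.cosh (Real.pi * t / 2) = Real.cosh u := by rw [hu, Real.cosh_abs]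
  rw [e7] at e8
  rw [e9]
  have hs := Real.sinh_pos_iff.mpr hupos
  have hc := Real.cosh_pos u
  have hle := sinh_le_two_mul_mul_cosh hupos.le
  have hsq : (1 / 2 : ℝ) ≤ (G * Real.cosh u) ^ 2 := by
    have : (G * Real.cosh u) ^ 2 * Real.sinh u = u * Real.cosh u := by
      nlinarith [e8]
    nlinarith
  nlinarith [mul_nonneg hG0 hc.le]

lemma norm_riemannZeta_neg_one_ge (t : ℝ) :
    1 / 128 * √(1 + t ^ 2) ≤ ‖riemannZeta (-1 + t * I)‖ := by
  have hre : ((2 : ℂ) - t * I).re = 2 := by simp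
  have hs1 : (2 : ℂ) - t * I ≠ 1 := fun h ↦ by
    have := congrArg re h; rw [hre] at this; norm_num at this
  have hfe := riemannZeta_one_sub' (s := 2 - t * I) (by rw [hre]; norm_num) hs1
  rw [show (1 : ℂ) - (2 - t * I) = -1 + t * I by ring] at hfe
  have hcos : ‖cos (Real.pi * (2 - t * I) / 2)‖ = Real.cosh (Real.pi * (-t) / 2) := by
    have : (Real.pi * (2 - t * I) / 2 : ℂ) = Real.pi - ((Real.pi * t / 2 : ℝ) : ℂ) * I := by
      push_cast; ring
    rw [this, cos_pi_sub, cos_mul_I, norm_neg, ← ofReal_cosh, norm_real,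
      Real.norm_of_nonneg (Real.cosh_pos _).le, ← Real.cosh_neg]
    congr 1; ring
  have hG : Gamma (2 - t * I) = (1 + ((-t : ℝ) : ℂ) * I) * Gamma (1 + ((-t : ℝ) : ℂ) * I) := by
    rw [← Gamma_add_one]
    · congr 1; push_cast; ring
    · intro h; have := congrArg re h; simp at this
  have hn : ‖(1 + ((-t : ℝ) : ℂ) * I)‖ = √(1 + t ^ 2) := by
    rw [← ofReal_one, norm_add_mul_I]; norm_num
  have hgc := norm_Gamma_mul_cosh_ge (-t)
  have hz := norm_riemannZeta_ge (s := 2 - t * I) hre.ge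
  have hp := norm_two_pi_cpow_ge (s := 2 - t * I) hre.le
  rw [hfe]
  simp only [norm_mul, norm_ofNat]
  rw [hcos, hG, norm_mul, hn]
  calc 1 / 128 * √(1 + t ^ 2) = (2 * (1 / 64) * √(1 + t ^ 2)) * (1 / 2) * (1 / 2) := by ring
    _ ≤ (2 * ‖(2 * Real.pi : ℂ) ^ (-(2 - t * I))‖ * √(1 + t ^ 2)) *
        (‖Gamma (1 + ((-t : ℝ) : ℂ) * I)‖ * Real.cosh (Real.pi * (-t) / 2)) *
        ‖riemannZeta (2 - t * I)‖ := by gcongr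
    _ = _ := by ring

/-- Dividing out a finite set of zeros. -/
lemma exists_eq_mul_prod_sub {f : ℂ → ℂ} {U : Set ℂ} (hU : IsOpen U) (hf : DifferentiableOn ℂ f U)
    (S : Finset ℂ) (hS : ∀ ρ ∈ S, ρ ∈ U ∧ f ρ = 0) :
    ∃ g : ℂ → ℂ, DifferentiableOn ℂ g U ∧ ∀ z, f z = g z * ∏ ρ ∈ S, (z - ρ) := by
  classical
  induction S using Finset.induction_on with
  | empty => exact ⟨f, hf, by simp⟩
  | insert a S ha ih =>
    obtain ⟨g, hg, hfg⟩ := ih fun ρ hρ ↦ hS ρ (Finset.mem_insert_of_mem hρ)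
    obtain ⟨haU, hfa⟩ := hS a (Finset.mem_insert_self a S)
    have hga : g a = 0 := by
      rw [hfg, mul_eq_zero] at hfa
      refine hfa.resolve_right (Finset.prod_ne_zero_iff.mpr fun ρ hρ h ↦ ha ?_)
      rwa [sub_eq_zero.mp h]
    refine ⟨dslope g a, (differentiableOn_dslope (hU.mem_nhds haU)).mpr hg, fun z ↦ ?_⟩
    have h := sub_smul_dslope g a z
    rw [hga, sub_zero, smul_eq_mul] at h
    rw [hfg, Finset.prod_insert ha, ← h]
    ring

/-- A zero-free function on a disc, bounded above, is bounded below on smaller discs. -/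
lemma norm_ge_of_ne_zero {h : ℂ → ℂ} {R M : ℝ} (hR : 0 < R) (hM : 0 < M)
    (hd : DifferentiableOn ℂ h (Metric.ball 0 R)) (hM' : ∀ z ∈ Metric.ball 0 R, ‖h z‖ ≤ M)
    (h0 : ∀ z ∈ Metric.ball 0 R, h z ≠ 0) {z : ℂ} (hz : ‖z‖ < R) {a : ℝ} (ha : 0 < a)
    (haM : a < M) (ha0 : a ≤ ‖h 0‖) :
    a * (a / M) ^ (2 * ‖z‖ / (R - ‖z‖)) ≤ ‖h z‖ := by
  have hd' : DifferentiableOn ℂ (fun z ↦ deriv h z / h z) (Metric.ball 0 R) :=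
    (hd.deriv Metric.isOpen_ball).div hd h0
  obtain ⟨L, hL0, hL⟩ := hd'.isExactOn_ball.with_val_at 0 0
  have hmem0 : (0 : ℂ) ∈ Metric.ball (0 : ℂ) R := Metric.mem_ball_self hR
  have hE : ∀ w ∈ Metric.ball (0 : ℂ) R, h w = h 0 * exp (L w) := by
    have hder : ∀ w ∈ Metric.ball (0 : ℂ) R,
        HasDerivAt (fun w ↦ h w * exp (-L w)) 0 w := by
      intro w hw
      have h1 := (hd.differentiableAt (Metric.isOpen_ball.mem_nhds hw)).hasDerivAt
      have h2 := (hL w hw).fun_neg.cexp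
      refine (h1.mul h2).congr_deriv ?_
      have := h0 w hw
      field_simp
      ring
    intro w hw
    have hc := (convex_ball (0 : ℂ) R).is_const_of_fderivWithin_eq_zero (𝕜 := ℂ)
      (f := fun w ↦ h w * exp (-L w))
      (fun u hu ↦ (hder u hu).differentiableAt.differentiableWithinAt)
      (fun u hu ↦ by
        rw [fderivWithin_of_isOpen Metric.isOpen_ball hu]
        ext
        simp [(hder u hu).hasFDerivAt.fderiv]) hw hmem0
    simp only [hL0, neg_zero, exp_zero, mul_one] at hc
    rw [← hc, mul_assoc, ← exp_add]
    simp
  have hA : 0 < Real.log (M / a) := Real.log_pos ((one_lt_div ha).mpr haM)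
  have hre : MapsTo L (Metric.ball 0 R) {z | z.re ≤ Real.log (M / a)} := by
    intro w hw
    have h1 := hM' w hw
    rw [hE w hw, norm_mul, norm_exp] at h1
    rw [mem_ofPred_eq, Real.le_log_iff_exp_le (by positivity), le_div_iff₀ ha]
    nlinarith [Real.exp_pos (L w).re]
  have hb := borelCaratheodory_zero hA
    (fun w hw ↦ (hL w hw).differentiableAt.differentiableWithinAt) hre hR
    (mem_ball_zero_iff.mpr hz) hL0
  rw [hE z (mem_ball_zero_iff.mpr hz), norm_mul, norm_exp]
  have h3 : (a / M) ^ (2 * ‖z‖ / (R - ‖z‖)) ≤ Real.exp (L z).re := by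
    rw [Real.rpow_def_of_pos (by positivity)]
    gcongr
    rw [show Real.log (a / M) = -Real.log (M / a) by rw [← Real.log_inv, inv_div]]
    have := neg_abs_le (L z).re
    have h4 := abs_re_le_norm (L z)
    have : 2 * Real.log (M / a) * ‖z‖ / (R - ‖z‖) =
      Real.log (M / a) * (2 * ‖z‖ / (R - ‖z‖)) := by ring
    linarith
  gcongr

/-- A quantitative Blaschke factorization: bounds the number of zeros in a disc and gives a lower
bound away from them. -/
lemma card_zeros_and_norm_ge {f : ℂ → ℂ} {U : Set ℂ} (hU : IsOpen U) (hf : DifferentiableOn ℂ f U)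
    {r R M a : ℝ} (hr : 0 < r) (hrR : r < R) (hRU : Metric.closedBall 0 R ⊆ U)
    (hM : ∀ z ∈ Metric.closedBall 0 R, ‖f z‖ ≤ M) (ha : 0 < a) (haM : a < M) (ha0 : a ≤ ‖f 0‖)
    (S : Finset ℂ) (hS : ∀ ρ ∈ S, ‖ρ‖ ≤ r ∧ f ρ = 0) :
    a * (R / r) ^ S.card ≤ M ∧
      ((∀ ρ, ‖ρ‖ < r → f ρ = 0 → ρ ∈ S) → (∀ ρ ∈ S, deriv f ρ ≠ 0) →
        ∀ z, ‖z‖ < r → a * (a / M) ^ (2 * ‖z‖ / (r - ‖z‖)) * ∏ ρ ∈ S, (‖z - ρ‖ / (2 * R)) ≤ ‖f z‖) := by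
  have hR : 0 < R := hr.trans hrR
  have hM0 : 0 < M := ha.trans haM
  obtain ⟨g, hg, hfg⟩ := exists_eq_mul_prod_sub hU hf S fun ρ hρ ↦
    ⟨hRU (mem_closedBall_zero_iff.mpr ((hS ρ hρ).1.trans hrR.le)), (hS ρ hρ).2⟩
  set D : ℂ → ℂ → ℂ := fun ρ z ↦ (R ^ 2 - (starRingEnd ℂ) ρ * z) / R with hD
  have hRC : (R : ℂ) ≠ 0 := ofReal_ne_zero.mpr hR.ne'
  set h : ℂ → ℂ := fun z ↦ g z * ∏ ρ ∈ S, D ρ z with hh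
  have hdprod : Differentiable ℂ fun z ↦ ∏ ρ ∈ S, D ρ z := by
    simp only [hD]; fun_prop
  have hhd : DifferentiableOn ℂ h U := hg.mul hdprod.differentiableOn
  have hDsphere : ∀ ρ z, ‖z‖ = R → ‖D ρ z‖ = ‖z - ρ‖ := by
    intro ρ z hz
    have : (R : ℂ) ^ 2 = z * (starRingEnd ℂ) z := by
      rw [mul_conj, normSq_eq_norm_sq, hz]; push_cast; rfl
    rw [hD]
    simp only
    rw [this, show z * (starRingEnd ℂ) z - (starRingEnd ℂ) ρ * z = z * (starRingEnd ℂ) (z - ρ) by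
      rw [map_sub]; ring, norm_div, norm_mul, norm_conj, hz, norm_real, Real.norm_of_nonneg hR.le]
    field_simp
  have hhM : ∀ z ∈ Metric.closedBall (0 : ℂ) R, ‖h z‖ ≤ M := by
    intro z hz
    refine norm_le_of_forall_mem_frontier_norm_le (U := Metric.ball 0 R) Metric.isBounded_ball
      ?_ ?_ (by rwa [closure_ball _ hR.ne'])
    · exact (hhd.mono hRU).diffContOnCl_ball subset_rfl
    · intro w hw
      rw [frontier_ball _ hR.ne', mem_sphere_zero_iff_norm] at hw
      have : ‖h w‖ = ‖f w‖ := by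
        rw [hfg, hh, norm_mul, norm_mul, norm_prod, norm_prod]
        congr 1
        exact Finset.prod_congr rfl fun ρ _ ↦ hDsphere ρ w hw
      rw [this]
      exact hM w (mem_closedBall_zero_iff.mpr hw.le)
  have hh0 : ‖h 0‖ = ‖g 0‖ * R ^ S.card := by
    have : ∀ ρ, ‖D ρ 0‖ = R := by
      intro ρ
      simp only [hD, mul_zero, sub_zero]
      rw [pow_two, mul_div_cancel_right₀ _ hRC, norm_real, Real.norm_of_nonneg hR.le]
    simp [hh, this]
  have hf0 : ‖f 0‖ ≤ ‖g 0‖ * r ^ S.card := by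
    rw [hfg, norm_mul, norm_prod]
    gcongr
    calc ∏ ρ ∈ S, ‖0 - ρ‖ ≤ ∏ ρ ∈ S, r :=
          Finset.prod_le_prod (fun _ _ ↦ norm_nonneg _) fun ρ hρ ↦ by simpa using (hS ρ hρ).1
      _ = _ := by simp
  have hah0 : a * (R / r) ^ S.card ≤ ‖h 0‖ := by
    rw [hh0, div_pow, ← mul_div_assoc, div_le_iff₀ (by positivity)]
    calc a * R ^ S.card ≤ (‖g 0‖ * r ^ S.card) * R ^ S.card := by
          gcongr; exact ha0.trans hf0
      _ = _ := by ring
  refine ⟨hah0.trans (hhM 0 (by simp [hR.le])), fun hall hsimple z hz ↦ ?_⟩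
  have hDne : ∀ ρ ∈ S, ∀ w, ‖w‖ ≤ R → D ρ w ≠ 0 := by
    intro ρ hρ w hw h0
    simp only [hD, div_eq_zero_iff, hRC, or_false] at h0
    have h1 : ‖(R : ℂ) ^ 2‖ = ‖(starRingEnd ℂ) ρ * w‖ := by rw [sub_eq_zero.mp h0]
    rw [norm_pow, norm_real, Real.norm_of_nonneg hR.le, norm_mul, norm_conj] at h1
    nlinarith [(hS ρ hρ).1, norm_nonneg ρ, norm_nonneg w]
  have hgne : ∀ w ∈ Metric.ball (0 : ℂ) r, g w ≠ 0 := by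
    intro w hw h0
    rw [mem_ball_zero_iff] at hw
    have hfw : f w = 0 := by rw [hfg, h0, zero_mul]
    have hwS := hall w hw hfw
    apply hsimple w hwS
    have hwU : U ∈ 𝓝 w := hU.mem_nhds (hRU (mem_closedBall_zero_iff.mpr (hw.le.trans hrR.le)))
    have h1 := (hg.differentiableAt hwU).hasDerivAt
    have h2 : HasDerivAt (fun z ↦ ∏ ρ ∈ S, (z - ρ)) (deriv (fun z ↦ ∏ ρ ∈ S, (z - ρ)) w) w := by
      refine DifferentiableAt.hasDerivAt ?_
      fun_prop
    have h3 := h1.mul h2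
    have h4 : ∏ ρ ∈ S, (w - ρ) = 0 := Finset.prod_eq_zero hwS (sub_self w)
    rw [h0, h4, mul_zero, zero_mul, add_zero] at h3
    rw [funext hfg]
    exact h3.deriv
  have hlow := norm_ge_of_ne_zero (h := h) hr hM0
    (hhd.mono ((Metric.ball_subset_closedBall.trans (Metric.closedBall_subset_closedBall hrR.le)).trans hRU))
    (fun w hw ↦ hhM w (mem_closedBall_zero_iff.mpr ((mem_ball_zero_iff.mp hw).le.trans hrR.le)))
    (fun w hw ↦ mul_ne_zero (hgne w hw) (Finset.prod_ne_zero_iff.mpr fun ρ hρ ↦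
      hDne ρ hρ w ((mem_ball_zero_iff.mp hw).le.trans hrR.le))) hz ha haM
    (le_trans (le_mul_of_one_le_right ha.le (one_le_pow₀ ((one_le_div hr).mpr hrR.le))) hah0)
  have hfz : ‖f z‖ = ‖h z‖ * ∏ ρ ∈ S, (‖z - ρ‖ / ‖D ρ z‖) := by
    rw [Finset.prod_div_distrib, hfg, hh, norm_mul, norm_mul, norm_prod, norm_prod]
    have : ∏ ρ ∈ S, ‖D ρ z‖ ≠ 0 := Finset.prod_ne_zero_iff.mpr fun ρ hρ ↦
      norm_ne_zero_iff.mpr (hDne ρ hρ z (hz.le.trans hrR.le))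
    field_simp
  rw [hfz]
  gcongr with ρ hρ
  · exact norm_pos_iff.mpr (hDne ρ hρ z (hz.le.trans hrR.le))
  · simp only [hD]
    rw [norm_div, norm_real, Real.norm_of_nonneg hR.le, div_le_iff₀ hR]
    calc _ ≤ ‖(R : ℂ) ^ 2‖ + ‖(starRingEnd ℂ) ρ * z‖ := norm_sub_le _ _
      _ ≤ R ^ 2 + R * R := by
          rw [norm_pow, norm_real, Real.norm_of_nonneg hR.le, norm_mul, norm_conj]
          gcongr
          · exact (hS ρ hρ).1.trans hrR.le
          · exact hz.le.trans hrR.le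
      _ = _ := by ring

lemma norm_riemannZeta_shift_le {t : ℝ} (ht : 2 ≤ |t|) {z : ℂ} (hz : ‖z‖ ≤ 7 / 4) :
    2 + t * I + z ≠ 1 ∧ ‖riemannZeta (2 + t * I + z)‖ ≤ 8 * (4 + |t|) := by
  have h1 := abs_le.mp ((abs_re_le_norm z).trans hz)
  have h2 := (abs_im_le_norm z).trans hz
  have him : (2 + t * I + z - 1).im = t + z.im := by simp
  have h3 : 1 / 4 ≤ ‖2 + t * I + z - 1‖ := by
    refine le_trans ?_ (abs_im_le_norm _)
    rw [him]
    have := abs_sub_abs_le_abs_sub t (-z.im)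
    rw [abs_neg, sub_neg_eq_add] at this
    linarith
  refine ⟨fun h ↦ ?_, ?_⟩
  · rw [h] at h3; norm_num at h3
  · refine (norm_riemannZeta_le (by simp; linarith) h3).trans ?_
    gcongr
    calc _ ≤ ‖(2 : ℂ)‖ + ‖(t : ℂ) * I‖ + ‖z‖ := norm_add₃_le
      _ ≤ _ := by simp; linarith

lemma differentiableOn_riemannZeta_shift (c : ℂ) :
    DifferentiableOn ℂ (fun z ↦ riemannZeta (c + z)) {z | c + z ≠ 1} := fun z hz ↦
  ((differentiableAt_riemannZeta hz).comp z (by fun_prop)).differentiableWithinAt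

lemma isOpen_shift_ne_one (c : ℂ) : IsOpen {z : ℂ | c + z ≠ 1} :=
  isOpen_ne_fun (by fun_prop) (by fun_prop)

/-- The number of zeros on a unit segment of the critical line is logarithmic in the height. -/
lemma card_zeros_le {t : ℝ} (ht : 2 ≤ |t|) (S : Finset ℝ)
    (hS : ∀ γ ∈ S, |γ - t| ≤ 1 / 2 ∧ riemannZeta (1 / 2 + γ * I) = 0) :
    (S.card : ℝ) ≤ 14 * Real.log (16 * (4 + |t|)) := by
  classical
  set e : ℝ → ℂ := fun γ ↦ -(3 / 2) + ((γ - t : ℝ) : ℂ) * I with he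
  have hinj : Function.Injective e := by
    intro x y h
    have := congrArg im h
    simpa [he] using this
  have h := (card_zeros_and_norm_ge (f := fun z ↦ riemannZeta (2 + t * I + z)) (r := 13 / 8)
    (R := 7 / 4) (M := 8 * (4 + |t|)) (a := 1 / 2)
    (isOpen_shift_ne_one _) (differentiableOn_riemannZeta_shift _) (by norm_num) (by norm_num)
    (fun z hz ↦ (norm_riemannZeta_shift_le ht (by simpa using hz)).1)
    (fun z hz ↦ (norm_riemannZeta_shift_le ht (by simpa using hz)).2) (by norm_num)
    (by linarith) (norm_riemannZeta_ge (by simp)) (S.image e) (by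
      intro ρ hρ
      obtain ⟨γ, hγ, rfl⟩ := Finset.mem_image.mp hρ
      obtain ⟨h1, h2⟩ := hS γ hγ
      refine ⟨?_, ?_⟩
      · have : e γ = ((-(3 / 2) : ℝ) : ℂ) + ((γ - t : ℝ) : ℂ) * I := by simp [he]
        rw [this, norm_add_mul_I, Real.sqrt_le_left (by norm_num)]
        nlinarith [abs_le.mp h1, sq_abs (γ - t), abs_nonneg (γ - t)]
      · rw [← h2]; congr 1; simp [he]; ring)).1
  rw [Finset.card_image_of_injective _ hinj] at h
  have h2 : ((7 / 4 / (13 / 8) : ℝ)) ^ S.card ≤ 16 * (4 + |t|) := by linarith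
  have h3 := Real.log_le_log (by positivity) h2
  rw [Real.log_pow] at h3
  have h4 : (1 / 14 : ℝ) ≤ Real.log (7 / 4 / (13 / 8)) := by
    have := Real.one_sub_inv_le_log_of_pos (x := (7 / 4 / (13 / 8) : ℝ)) (by norm_num)
    refine le_trans ?_ this
    norm_num
  have h5 : (S.card : ℝ) * (1 / 14) ≤ S.card * Real.log (7 / 4 / (13 / 8)) := by gcongr
  linarith

lemma finite_zeros (V : ℝ) : {γ : ℝ | |γ| ≤ V ∧ riemannZeta (1 / 2 + γ * I) = 0}.Finite := by
  have h := (isCompact_closedBall (0 : ℂ) (1 / 2 + V)).inter_riemannZetaZeros_finite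
  have hinj : Function.Injective fun γ : ℝ ↦ (1 / 2 + γ * I : ℂ) := by
    intro x y h
    have := congrArg im h
    simpa using this
  refine (h.preimage (f := fun γ : ℝ ↦ (1 / 2 + γ * I : ℂ)) hinj.injOn).subset fun γ hγ ↦ ?_
  refine ⟨?_, hγ.2⟩
  rw [mem_closedBall_zero_iff]
  refine (norm_add_le _ _).trans ?_
  simpa using hγ.1

/-- Away from the zeros, `ζ` is not too small. -/
lemma norm_riemannZeta_ge_of_gap
    (hRH : ∀ ρ : ℂ, riemannZeta ρ = 0 → 0 < ρ.re → ρ.re < 1 → ρ.re = 1 / 2)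
    (hsimple : ∀ ρ : ℂ, riemannZeta ρ = 0 → 0 < ρ.re → ρ.re < 1 → deriv riemannZeta ρ ≠ 0)
    {t δ : ℝ} (ht : 2 ≤ |t|) (hδ : 0 < δ) (hδ1 : δ ≤ 1)
    (hgap : ∀ γ : ℝ, riemannZeta (1 / 2 + γ * I) = 0 → δ ≤ |γ - t|) {σ : ℝ} (hσ : 1 / 2 ≤ σ)
    (hσ2 : σ ≤ 2) :
    1 / 2 * (1 / (16 * (4 + |t|))) ^ (24 : ℝ) *
      (2 * δ / 7) ^ (14 * Real.log (16 * (4 + |t|))) ≤ ‖riemannZeta (σ + t * I)‖ := by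
  classical
  set c : ℂ := 2 + t * I with hc
  have hfin : {z : ℂ | ‖z‖ ≤ 13 / 8 ∧ riemannZeta (c + z) = 0}.Finite := by
    have h := (isCompact_closedBall c (13 / 8)).inter_riemannZetaZeros_finite
    refine (h.preimage (f := fun z ↦ c + z) (add_right_injective c).injOn).subset fun z hz ↦ ?_
    exact ⟨by simpa using hz.1, hz.2⟩
  set S := hfin.toFinset with hS
  have hmem : ∀ ρ, ρ ∈ S ↔ ‖ρ‖ ≤ 13 / 8 ∧ riemannZeta (c + ρ) = 0 := by simp [hS]
  have hre : ∀ ρ ∈ S, 0 < (c + ρ).re ∧ (c + ρ).re < 1 := by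
    intro ρ hρ
    obtain ⟨h1, h2⟩ := (hmem ρ).mp hρ
    refine re_mem_of_riemannZeta_eq_zero ?_ h2
    have := abs_le.mp ((abs_re_le_norm ρ).trans h1)
    simp [hc]; linarith
  have hform : ∀ ρ ∈ S, c + ρ = 1 / 2 + ((c + ρ).im : ℂ) * I ∧
      riemannZeta (1 / 2 + ((c + ρ).im : ℂ) * I) = 0 := by
    intro ρ hρ
    have h2 := ((hmem ρ).mp hρ).2
    have h3 := hRH _ h2 (hre ρ hρ).1 (hre ρ hρ).2
    have h4 : c + ρ = 1 / 2 + ((c + ρ).im : ℂ) * I := by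
      conv_lhs => rw [← re_add_im (c + ρ), h3]
      push_cast; rfl
    exact ⟨h4, h4 ▸ h2⟩
  have h := card_zeros_and_norm_ge (f := fun z ↦ riemannZeta (c + z)) (r := 13 / 8)
    (R := 7 / 4) (M := 8 * (4 + |t|)) (a := 1 / 2)
    (isOpen_shift_ne_one _) (differentiableOn_riemannZeta_shift _) (by norm_num) (by norm_num)
    (fun z hz ↦ (norm_riemannZeta_shift_le ht (by simpa using hz)).1)
    (fun z hz ↦ (norm_riemannZeta_shift_le ht (by simpa using hz)).2) (by norm_num)
    (by linarith) (norm_riemannZeta_ge (by simp [hc])) S (fun ρ hρ ↦ (hmem ρ).mp hρ)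
  obtain ⟨hcard, hlow⟩ := h
  have hz : ‖((σ - 2 : ℝ) : ℂ)‖ ≤ 3 / 2 := by
    rw [norm_real, Real.norm_eq_abs, abs_le]; constructor <;> linarith
  have hlow' := hlow (fun ρ h1 h2 ↦ (hmem ρ).mpr ⟨h1.le, h2⟩)
    (fun ρ hρ ↦ by
      rw [deriv_comp_const_add]
      exact hsimple _ ((hmem ρ).mp hρ).2 (hre ρ hρ).1 (hre ρ hρ).2)
    ((σ - 2 : ℝ) : ℂ) (hz.trans_lt (by norm_num))
  have hcz : c + ((σ - 2 : ℝ) : ℂ) = σ + t * I := by rw [hc]; push_cast; ring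
  simp only [hcz] at hlow'
  refine le_trans ?_ hlow'
  have hX : (1 : ℝ) ≤ 16 * (4 + |t|) := by linarith
  have e1 : (1 / 2 / (8 * (4 + |t|)) : ℝ) = 1 / (16 * (4 + |t|)) := by field_simp; norm_num
  rw [e1]
  have hcardR : (S.card : ℝ) ≤ 14 * Real.log (16 * (4 + |t|)) := by
    have h2 : ((7 / 4 / (13 / 8) : ℝ)) ^ S.card ≤ 16 * (4 + |t|) := by linarith
    have h3 := Real.log_le_log (by positivity) h2
    rw [Real.log_pow] at h3
    have h4 : (1 / 14 : ℝ) ≤ Real.log (7 / 4 / (13 / 8)) := by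
      have := Real.one_sub_inv_le_log_of_pos (x := (7 / 4 / (13 / 8) : ℝ)) (by norm_num)
      refine le_trans ?_ this
      norm_num
    have h5 : (S.card : ℝ) * (1 / 14) ≤ S.card * Real.log (7 / 4 / (13 / 8)) := by gcongr
    linarith
  gcongr ?_ * ?_ * ?_
  · refine Real.rpow_le_rpow_of_exponent_ge (by positivity) ?_ ?_
    · rw [div_le_one (by linarith)]; exact hX
    · rw [div_le_iff₀ (by linarith)]; linarith
  · calc (2 * δ / 7) ^ (14 * Real.log (16 * (4 + |t|))) ≤ (2 * δ / 7) ^ (S.card : ℝ) :=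
          Real.rpow_le_rpow_of_exponent_ge (by positivity) (by linarith) hcardR
      _ = ∏ ρ ∈ S, (2 * δ / 7) := by rw [Finset.prod_const, Real.rpow_natCast]
      _ ≤ _ := by
          refine Finset.prod_le_prod (fun _ _ ↦ by positivity) fun ρ hρ ↦ ?_
          have h1 := hgap _ (hform ρ hρ).2
          have h2 := abs_im_le_norm (((σ - 2 : ℝ) : ℂ) - ρ)
          have h3 : (((σ - 2 : ℝ) : ℂ) - ρ).im = -((c + ρ).im - t) := by simp [hc]
          rw [h3, abs_neg] at h2
          rw [div_le_div_iff₀ (by norm_num) (by norm_num)]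
          linarith

lemma exists_gap {n : ℕ} (hn : 2 ≤ n) : ∃ t δ : ℝ, n ≤ t ∧ t ≤ n + 1 ∧ δ ≤ 1 ∧
    1 / (32 * (16 * (4 + t))) ≤ δ ∧
    ∀ γ : ℝ, riemannZeta (1 / 2 + γ * I) = 0 → δ ≤ |γ - t| := by
  classical
  have hn2 : (2 : ℝ) ≤ n := by exact_mod_cast hn
  set S := ((finite_zeros (n + 1)).toFinset).filter fun γ ↦ (n : ℝ) ≤ γ with hS
  have hmem : ∀ γ, γ ∈ S ↔ (|γ| ≤ n + 1 ∧ riemannZeta (1 / 2 + γ * I) = 0) ∧ (n : ℝ) ≤ γ := by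
    simp [hS]
  have hcard := card_zeros_le (t := n + 1 / 2) (by rw [abs_of_pos] <;> linarith) S (by
    intro γ hγ
    obtain ⟨⟨h1, h2⟩, h3⟩ := (hmem γ).mp hγ
    refine ⟨?_, h2⟩
    have := abs_le.mp h1
    rw [abs_le]; constructor <;> linarith)
  rw [abs_of_pos (by positivity)] at hcard
  set m := S.card with hm
  obtain ⟨j, hj, hjS⟩ : ∃ j ∈ Finset.range (m + 1), j ∉ S.image fun γ : ℝ ↦ ⌊(γ - n) * (m + 1)⌋₊ := by
    by_contra! hall
    have h1 := Finset.card_le_card (s := Finset.range (m + 1)) hall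
    have h2 := Finset.card_image_le (s := S) (f := fun γ : ℝ ↦ ⌊(γ - n) * (m + 1)⌋₊)
    rw [Finset.card_range] at h1
    omega
  have hjm : (j : ℝ) + 1 ≤ m + 1 := by
    have := Finset.mem_range.mp hj
    exact_mod_cast this
  have hm1 : (0 : ℝ) < m + 1 := by positivity
  have hj0 : (0 : ℝ) ≤ j := j.cast_nonneg
  set t : ℝ := n + (j + 1 / 2) / (m + 1) with ht
  have ht0 : (n : ℝ) ≤ t := by rw [ht]; have : 0 ≤ ((j : ℝ) + 1 / 2) / (m + 1) := by positivity
                               linarith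
  have ht1 : t ≤ n + 1 := by
    have : ((j : ℝ) + 1 / 2) / (m + 1) ≤ 1 := by rw [div_le_one hm1]; linarith
    rw [ht]; linarith
  refine ⟨t, 1 / (2 * (m + 1)), ht0, ht1, ?_, ?_, ?_⟩
  · rw [div_le_one (by positivity)]; linarith
  · gcongr 1 / ?_
    have h1 := Real.log_le_sub_one_of_pos (x := 16 * (4 + ((n : ℝ) + 1 / 2))) (by positivity)
    linarith
  · intro γ hγ
    by_contra! hlt
    rw [lt_div_iff₀ (by positivity)] at hlt
    have hlt' : |(γ - n) * (m + 1) - (j + 1 / 2)| < 1 / 2 := by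
      have : (γ - n) * (m + 1) - (j + 1 / 2) = (γ - t) * (m + 1) := by
        rw [ht]; field_simp; ring
      rw [this, abs_mul, abs_of_pos hm1]
      linarith
    obtain ⟨h1, h2⟩ := abs_lt.mp hlt'
    have hγn : (n : ℝ) ≤ γ := by
      by_contra! hh
      nlinarith
    have hγn1 : γ ≤ n + 1 := by
      by_contra! hh
      nlinarith
    apply hjS
    rw [Finset.mem_image]
    refine ⟨γ, (hmem γ).mpr ⟨⟨?_, hγ⟩, hγn⟩, ?_⟩
    · rw [abs_of_nonneg (by linarith)]; exact hγn1
    · rw [Nat.floor_eq_iff (by linarith)]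
      constructor <;> linarith

/-- There are heights in every unit interval on which `1/ζ` has at most exponential size. -/
lemma exists_good_height
    (hRH : ∀ ρ : ℂ, riemannZeta ρ = 0 → 0 < ρ.re → ρ.re < 1 → ρ.re = 1 / 2)
    (hsimple : ∀ ρ : ℂ, riemannZeta ρ = 0 → 0 < ρ.re → ρ.re < 1 → deriv riemannZeta ρ ≠ 0)
    {n : ℕ} (hn : 2 ≤ n) : ∃ t : ℝ, n ≤ t ∧ t ≤ n + 1 ∧ ∀ σ : ℝ, -1 ≤ σ → σ ≤ 2 →
      Real.exp (-8000 * t) ≤ ‖riemannZeta (σ + t * I)‖ ∧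
      Real.exp (-8000 * t) ≤ ‖riemannZeta (σ - t * I)‖ := by
  have hn2 : (2 : ℝ) ≤ n := by exact_mod_cast hn
  obtain ⟨t, δ, h1, h2, hδ1, hδ, hgap⟩ := exists_gap hn
  have ht2 : 2 ≤ t := hn2.trans h1
  have hδ0 : 0 < δ := lt_of_lt_of_le (by positivity) hδ
  set X := 16 * (4 + t) with hX
  have hX0 : 0 < X := by positivity
  have hX48 : X ≤ 48 * t := by rw [hX]; linarith
  have hright : ∀ σ : ℝ, 1 / 2 ≤ σ → σ ≤ 2 →
      Real.exp (-(7990 * t)) ≤ ‖riemannZeta (σ + t * I)‖ := by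
    intro σ hσ hσ2
    have habs : |t| = t := abs_of_pos (by linarith)
    have h := norm_riemannZeta_ge_of_gap hRH hsimple (by rwa [habs]) hδ0 hδ1 hgap hσ hσ2
    rw [habs, ← hX] at h
    refine le_trans ?_ h
    have hlog0 : 0 ≤ Real.log X := Real.log_nonneg (by rw [hX]; linarith)
    have e1 : (1 : ℝ) / (112 * X) ≤ 2 * δ / 7 := by
      have : (1 : ℝ) / (112 * X) = 2 * (1 / (32 * X)) / 7 := by field_simp; norm_num
      rw [this]; gcongr
    calc Real.exp (-(7990 * t)) ≤ Real.exp (-Real.log 2 - 24 * Real.log X -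
          (14 * Real.log X) * Real.log (112 * X)) := by
          gcongr
          have hl2 := Real.log_two_lt_d9
          have hl112 : Real.log 112 ≤ 7 := by
            rw [Real.log_le_iff_le_exp (by norm_num)]
            calc (112 : ℝ) ≤ 2.7 ^ 7 := by norm_num
              _ ≤ Real.exp 1 ^ 7 := by gcongr; linarith [Real.exp_one_gt_d9]
              _ = _ := by rw [← Real.exp_nat_mul]; norm_num
          rw [Real.log_mul (by norm_num) hX0.ne']
          have hlX : Real.log X ≤ 2 * √X := by
            have := Real.log_le_sub_one_of_pos (x := √X) (by positivity)
            rw [Real.log_sqrt hX0.le] at this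
            linarith
          have hlX2 : Real.log X * Real.log X ≤ 4 * X := by
            nlinarith [Real.sq_sqrt hX0.le, Real.sqrt_nonneg X]
          have hlX1 : Real.log X ≤ X / 8 + 2 := by
            have := Real.log_le_sub_one_of_pos (x := X / 8) (by positivity)
            have h8 : Real.log 8 ≤ 3 := by
              rw [Real.log_le_iff_le_exp (by norm_num)]
              calc (8 : ℝ) ≤ 2.7 ^ 3 := by norm_num
                _ ≤ Real.exp 1 ^ 3 := by gcongr; linarith [Real.exp_one_gt_d9]
                _ = _ := by rw [← Real.exp_nat_mul]; norm_num
            rw [Real.log_div hX0.ne' (by norm_num)] at this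
            linarith
          nlinarith
      _ = 1 / 2 * (1 / X) ^ (24 : ℝ) * (1 / (112 * X)) ^ (14 * Real.log X) := by
          rw [Real.rpow_def_of_pos (by positivity), Real.rpow_def_of_pos (by positivity),
            one_div X, one_div (112 * X), Real.log_inv, Real.log_inv, sub_eq_add_neg, sub_eq_add_neg,
            Real.exp_add, Real.exp_add, Real.exp_neg (Real.log 2), Real.exp_log (by norm_num)]
          ring_nf
      _ ≤ _ := by gcongr
  have hall : ∀ σ : ℝ, -1 ≤ σ → σ ≤ 2 → Real.exp (-8000 * t) ≤ ‖riemannZeta (σ + t * I)‖ := by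
    intro σ hσ hσ2
    rcases le_total (1 / 2) σ with h | h
    · refine le_trans ?_ (hright σ h hσ2)
      gcongr; linarith
    · have hfe := norm_riemannZeta_one_sub_ge (s := ((1 - σ : ℝ) : ℂ) - t * I)
        (by simp; linarith) (by simp; linarith)
        (by simp; rw [abs_of_pos] <;> linarith)
      rw [show (1 : ℂ) - (((1 - σ : ℝ) : ℂ) - t * I) = σ + t * I by push_cast; ring] at hfe
      refine le_trans ?_ hfe
      have h3 := hright (1 - σ) (by linarith) (by linarith)
      rw [← norm_conj, ← riemannZeta_conj] at h3
      have hcj : (starRingEnd ℂ) (((1 - σ : ℝ) : ℂ) + t * I) = ((1 - σ : ℝ) : ℂ) - t * I := by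
        rw [map_add, map_mul, conj_ofReal, conj_ofReal, conj_I]; ring
      rw [hcj] at h3
      have him : |((((1 - σ : ℝ) : ℂ) - t * I).im)| = t := by simp; linarith
      rw [him]
      calc Real.exp (-8000 * t) ≤ Real.exp (-4) * Real.exp (-Real.pi * t) * Real.exp (-(7990 * t)) := by
            rw [← Real.exp_add, ← Real.exp_add]
            gcongr
            nlinarith [Real.pi_lt_four]
        _ ≤ _ := by
            gcongr
            rw [Real.exp_neg, inv_le_comm₀ (Real.exp_pos _) (by norm_num)]
            calc _ ≤ (2.7 : ℝ) ^ 4 := by norm_num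
                _ ≤ Real.exp 1 ^ 4 := by gcongr; linarith [Real.exp_one_gt_d9]
                _ = _ := by rw [← Real.exp_nat_mul]; norm_num
  refine ⟨t, h1, h2, fun σ hσ hσ2 ↦ ⟨hall σ hσ hσ2, ?_⟩⟩
  have h3 := hall σ hσ hσ2
  rw [← norm_conj, ← riemannZeta_conj] at h3
  have hcj : (starRingEnd ℂ) ((σ : ℂ) + t * I) = (σ : ℂ) - t * I := by
    rw [map_add, map_mul, conj_ofReal, conj_ofReal, conj_I]; ring
  rwa [hcj] at h3

/-- The smooth cutoff `π^{-1/2} ∫_{-T}^T exp((s - iu)²) du`, an entire function close to the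
indicator function of `|Im s| ≤ T` in vertical strips. -/
noncomputable def gaussCutoff (T : ℝ) (s : ℂ) : ℂ :=
  (1 / √Real.pi : ℝ) * ∫ u in (-T)..T, cexp ((s - u * I) ^ 2)

lemma differentiable_gaussCutoff (T : ℝ) : Differentiable ℂ (gaussCutoff T) := by
  obtain ⟨E, hE⟩ := (show Differentiable ℂ (fun z : ℂ ↦ cexp (z ^ 2)) by fun_prop).isExactOn_univ
  have hE' : ∀ z, HasDerivAt E (cexp (z ^ 2)) z := fun z ↦ hE z (mem_univ z)
  have hEd : Differentiable ℂ E := fun z ↦ (hE' z).differentiableAt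
  have h : gaussCutoff T = fun s ↦ (1 / √Real.pi : ℝ) * (I * E (s - T * I) - I * E (s + T * I)) := by
    ext s
    rw [gaussCutoff, intervalIntegral.integral_eq_sub_of_hasDerivAt
      (f := fun u : ℝ ↦ I * E (s - u * I))]
    · push_cast; ring_nf
    · intro u _
      have h1 : HasDerivAt (fun u : ℝ ↦ s - u * I) (-I) u := by
        simpa using ((hasDerivAt_id u).ofReal_comp.mul_const I).const_sub s
      have h2 := ((hE' (s - u * I)).comp u h1).const_mul I
      refine h2.congr_deriv ?_
      linear_combination (-cexp ((s - u * I) ^ 2)) * I_mul_I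
    · exact Continuous.intervalIntegrable (by fun_prop) _ _
  rw [h]
  fun_prop

lemma norm_cexp_sq (a t u : ℝ) :
    ‖cexp ((a + t * I - u * I) ^ 2)‖ = Real.exp (a ^ 2) * Real.exp (-(t - u) ^ 2) := by
  rw [norm_exp, ← Real.exp_add]
  congr 1
  rw [show (a + t * I - u * I : ℂ) = a + ((t - u : ℝ) : ℂ) * I by push_cast; ring, pow_two]
  simp
  ring

lemma integrable_cexp_sq (s : ℂ) : Integrable fun u : ℝ ↦ cexp ((s - u * I) ^ 2) := by
  have h2 := integrable_cexp_quadratic (b := 1) (by simp) (-2 * I * s) (s ^ 2)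
  refine h2.congr (ae_of_all _ fun u ↦ ?_)
  simp only
  congr 1
  linear_combination (-u ^ 2) * I_sq

lemma integral_cexp_sq (s : ℂ) : ∫ u : ℝ, cexp ((s - u * I) ^ 2) = (√Real.pi : ℝ) := by
  have h2 := integral_cexp_quadratic (b := -1) (by simp) (-2 * I * s) (s ^ 2)
  have h3 : (fun u : ℝ ↦ cexp ((s - u * I) ^ 2)) =
      fun u : ℝ ↦ cexp (-1 * u ^ 2 + -2 * I * s * u + s ^ 2) := by
    ext u
    congr 1
    linear_combination (u ^ 2) * I_sq
  rw [h3, h2]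
  have : s ^ 2 - (-2 * I * s) ^ 2 / (4 * -1) = 0 := by
    linear_combination (s ^ 2) * I_sq
  rw [this, exp_zero, mul_one, neg_neg, div_one, Real.sqrt_eq_rpow, ofReal_cpow Real.pi_pos.le]
  norm_num

lemma norm_setIntegral_cexp_sq_le {A : Set ℝ} (hA : MeasurableSet A) {a t d : ℝ} (hd : 0 ≤ d)
    (h : ∀ u ∈ A, d ≤ |t - u|) :
    ‖∫ u in A, cexp ((a + t * I - u * I) ^ 2)‖ ≤
      Real.exp (a ^ 2) * Real.exp (-d ^ 2 / 2) * √(2 * Real.pi) := by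
  have hint : Integrable fun u : ℝ ↦ Real.exp (-(1 / 2) * (t - u) ^ 2) :=
    (integrable_exp_neg_mul_sq (b := 1 / 2) (by norm_num)).comp_sub_left t
  have hval : ∫ u : ℝ, Real.exp (-(1 / 2) * (t - u) ^ 2) = √(2 * Real.pi) := by
    rw [integral_sub_left_eq_self (fun u : ℝ ↦ Real.exp (-(1 / 2) * u ^ 2)) volume t,
      integral_gaussian]
    congr 1; ring
  calc ‖∫ u in A, cexp ((a + t * I - u * I) ^ 2)‖
      ≤ ∫ u in A, Real.exp (a ^ 2) * Real.exp (-d ^ 2 / 2) * Real.exp (-(1 / 2) * (t - u) ^ 2) := by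
        refine norm_integral_le_of_norm_le (hint.const_mul _).integrableOn ?_
        refine (ae_restrict_iff' hA).mpr (ae_of_all _ fun u hu ↦ ?_)
        rw [norm_cexp_sq]
        simp only [← Real.exp_add]
        rw [Real.exp_le_exp]
        have := pow_le_pow_left₀ hd (h u hu) 2
        rw [sq_abs] at this
        linarith
    _ ≤ ∫ u, Real.exp (a ^ 2) * Real.exp (-d ^ 2 / 2) * Real.exp (-(1 / 2) * (t - u) ^ 2) :=
        setIntegral_le_integral (hint.const_mul _) (ae_of_all _ fun u ↦ by positivity)
    _ = _ := by rw [integral_const_mul, hval]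

lemma sqrt_two_pi_div : 1 / √Real.pi * √(2 * Real.pi) = √2 := by
  rw [Real.sqrt_mul (by norm_num)]
  have := Real.sqrt_pos.mpr Real.pi_pos
  field_simp

lemma gaussCutoff_eq_setIntegral {T : ℝ} (hT : 0 ≤ T) (s : ℂ) :
    gaussCutoff T s = (1 / √Real.pi : ℝ) * ∫ u in Ioc (-T) T, cexp ((s - u * I) ^ 2) := by
  rw [gaussCutoff, intervalIntegral.integral_of_le (by linarith)]

lemma norm_gaussCutoff_le {T : ℝ} (hT : 0 ≤ T) (a t : ℝ) {d : ℝ} (hd : 0 ≤ d) (h : d ≤ |t| - T ∨ d = 0) :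
    ‖gaussCutoff T (a + t * I)‖ ≤ √2 * Real.exp (a ^ 2) * Real.exp (-d ^ 2 / 2) := by
  rw [gaussCutoff_eq_setIntegral hT, norm_mul, norm_real, Real.norm_of_nonneg (by positivity),
    ← sqrt_two_pi_div]
  have := norm_setIntegral_cexp_sq_le (A := Ioc (-T) T) measurableSet_Ioc (a := a) (t := t) hd (by
    intro u hu
    rcases h with h | h
    · have h1 : |u| ≤ T := abs_le.mpr ⟨hu.1.le, hu.2⟩
      linarith [abs_sub_abs_le_abs_sub t u]
    · rw [h]; positivity)
  calc _ ≤ 1 / √Real.pi * (Real.exp (a ^ 2) * Real.exp (-d ^ 2 / 2) * √(2 * Real.pi)) := by gcongr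
    _ = _ := by ring

lemma norm_gaussCutoff_sub_one_le {T : ℝ} (hT : 0 ≤ T) (a t : ℝ) (h : |t| ≤ T) :
    ‖gaussCutoff T (a + t * I) - 1‖ ≤ √2 * Real.exp (a ^ 2) * Real.exp (-(T - |t|) ^ 2 / 2) := by
  have h1 := integral_add_compl (measurableSet_Ioc (a := -T) (b := T)) (integrable_cexp_sq (a + t * I))
  rw [integral_cexp_sq] at h1
  have hpi : (√Real.pi : ℂ) ≠ 0 := ofReal_ne_zero.mpr (Real.sqrt_pos.mpr Real.pi_pos).ne'
  have h2 : gaussCutoff T (a + t * I) - 1 =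
      -((1 / √Real.pi : ℝ) * ∫ u in (Ioc (-T) T)ᶜ, cexp ((a + t * I - u * I) ^ 2)) := by
    rw [gaussCutoff_eq_setIntegral hT, eq_sub_of_add_eq h1]
    push_cast
    field_simp
    ring
  rw [h2, norm_neg, norm_mul, norm_real, Real.norm_of_nonneg (by positivity), ← sqrt_two_pi_div]
  have := norm_setIntegral_cexp_sq_le (A := (Ioc (-T) T)ᶜ) measurableSet_Ioc.compl (a := a) (t := t)
    (sub_nonneg.mpr h) (by
      intro u hu
      have h1 : T ≤ |u| := by
        by_contra! hlt
        exact hu ⟨(abs_lt.mp hlt).1, (abs_lt.mp hlt).2.le⟩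
      rw [abs_sub_comm]
      linarith [abs_sub_abs_le_abs_sub u t])
  calc _ ≤ 1 / √Real.pi * (Real.exp (a ^ 2) * Real.exp (-(T - |t|) ^ 2 / 2) * √(2 * Real.pi)) := by
        gcongr
    _ = _ := by ring

lemma norm_gaussCutoff_le_exp {T : ℝ} (hT : 0 ≤ T) (a t : ℝ) :
    ‖gaussCutoff T (a + t * I)‖ ≤
      √2 * Real.exp (a ^ 2) * Real.exp (T ^ 2 / 2) * Real.exp (-(1 / 4) * t ^ 2) := by
  rw [mul_assoc _ (Real.exp (T ^ 2 / 2)), ← Real.exp_add]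
  rcases le_total |t| T with h | h
  · refine (norm_gaussCutoff_le hT a t le_rfl (Or.inr rfl)).trans ?_
    gcongr
    have := pow_le_pow_left₀ (abs_nonneg t) h 2
    rw [sq_abs] at this
    nlinarith
  · refine (norm_gaussCutoff_le hT a t (sub_nonneg.mpr h) (Or.inl le_rfl)).trans ?_
    gcongr
    nlinarith [sq_abs t, sq_nonneg (|t| - 2 * T)]

lemma integrable_gaussCutoff {T : ℝ} (hT : 0 ≤ T) (a : ℝ) :
    Integrable fun t : ℝ ↦ gaussCutoff T (a + t * I) := by
  refine ((integrable_exp_neg_mul_sq (b := 1 / 4) (by norm_num)).const_mul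
    (√2 * Real.exp (a ^ 2) * Real.exp (T ^ 2 / 2))).mono' ?_
    (ae_of_all _ fun t ↦ norm_gaussCutoff_le_exp hT a t)
  have := (differentiable_gaussCutoff T).continuous
  exact Continuous.aestronglyMeasurable (by fun_prop)

/-- The inverse Laplace transform of `gaussCutoff T`. -/
noncomputable def cutoffKernel (T v : ℝ) : ℝ :=
  Real.exp (-(1 / 4) * v ^ 2) * (T / Real.pi) * Real.sinc (T * v)

lemma continuous_cutoffKernel (T : ℝ) : Continuous (cutoffKernel T) := by
  unfold cutoffKernel
  have := Real.continuous_sinc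
  fun_prop

lemma cutoffKernel_neg (T v : ℝ) : cutoffKernel T (-v) = cutoffKernel T v := by
  simp [cutoffKernel]

lemma abs_cutoffKernel_le {T : ℝ} (hT : 0 ≤ T) (v : ℝ) :
    |cutoffKernel T v| ≤ T / Real.pi * Real.exp (-(1 / 4) * v ^ 2) := by
  rw [cutoffKernel, abs_mul, abs_mul, abs_of_pos (Real.exp_pos _),
    abs_of_nonneg (div_nonneg hT Real.pi_pos.le)]
  have := Real.abs_sinc_le_one (T * v)
  calc _ ≤ Real.exp (-(1 / 4) * v ^ 2) * (T / Real.pi) * 1 := by gcongr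
    _ = _ := by ring

lemma integral_cexp_mul_I_eq (T v : ℝ) :
    ∫ u in (-T)..T, cexp (u * v * I) = 2 * T * Real.sinc (T * v) := by
  rcases eq_or_ne v 0 with rfl | hv
  · simp; ring
  have h1 := intervalIntegral.integral_comp_mul_right (a := -T) (b := T)
    (fun t : ℝ ↦ cexp (t * I)) hv
  have h2 := integral_exp_mul_I_eq_sinc (T * v)
  rw [← neg_mul] at h2
  rw [h2] at h1
  have hvC : (v : ℂ) ≠ 0 := ofReal_ne_zero.mpr hv
  calc _ = ∫ u in (-T)..T, cexp (((u * v : ℝ) : ℂ) * I) := by simp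
    _ = _ := by
      rw [h1, real_smul]
      push_cast
      field_simp

lemma exp_neg_sub_sq_le (t u : ℝ) :
    Real.exp (-(t - u) ^ 2) ≤ Real.exp (-(1 / 2) * t ^ 2) * Real.exp (u ^ 2) := by
  rw [← Real.exp_add, Real.exp_le_exp]
  nlinarith [sq_nonneg (t - 2 * u)]

lemma integral_gaussCutoff_mul_exp {T : ℝ} (hT : 0 ≤ T) (a v : ℝ) :
    ∫ t : ℝ, cexp (v * (a + t * I)) * gaussCutoff T (a + t * I) =
      2 * Real.pi * cutoffKernel T v := by
  have hint : Integrable (Function.uncurry fun t u : ℝ ↦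
      cexp (v * (a + t * I)) * cexp ((a + t * I - u * I) ^ 2))
      (volume.prod (volume.restrict (Ioc (-T) T))) := by
    refine Integrable.mono' (g := fun z : ℝ × ℝ ↦ (Real.exp (v * a) * Real.exp (a ^ 2) *
      Real.exp (-(1 / 2) * z.1 ^ 2)) * Real.exp (z.2 ^ 2)) ?_ ?_ (ae_of_all _ fun z ↦ ?_)
    · refine Integrable.mul_prod (f := fun t : ℝ ↦ Real.exp (v * a) * Real.exp (a ^ 2) *
        Real.exp (-(1 / 2) * t ^ 2)) (g := fun u : ℝ ↦ Real.exp (u ^ 2)) ?_ ?_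
      · exact (integrable_exp_neg_mul_sq (by norm_num)).const_mul _
      · exact Continuous.integrableOn_Ioc (by fun_prop)
    · exact Continuous.aestronglyMeasurable (by unfold Function.uncurry; fun_prop)
    · simp only [Function.uncurry]
      rw [norm_mul, norm_cexp_sq, norm_exp]
      have : ((v : ℂ) * (a + z.1 * I)).re = v * a := by simp
      rw [this]
      calc _ ≤ Real.exp (v * a) * (Real.exp (a ^ 2) *
            (Real.exp (-(1 / 2) * z.1 ^ 2) * Real.exp (z.2 ^ 2))) := by
            gcongr; exact exp_neg_sub_sq_le _ _
        _ = _ := by ring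
  have hswap := integral_integral_swap hint
  have hinner : ∀ u : ℝ, ∫ t : ℝ, cexp (v * (a + t * I)) * cexp ((a + t * I - u * I) ^ 2) =
      (√Real.pi * Real.exp (-(1 / 4) * v ^ 2) : ℝ) * cexp (u * v * I) := by
    intro u
    have h2 := integral_cexp_quadratic (b := -1) (by simp) (2 * I * (a - u * I) + I * v)
      ((a - u * I) ^ 2 + v * a)
    have h3 : (fun t : ℝ ↦ cexp (v * (a + t * I)) * cexp ((a + t * I - u * I) ^ 2)) =
        fun t : ℝ ↦ cexp (-1 * t ^ 2 + (2 * I * (a - u * I) + I * v) * t +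
          ((a - u * I) ^ 2 + v * a)) := by
      ext t
      rw [← exp_add]
      congr 1
      linear_combination (t ^ 2) * I_sq
    rw [h3, h2]
    have : (a - u * I : ℂ) ^ 2 + v * a - (2 * I * (a - u * I) + I * v) ^ 2 / (4 * -1) =
        ((-(1 / 4) * v ^ 2 : ℝ) : ℂ) + u * v * I := by
      push_cast
      linear_combination (a - u * I + v / 2) ^ 2 * I_sq
    have e1 : (Real.pi : ℂ) ^ (1 / 2 : ℂ) = (√Real.pi : ℝ) := by
      rw [Real.sqrt_eq_rpow, ofReal_cpow Real.pi_pos.le]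
      norm_num
    rw [this, exp_add, neg_neg, div_one, e1]
    push_cast
    ring
  have hout : ∀ t : ℝ, cexp (v * (a + t * I)) * gaussCutoff T (a + t * I) =
      (1 / √Real.pi : ℝ) *
        ∫ u in Ioc (-T) T, cexp (v * (a + t * I)) * cexp ((a + t * I - u * I) ^ 2) := by
    intro t
    rw [gaussCutoff_eq_setIntegral hT, integral_const_mul]
    ring
  simp_rw [hout]
  rw [integral_const_mul, hswap]
  simp_rw [hinner]
  rw [integral_const_mul, ← intervalIntegral.integral_of_le (by linarith), integral_cexp_mul_I_eq,
    cutoffKernel]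
  have hpi : (Real.pi : ℂ) ≠ 0 := ofReal_ne_zero.mpr Real.pi_ne_zero
  have hpi2 : (√Real.pi : ℂ) ≠ 0 := ofReal_ne_zero.mpr (Real.sqrt_pos.mpr Real.pi_pos).ne'
  push_cast
  field_simp

lemma integral_exp_mul_cutoffKernel {T : ℝ} (hT : 0 ≤ T) (α : ℝ) :
    ∫ v : ℝ, (Real.exp (-α * v) * cutoffKernel T v : ℝ) = gaussCutoff T α := by
  have hint : Integrable (Function.uncurry fun v u : ℝ ↦
      cexp (-(1 / 4) * v ^ 2 + -α * v + 0) * cexp (u * v * I))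
      (volume.prod (volume.restrict (Ioc (-T) T))) := by
    refine Integrable.mono' (g := fun z : ℝ × ℝ ↦ ‖cexp (-(1 / 4) * z.1 ^ 2 + -α * z.1 + 0)‖ * 1)
      ?_ ?_ (ae_of_all _ fun z ↦ ?_)
    · refine Integrable.mul_prod (f := fun v : ℝ ↦ ‖cexp (-(1 / 4) * v ^ 2 + -α * v + 0)‖)
        (g := fun u : ℝ ↦ (1 : ℝ)) ?_ ?_
      · exact (integrable_cexp_quadratic (b := 1 / 4) (by norm_num) (-α) 0).norm
      · exact integrable_const _
    · exact Continuous.aestronglyMeasurable (by unfold Function.uncurry; fun_prop)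
    · simp only [Function.uncurry]
      rw [norm_mul, ← ofReal_mul, norm_exp_ofReal_mul_I]
  have hswap := integral_integral_swap hint
  have hinner : ∀ u : ℝ, ∫ v : ℝ, cexp (-(1 / 4) * v ^ 2 + -α * v + 0) * cexp (u * v * I) =
      (2 * √Real.pi : ℝ) * cexp ((α - u * I) ^ 2) := by
    intro u
    have h2 := integral_cexp_quadratic (b := -(1 / 4)) (by norm_num) (-α + u * I) 0
    have h3 : (fun v : ℝ ↦ cexp (-(1 / 4) * v ^ 2 + -α * v + 0) * cexp (u * v * I)) =
        fun v : ℝ ↦ cexp (-(1 / 4) * v ^ 2 + (-α + u * I) * v + 0) := by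
      ext v
      rw [← exp_add]
      congr 1
      ring
    rw [h3, h2]
    have e1 : (Real.pi / - -(1 / 4) : ℂ) = ((4 * Real.pi : ℝ) : ℂ) := by push_cast; ring
    have e2 : (0 : ℂ) - (-α + u * I) ^ 2 / (4 * -(1 / 4)) = (α - u * I) ^ 2 := by ring
    rw [e1, e2, show (1 / 2 : ℂ) = ((1 / 2 : ℝ) : ℂ) by push_cast; rfl,
      ← ofReal_cpow (by positivity), ← Real.sqrt_eq_rpow, Real.sqrt_mul (by norm_num),
      show (4 : ℝ) = 2 ^ 2 by norm_num, Real.sqrt_sq (by norm_num)]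
  have hout : ∀ v : ℝ, ((Real.exp (-α * v) * cutoffKernel T v : ℝ) : ℂ) =
      (1 / (2 * Real.pi) : ℝ) *
        ∫ u in Ioc (-T) T, cexp (-(1 / 4) * v ^ 2 + -α * v + 0) * cexp (u * v * I) := by
    intro v
    rw [integral_const_mul, ← intervalIntegral.integral_of_le (by linarith),
      integral_cexp_mul_I_eq, cutoffKernel, add_zero, exp_add]
    have hpi : (Real.pi : ℂ) ≠ 0 := ofReal_ne_zero.mpr Real.pi_ne_zero
    push_cast
    field_simp
  rw [← integral_complex_ofReal]
  simp_rw [hout]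
  rw [integral_const_mul, hswap]
  simp_rw [hinner]
  rw [integral_const_mul, gaussCutoff_eq_setIntegral hT]
  have hpi2 : (√Real.pi : ℂ) ≠ 0 := ofReal_ne_zero.mpr (Real.sqrt_pos.mpr Real.pi_pos).ne'
  have hpi3 : (Real.pi : ℂ) = (√Real.pi : ℂ) * √Real.pi := by
    rw [← ofReal_mul, Real.mul_self_sqrt Real.pi_pos.le]
  push_cast
  rw [hpi3]
  field_simp
  simp_rw [mul_comm I]

/-- The smoothed step function obtained from `gaussCutoff` by Perron inversion. -/
noncomputable def smoothStep (α T L : ℝ) : ℝ :=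
  ∫ v in Iic L, Real.exp (-α * v) * cutoffKernel T v

lemma integrable_exp_mul_cutoffKernel {T : ℝ} (hT : 0 ≤ T) (β : ℝ) :
    Integrable fun v : ℝ ↦ Real.exp (β * v) * cutoffKernel T v := by
  have h := (integrable_cexp_quadratic (b := 1 / 4) (by norm_num) β 0).norm.const_mul (T / Real.pi)
  have := continuous_cutoffKernel T
  refine h.mono' (Continuous.aestronglyMeasurable (by fun_prop)) (ae_of_all _ fun v ↦ ?_)
  have hre : (-(1 / 4) * (v : ℂ) ^ 2 + β * v + 0).re = -(1 / 4) * v ^ 2 + β * v := by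
    rw [show (-(1 / 4) * (v : ℂ) ^ 2 + β * v + 0) = ((-(1 / 4) * v ^ 2 + β * v : ℝ) : ℂ) by
      push_cast; ring, ofReal_re]
  rw [norm_exp, hre, norm_mul, Real.norm_of_nonneg (Real.exp_pos _).le, Real.norm_eq_abs,
    Real.exp_add]
  calc _ ≤ Real.exp (β * v) * (T / Real.pi * Real.exp (-(1 / 4) * v ^ 2)) := by
        gcongr; exact abs_cutoffKernel_le hT v
    _ = _ := by ring

lemma integral_perron {T : ℝ} (hT : 0 ≤ T) {α c : ℝ} (hc : α < c) (L : ℝ) :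
    ∫ t : ℝ, cexp (L * (c + t * I - α)) * gaussCutoff T (c + t * I) / (c + t * I - α) =
      2 * Real.pi * smoothStep α T L := by
  have hre : ∀ t : ℝ, (c + t * I - α : ℂ).re = c - α := fun t ↦ by simp
  have hint : Integrable (Function.uncurry fun t v : ℝ ↦
      cexp ((c + t * I - α) * v) * gaussCutoff T (c + t * I))
      (volume.prod (volume.restrict (Iic L))) := by
    have hw := integrable_gaussCutoff hT c
    have he : IntegrableOn (fun v : ℝ ↦ ‖cexp (((c - α : ℝ) : ℂ) * v)‖) (Iic L) :=
      (integrableOn_exp_mul_complex_Iic (by simpa using hc) L).norm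
    refine (hw.norm.mul_prod he).mono' ?_ (ae_of_all _ fun z ↦ ?_)
    · have := (differentiable_gaussCutoff T).continuous
      exact Continuous.aestronglyMeasurable (by unfold Function.uncurry; fun_prop)
    · simp only [Function.uncurry]
      rw [norm_mul, norm_exp, norm_exp, re_mul_ofReal, re_mul_ofReal, hre, ofReal_re, mul_comm]
  have hswap := integral_integral_swap hint
  have h1 : ∀ t : ℝ, cexp (L * (c + t * I - α)) * gaussCutoff T (c + t * I) / (c + t * I - α) =
      ∫ v in Iic L, cexp ((c + t * I - α) * v) * gaussCutoff T (c + t * I) := by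
    intro t
    rw [integral_mul_const, integral_exp_mul_complex_Iic (by rw [hre]; linarith)]
    ring_nf
  have h2 : ∀ v : ℝ, ∫ t : ℝ, cexp ((c + t * I - α) * v) * gaussCutoff T (c + t * I) =
      2 * Real.pi * ((Real.exp (-α * v) * cutoffKernel T v : ℝ) : ℂ) := by
    intro v
    have h3 : ∀ t : ℝ, cexp ((c + t * I - α) * v) * gaussCutoff T (c + t * I) =
        cexp (-α * v) * (cexp (v * (c + t * I)) * gaussCutoff T (c + t * I)) := by
      intro t
      rw [← mul_assoc, ← exp_add]
      ring_nf
    simp_rw [h3]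
    rw [integral_const_mul, integral_gaussCutoff_mul_exp hT]
    push_cast
    ring
  simp_rw [h1]
  rw [hswap]
  simp_rw [h2]
  rw [integral_const_mul, smoothStep, integral_complex_ofReal]

lemma exp_sub_sq_le {β v : ℝ} (hβ : |β| ≤ 1) (hv : 0 ≤ v) :
    Real.exp (β * v - v ^ 2 / 4) ≤ Real.exp 16 * Real.exp (-3 * v) := by
  rw [← Real.exp_add, Real.exp_le_exp]
  have := (abs_le.mp hβ).2
  nlinarith [sq_nonneg (v / 2 - 4), mul_le_mul_of_nonneg_right this hv]

lemma integral_exp_mul_cutoffKernel_Ioi_le {T A β : ℝ} (hT : 1 ≤ T) (hA : 0 < A) (hβ : |β| ≤ 1) :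
    |∫ v in Ioi A, Real.exp (β * v) * cutoffKernel T v| ≤
      2 * Real.exp 16 * (Real.exp (-2 * A) / (T * A)) := by
  have hT0 : 0 < T := by linarith
  set g : ℝ → ℝ := fun v ↦ Real.exp (β * v - v ^ 2 / 4) / (Real.pi * v) with hg
  set g' : ℝ → ℝ := fun v ↦ g v * (β - v / 2 - 1 / v) with hg'
  have hgb : ∀ v, 0 < v → |g v| ≤ Real.exp 16 * Real.exp (-3 * v) / v := by
    intro v hv
    rw [hg, abs_of_nonneg (by positivity)]
    have h1 := exp_sub_sq_le hβ hv.le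
    have h2 : v ≤ Real.pi * v := by nlinarith [Real.pi_gt_three]
    exact div_le_div₀ (by positivity) h1 hv h2
  have hgb' : ∀ v, 0 < v → |g' v| ≤ Real.exp 16 * Real.exp (-2 * v) * v ^ (-2 : ℝ) := by
    intro v hv
    have h1 : |β - v / 2 - 1 / v| ≤ 1 + v / 2 + 1 / v := by
      have := abs_le.mp hβ
      have : 0 < 1 / v := by positivity
      rw [abs_le]; constructor <;> linarith
    have h2 : (1 + v / 2 + 1 / v) * v ≤ Real.exp v := by
      have := Real.quadratic_le_exp_of_nonneg hv.le
      have h3 : 1 / v * v = 1 := by field_simp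
      nlinarith
    have h4 : Real.exp (-2 * v) = Real.exp (-3 * v) * Real.exp v := by
      rw [← Real.exp_add]; ring_nf
    rw [hg', abs_mul, Real.rpow_neg hv.le, Real.rpow_two, h4]
    calc |g v| * |β - v / 2 - 1 / v|
        ≤ (Real.exp 16 * Real.exp (-3 * v) / v) * (1 + v / 2 + 1 / v) := by
          gcongr; exact hgb v hv
      _ = Real.exp 16 * Real.exp (-3 * v) * ((1 + v / 2 + 1 / v) * v) * (v ^ 2)⁻¹ := by
          field_simp
      _ ≤ Real.exp 16 * Real.exp (-3 * v) * Real.exp v * (v ^ 2)⁻¹ := by gcongr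
      _ = _ := by ring
  have hgd : ∀ v, 0 < v → HasDerivAt g (g' v) v := by
    intro v hv
    have h1 : HasDerivAt (fun v : ℝ ↦ β * v - v ^ 2 / 4) (β - v / 2) v := by
      refine (((hasDerivAt_id v).const_mul β).sub (((hasDerivAt_pow 2 v)).div_const 4)).congr_deriv ?_
      simp; ring
    have h2 : HasDerivAt (fun v : ℝ ↦ Real.pi * v) Real.pi v := by
      simpa using (hasDerivAt_id v).const_mul Real.pi
    have hne : Real.pi * v ≠ 0 := (mul_pos Real.pi_pos hv).ne'
    refine (h1.exp.div h2 hne).congr_deriv ?_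
    rw [hg', hg]
    have := Real.pi_ne_zero
    field_simp
  have hcont : ContinuousOn g' (Ioi A) := by
    have h0 : ∀ v ∈ Ioi A, v ≠ 0 := fun v hv ↦ (hA.trans hv).ne'
    have h1 : ∀ v ∈ Ioi A, Real.pi * v ≠ 0 := fun v hv ↦ mul_ne_zero Real.pi_ne_zero (h0 v hv)
    rw [hg', hg]
    exact (ContinuousOn.div (by fun_prop) (by fun_prop) h1).mul
      ((by fun_prop : ContinuousOn (fun v : ℝ ↦ β - v / 2) (Ioi A)).sub
        (ContinuousOn.div (by fun_prop) (by fun_prop) h0))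
  have hdom : IntegrableOn (fun v : ℝ ↦ Real.exp 16 * Real.exp (-2 * A) * v ^ (-2 : ℝ)) (Ioi A) :=
    (integrableOn_Ioi_rpow_of_lt (by norm_num) hA).const_mul _
  have hdomle : ∀ v ∈ Ioi A, ‖g' v * Real.cos (T * v)‖ ≤
      Real.exp 16 * Real.exp (-2 * A) * v ^ (-2 : ℝ) := by
    intro v hv
    have hv' : A < v := hv
    have hv0 : 0 < v := hA.trans hv'
    rw [norm_mul]
    calc ‖g' v‖ * ‖Real.cos (T * v)‖ ≤ (Real.exp 16 * Real.exp (-2 * v) * v ^ (-2 : ℝ)) * 1 := by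
          gcongr
          · exact hgb' v hv0
          · exact Real.abs_cos_le_one _
      _ ≤ _ := by
          have : Real.exp (-2 * v) ≤ Real.exp (-2 * A) := Real.exp_le_exp.mpr (by linarith)
          rw [mul_one]
          gcongr
  have hint1 : IntegrableOn (fun v ↦ g' v * Real.cos (T * v)) (Ioi A) := by
    refine hdom.mono' ?_ ?_
    · exact (hcont.mul (by fun_prop)).aestronglyMeasurable measurableSet_Ioi
    · exact (ae_restrict_iff' measurableSet_Ioi).mpr (ae_of_all _ hdomle)
  have hint2 : IntegrableOn (fun v ↦ Real.exp (β * v) * cutoffKernel T v) (Ioi A) :=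
    (integrable_exp_mul_cutoffKernel hT0.le β).integrableOn
  have heq : ∀ v, 0 < v → Real.exp (β * v) * cutoffKernel T v = g v * Real.sin (T * v) := by
    intro v hv
    have hne : T * v ≠ 0 := (mul_pos hT0 hv).ne'
    have := Real.pi_ne_zero
    rw [hg, cutoffKernel, Real.sinc_of_ne_zero hne]
    have e : Real.exp (β * v - v ^ 2 / 4) = Real.exp (β * v) * Real.exp (-(1 / 4) * v ^ 2) := by
      rw [← Real.exp_add]; ring_nf
    simp only [e]
    field_simp
  have hFTC := integral_Ioi_of_hasDerivAt_of_tendsto' (a := A) (m := 0)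
    (f := fun v ↦ -(g v * Real.cos (T * v) / T))
    (f' := fun v ↦ Real.exp (β * v) * cutoffKernel T v - g' v * Real.cos (T * v) / T)
    (fun v hv ↦ ?_) (hint2.sub (hint1.div_const T)) ?_
  · rw [integral_sub hint2 (hint1.div_const T), integral_div] at hFTC
    have hI : |∫ v in Ioi A, g' v * Real.cos (T * v)| ≤ Real.exp 16 * Real.exp (-2 * A) / A := by
      have h := norm_integral_le_of_norm_le hdom
        ((ae_restrict_iff' measurableSet_Ioi).mpr (ae_of_all _ hdomle))
      rw [integral_const_mul, integral_Ioi_rpow_of_lt (by norm_num) hA] at h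
      refine h.trans (le_of_eq ?_)
      norm_num [Real.rpow_neg hA.le]
      field_simp
    have hgA : |g A * Real.cos (T * A)| ≤ Real.exp 16 * Real.exp (-2 * A) / A := by
      rw [abs_mul]
      calc _ ≤ (Real.exp 16 * Real.exp (-3 * A) / A) * 1 := by
            gcongr
            · exact hgb A hA
            · exact Real.abs_cos_le_one _
        _ ≤ _ := by
            rw [mul_one]
            gcongr
            norm_num
    have hval : ∫ v in Ioi A, Real.exp (β * v) * cutoffKernel T v =
        ((∫ v in Ioi A, g' v * Real.cos (T * v)) + g A * Real.cos (T * A)) / T := by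
      rw [add_div]
      linarith
    rw [hval, abs_div, abs_of_pos hT0]
    calc _ ≤ (Real.exp 16 * Real.exp (-2 * A) / A + Real.exp 16 * Real.exp (-2 * A) / A) / T := by
          gcongr
          exact (abs_add_le _ _).trans (add_le_add hI hgA)
      _ = _ := by field_simp; ring
  · have hv0 : 0 < v := hA.trans_le hv
    have hc : HasDerivAt (fun v : ℝ ↦ Real.cos (T * v)) (-Real.sin (T * v) * T) v :=
      (by simpa using (hasDerivAt_id v).const_mul T : HasDerivAt (fun v : ℝ ↦ T * v) T v).cos
    refine (((hgd v hv0).mul hc).div_const T).neg.congr_deriv ?_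
    rw [heq v hv0]
    field_simp
    ring
  · have h0 : Tendsto (fun v : ℝ ↦ Real.exp 16 * Real.exp (-v)) atTop (𝓝 0) := by
      simpa using (Real.tendsto_exp_neg_atTop_nhds_zero).const_mul (Real.exp 16)
    refine squeeze_zero_norm' ?_ h0
    filter_upwards [eventually_ge_atTop 1] with v hv
    have hv0 : 0 < v := by linarith
    rw [norm_neg, norm_div, norm_mul, Real.norm_of_nonneg hT0.le]
    calc _ ≤ (Real.exp 16 * Real.exp (-3 * v) / v) * 1 / T := by
          gcongr
          · exact hgb v hv0
          · exact Real.abs_cos_le_one _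
      _ ≤ (Real.exp 16 * Real.exp (-3 * v) / 1) * 1 / 1 := by gcongr
      _ ≤ _ := by
          rw [div_one, div_one, mul_one]
          gcongr
          linarith

lemma abs_smoothStep_le_of_neg {α T L : ℝ} (hα : |α| ≤ 1) (hT : 1 ≤ T) (hL : L < 0) :
    |smoothStep α T L| ≤ 2 * Real.exp 16 * (Real.exp (-2 * |L|) / (T * |L|)) := by
  have h := integral_comp_neg_Iic L fun v ↦ Real.exp (α * v) * cutoffKernel T v
  have h2 : smoothStep α T L = ∫ v in Ioi (-L), Real.exp (α * v) * cutoffKernel T v := by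
    rw [← h, smoothStep]
    simp only [cutoffKernel_neg, mul_neg, neg_mul]
  rw [h2, abs_of_neg hL]
  exact integral_exp_mul_cutoffKernel_Ioi_le hT (by linarith) hα

lemma smoothStep_add_integral_Ioi {α T : ℝ} (hT : 0 ≤ T) (L : ℝ) :
    ((smoothStep α T L + ∫ v in Ioi L, Real.exp (-α * v) * cutoffKernel T v : ℝ) : ℂ) =
      gaussCutoff T α := by
  have hi := integrable_exp_mul_cutoffKernel hT (-α)
  rw [smoothStep, intervalIntegral.integral_Iic_add_Ioi hi.integrableOn hi.integrableOn]
  exact_mod_cast integral_exp_mul_cutoffKernel hT α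

lemma norm_gaussCutoff_ofReal_sub_one_le {α T : ℝ} (hα : |α| ≤ 1) (hT : 1 ≤ T) :
    ‖gaussCutoff T α - 1‖ ≤ 16 / T := by
  have h := norm_gaussCutoff_sub_one_le (T := T) (by linarith) α 0 (by simp; linarith)
  simp only [ofReal_zero, zero_mul, add_zero, abs_zero, sub_zero] at h
  refine h.trans ?_
  have h1 : √2 ≤ 2 := by rw [Real.sqrt_le_left (by norm_num)]; norm_num
  have h2 : Real.exp (α ^ 2) ≤ 4 := by
    have : α ^ 2 ≤ 1 := by rw [← sq_abs]; nlinarith [abs_nonneg α]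
    calc _ ≤ Real.exp 1 := Real.exp_le_exp.mpr this
      _ ≤ 4 := by linarith [Real.exp_one_lt_d9]
  have h3 : Real.exp (-T ^ 2 / 2) ≤ 2 / T := by
    rw [neg_div, Real.exp_neg, inv_le_comm₀ (Real.exp_pos _) (by positivity)]
    have := Real.add_one_le_exp (T ^ 2 / 2)
    rw [inv_div]
    nlinarith [sq_nonneg (T - 1)]
  calc _ ≤ 2 * 4 * (2 / T) := by gcongr
    _ = _ := by ring

lemma abs_smoothStep_sub_one_le_of_pos {α T L : ℝ} (hα : |α| ≤ 1) (hT : 1 ≤ T) (hL : 0 < L) :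
    |smoothStep α T L - 1| ≤ 16 / T + 2 * Real.exp 16 * (Real.exp (-2 * |L|) / (T * |L|)) := by
  have h1 := smoothStep_add_integral_Ioi (α := α) (T := T) (by linarith) L
  have h2 := norm_gaussCutoff_ofReal_sub_one_le hα hT
  rw [← h1, ← ofReal_one, ← ofReal_sub, norm_real, Real.norm_eq_abs] at h2
  have h3 := integral_exp_mul_cutoffKernel_Ioi_le (β := -α) hT hL (by rwa [abs_neg])
  rw [abs_of_pos hL]
  rw [abs_le] at *
  constructor <;> linarith

lemma abs_exp_mul_cutoffKernel_le {α T : ℝ} (hα : |α| ≤ 1) (hT : 0 ≤ T) {v : ℝ} (hv : |v| ≤ 1) :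
    |Real.exp (-α * v) * cutoffKernel T v| ≤ 3 * T := by
  rw [abs_mul, abs_of_pos (Real.exp_pos _)]
  have h1 : Real.exp (-α * v) ≤ 3 := by
    have : -α * v ≤ 1 := by
      refine (le_abs_self _).trans ?_
      rw [abs_mul, abs_neg]
      nlinarith [abs_nonneg α, abs_nonneg v]
    calc _ ≤ Real.exp 1 := Real.exp_le_exp.mpr this
      _ ≤ 3 := by linarith [Real.exp_one_lt_d9]
  have h2 : |cutoffKernel T v| ≤ T := by
    refine (abs_cutoffKernel_le hT v).trans ?_
    have : Real.exp (-(1 / 4) * v ^ 2) ≤ 1 := by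
      rw [Real.exp_le_one_iff]; nlinarith [sq_nonneg v]
    calc _ ≤ T / 1 * 1 := by
          gcongr
          linarith [Real.pi_gt_three]
      _ = T := by ring
  calc _ ≤ 3 * T := by gcongr

lemma exists_abs_smoothStep_le :
    ∃ K : ℝ, 0 < K ∧ ∀ α T L : ℝ, |α| ≤ 1 → 1 ≤ T → |smoothStep α T L| ≤ K := by
  refine ⟨17 + 4 * Real.exp 16 + 3, by positivity, fun α T L hα hT ↦ ?_⟩
  have hT0 : 0 < T := by linarith
  have hfar : ∀ L : ℝ, 1 ≤ T * |L| →
      2 * Real.exp 16 * (Real.exp (-2 * |L|) / (T * |L|)) ≤ 2 * Real.exp 16 := by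
    intro L hL
    have h1 : Real.exp (-2 * |L|) ≤ 1 := by
      rw [Real.exp_le_one_iff]; nlinarith [abs_nonneg L]
    have : Real.exp (-2 * |L|) / (T * |L|) ≤ 1 := (div_le_one (by linarith)).mpr (h1.trans hL)
    nlinarith [Real.exp_pos 16]
  have hneg : ∀ L : ℝ, L < 0 → 1 ≤ T * |L| → |smoothStep α T L| ≤ 2 * Real.exp 16 := fun L h1 h2 ↦
    (abs_smoothStep_le_of_neg hα hT h1).trans (hfar L h2)
  have he := Real.exp_pos 16
  rcases le_or_gt 1 (T * |L|) with h | h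
  · rcases lt_trichotomy L 0 with h0 | rfl | h0
    · linarith [hneg L h0 h]
    · norm_num at h
    · have h1 := abs_smoothStep_sub_one_le_of_pos hα hT h0
      have h2 := hfar L h
      have h3 : 16 / T ≤ 16 := div_le_self (by norm_num) hT
      have h4 : |smoothStep α T L| ≤ |smoothStep α T L - 1| + 1 := by
        simpa using abs_add_le (smoothStep α T L - 1) 1
      linarith
  · have hTi : T * (1 / T) = 1 := by field_simp
    have h1 : |L| < 1 / T := by rw [lt_div_iff₀ hT0]; linarith
    have h1T : 1 / T ≤ 1 := (div_le_one hT0).mpr hT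
    have h2 := hneg (-(1 / T)) (by linarith [one_div_pos.mpr hT0]) (by
      rw [abs_neg, abs_of_pos (by positivity), hTi])
    have hi := integrable_exp_mul_cutoffKernel hT0.le (-α)
    have h3 : smoothStep α T L - smoothStep α T (-(1 / T)) =
        ∫ v in (-(1 / T))..L, Real.exp (-α * v) * cutoffKernel T v :=
      intervalIntegral.integral_Iic_sub_Iic hi.integrableOn hi.integrableOn
    have h4 : |∫ v in (-(1 / T))..L, Real.exp (-α * v) * cutoffKernel T v| ≤
        3 * T * |L - -(1 / T)| := by
      rw [← Real.norm_eq_abs (∫ v in _..L, _)]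
      refine intervalIntegral.norm_integral_le_of_norm_le_const fun v hv ↦ ?_
      rw [Real.norm_eq_abs]
      have hL := abs_lt.mp h1
      rw [uIoc_of_le (by linarith)] at hv
      exact abs_exp_mul_cutoffKernel_le hα hT0.le
        (abs_le.mpr ⟨by linarith [hv.1], by linarith [hv.2, hL.2]⟩)
    have h5 : |L - -(1 / T)| ≤ 2 * (1 / T) := by
      have hL := abs_lt.mp h1
      rw [abs_le]; constructor <;> linarith
    have h6 : 3 * T * |L - -(1 / T)| ≤ 6 := by
      calc _ ≤ 3 * T * (2 * (1 / T)) := by gcongr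
        _ = 6 := by field_simp; norm_num
    rw [← h3] at h4
    have h7 : |smoothStep α T L| ≤
        |smoothStep α T L - smoothStep α T (-(1 / T))| + |smoothStep α T (-(1 / T))| := by
      simpa using abs_add_le (smoothStep α T L - smoothStep α T (-(1 / T)))
        (smoothStep α T (-(1 / T)))
    linarith

lemma norm_moebius_le (n : ℕ) : ‖((ArithmeticFunction.moebius n : ℤ) : ℂ)‖ ≤ 1 := by
  rw [norm_intCast]
  exact_mod_cast ArithmeticFunction.abs_moebius_le_one

lemma one_le_norm_two_add_sub {α : ℝ} (hα : α ≤ 1) (t : ℝ) :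
    1 ≤ ‖((2 : ℝ) + t * I - α : ℂ)‖ := by
  refine le_trans ?_ (abs_re_le_norm _)
  simp
  rw [abs_of_pos] <;> linarith

lemma norm_perronTerm_le {α T : ℝ} (hα : α ≤ 1) (L t : ℝ) :
    ‖cexp (L * ((2 : ℝ) + t * I - α)) * gaussCutoff T ((2 : ℝ) + t * I) /
      ((2 : ℝ) + t * I - α)‖ ≤
      Real.exp (L * (2 - α)) * ‖gaussCutoff T ((2 : ℝ) + t * I)‖ := by
  have h1 := one_le_norm_two_add_sub hα t
  have h2 : ‖cexp (L * ((2 : ℝ) + t * I - α))‖ = Real.exp (L * (2 - α)) := by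
    rw [norm_exp]; simp
  rw [norm_div, norm_mul, h2]
  exact div_le_self (by positivity) h1

lemma integrable_perronTerm {α T : ℝ} (hα : α ≤ 1) (hT : 0 ≤ T) (L : ℝ) :
    Integrable fun t : ℝ ↦ cexp (L * ((2 : ℝ) + t * I - α)) *
      gaussCutoff T ((2 : ℝ) + t * I) / ((2 : ℝ) + t * I - α) := by
  have hc := (differentiable_gaussCutoff T).continuous
  refine ((integrable_gaussCutoff hT 2).norm.const_mul (Real.exp (L * (2 - α)))).mono' ?_
    (ae_of_all _ fun t ↦ norm_perronTerm_le hα L t)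
  refine Continuous.aestronglyMeasurable (Continuous.div (by fun_prop) (by fun_prop) fun t h ↦ ?_)
  have := one_le_norm_two_add_sub hα t
  rw [h, norm_zero] at this
  linarith

lemma norm_moebius_mul_perronTerm_le {α T x : ℝ} (hα : α ≤ 1) (hx : 0 < x) (n : ℕ) (t : ℝ) :
    ‖((ArithmeticFunction.moebius n : ℤ) : ℂ) / ((n : ℝ) ^ α : ℝ) *
      (cexp (Real.log (x / n) * ((2 : ℝ) + t * I - α)) * gaussCutoff T ((2 : ℝ) + t * I) /
      ((2 : ℝ) + t * I - α))‖ ≤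
      x ^ (2 - α) * (1 / (n : ℝ) ^ 2) * ‖gaussCutoff T ((2 : ℝ) + t * I)‖ := by
  rcases Nat.eq_zero_or_pos n with rfl | hn
  · simp
  have hn' : (0 : ℝ) < n := Nat.cast_pos.mpr hn
  have hnα := Real.rpow_pos_of_pos hn' α
  rw [norm_mul, norm_div, norm_real, Real.norm_of_nonneg hnα.le]
  have h1 : Real.exp (Real.log (x / n) * (2 - α)) = x ^ (2 - α) * (1 / (n : ℝ) ^ 2) * (n : ℝ) ^ α := by
    rw [← Real.rpow_def_of_pos (by positivity), Real.div_rpow hx.le hn'.le, Real.rpow_sub hn' 2 α,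
      Real.rpow_two]
    field_simp
  calc _ ≤ 1 / (n : ℝ) ^ α * (Real.exp (Real.log (x / n) * (2 - α)) *
        ‖gaussCutoff T ((2 : ℝ) + t * I)‖) := by
        gcongr
        · exact norm_moebius_le n
        · exact norm_perronTerm_le hα _ t
    _ = _ := by rw [h1]; field_simp

lemma tsum_moebius_mul_perronTerm {α T x : ℝ} (hx : 0 < x) (t : ℝ) :
    ∑' n : ℕ, ((ArithmeticFunction.moebius n : ℤ) : ℂ) / ((n : ℝ) ^ α : ℝ) *
      (cexp (Real.log (x / n) * ((2 : ℝ) + t * I - α)) * gaussCutoff T ((2 : ℝ) + t * I) /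
      ((2 : ℝ) + t * I - α)) =
    (x : ℂ) ^ ((2 : ℝ) + t * I - α : ℂ) * gaussCutoff T ((2 : ℝ) + t * I) /
      (((2 : ℝ) + t * I - α) * riemannZeta ((2 : ℝ) + t * I)) := by
  set s : ℂ := (2 : ℝ) + t * I with hs
  have hre : 1 < s.re := by simp [hs]
  have hmul := riemannZeta_mul_LSeries_moebius hre
  have hζ : riemannZeta s ≠ 0 := left_ne_zero_of_mul_eq_one hmul
  have hL : LSeries (fun n ↦ ((ArithmeticFunction.moebius n : ℤ) : ℂ)) s = (riemannZeta s)⁻¹ :=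
    eq_inv_of_mul_eq_one_right hmul
  have hxC : (x : ℂ) ≠ 0 := ofReal_ne_zero.mpr hx.ne'
  have hterm : ∀ n : ℕ, ((ArithmeticFunction.moebius n : ℤ) : ℂ) / ((n : ℝ) ^ α : ℝ) *
      (cexp (Real.log (x / n) * (s - α)) * gaussCutoff T s / (s - α)) =
      LSeries.term (fun n ↦ ((ArithmeticFunction.moebius n : ℤ) : ℂ)) s n *
        ((x : ℂ) ^ (s - α) * gaussCutoff T s / (s - α)) := by
    intro n
    rw [LSeries.term_def]
    split_ifs with hn
    · simp [hn]
    have hn' : (0 : ℝ) < n := Nat.cast_pos.mpr (Nat.pos_of_ne_zero hn)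
    have hnC : (n : ℂ) ≠ 0 := Nat.cast_ne_zero.mpr hn
    have e1 : cexp (Real.log (x / n) * (s - α)) = (x : ℂ) ^ (s - α) / (n : ℂ) ^ (s - α) := by
      rw [Real.log_div hx.ne' hn'.ne', cpow_def_of_ne_zero hxC, cpow_def_of_ne_zero hnC, ← exp_sub,
        ← ofReal_log hx.le, ← ofReal_natCast, ← ofReal_log hn'.le]
      push_cast
      ring_nf
    have e2 : (((n : ℝ) ^ α : ℝ) : ℂ) * (n : ℂ) ^ (s - α) = (n : ℂ) ^ s := by
      rw [ofReal_cpow hn'.le, ofReal_natCast, ← cpow_add _ _ hnC]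
      ring_nf
    rw [e1, ← e2]
    ring
  simp_rw [hterm]
  rw [tsum_mul_right, show ∑' n, LSeries.term (fun n ↦ ((ArithmeticFunction.moebius n : ℤ) : ℂ)) s n =
    (riemannZeta s)⁻¹ from hL]
  field_simp

lemma hasSum_moebius_mul_smoothStep {α T x : ℝ} (hα : α ≤ 1) (hT : 0 ≤ T) (hx : 0 < x) :
    HasSum (fun n : ℕ ↦ ((ArithmeticFunction.moebius n : ℤ) : ℂ) / ((n : ℝ) ^ α : ℝ) *
      (2 * Real.pi * smoothStep α T (Real.log (x / n))))
      (∫ t : ℝ, (x : ℂ) ^ ((2 : ℝ) + t * I - α : ℂ) * gaussCutoff T ((2 : ℝ) + t * I) /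
        (((2 : ℝ) + t * I - α) * riemannZeta ((2 : ℝ) + t * I))) := by
  have hint : ∀ n : ℕ, Integrable fun t : ℝ ↦
      ((ArithmeticFunction.moebius n : ℤ) : ℂ) / ((n : ℝ) ^ α : ℝ) *
      (cexp (Real.log (x / n) * ((2 : ℝ) + t * I - α)) * gaussCutoff T ((2 : ℝ) + t * I) /
      ((2 : ℝ) + t * I - α)) := fun n ↦ (integrable_perronTerm hα hT _).const_mul _
  have hsum : Summable fun n : ℕ ↦ ∫ t : ℝ,
      ‖((ArithmeticFunction.moebius n : ℤ) : ℂ) / ((n : ℝ) ^ α : ℝ) *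
      (cexp (Real.log (x / n) * ((2 : ℝ) + t * I - α)) * gaussCutoff T ((2 : ℝ) + t * I) /
      ((2 : ℝ) + t * I - α))‖ := by
    refine Summable.of_nonneg_of_le (fun n ↦ integral_nonneg fun t ↦ norm_nonneg _) (fun n ↦ ?_)
      (((Real.summable_one_div_nat_pow.mpr one_lt_two).mul_left (x ^ (2 - α))).mul_right
        (∫ t : ℝ, ‖gaussCutoff T ((2 : ℝ) + t * I)‖))
    rw [← integral_const_mul]
    exact integral_mono (hint n).norm ((integrable_gaussCutoff hT 2).norm.const_mul _)
      fun t ↦ norm_moebius_mul_perronTerm_le hα hx n t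
  have h := hasSum_integral_of_summable_integral_norm hint hsum
  simp_rw [tsum_moebius_mul_perronTerm hx, integral_const_mul,
    integral_perron hT (show α < 2 by linarith)] at h
  exact h

lemma exp_log_div_le {T y : ℝ} (hT : 1 ≤ T) (hy : 1 < y) :
    Real.exp (-2 * Real.log y) / (T * Real.log y) ≤ 1 / (T * (y * (y - 1))) := by
  have hy0 : 0 < y := by linarith
  have h1 : Real.exp (-2 * Real.log y) = 1 / y ^ 2 := by
    rw [show -2 * Real.log y = -(2 * Real.log y) by ring, Real.exp_neg, two_mul, Real.exp_add,
      Real.exp_log hy0]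
    field_simp
  have h2 : 1 - y⁻¹ ≤ Real.log y := Real.one_sub_inv_le_log_of_pos hy0
  have h3 : 0 < 1 - y⁻¹ := sub_pos.mpr (inv_lt_one_of_one_lt₀ hy)
  have h4 : y - 1 ≠ 0 := (sub_pos.mpr hy).ne'
  rw [h1]
  calc _ ≤ 1 / y ^ 2 / (T * (1 - y⁻¹)) := by gcongr
    _ = _ := by
      rw [show 1 - y⁻¹ = (y - 1) / y by field_simp]
      field_simp

lemma harmonic_eq (N : ℕ) : ((harmonic N : ℚ) : ℝ) = ∑ i ∈ Finset.range N, 1 / ((i : ℝ) + 1) := by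
  rw [harmonic]
  push_cast
  exact Finset.sum_congr rfl fun i _ ↦ by rw [one_div]

lemma sum_one_div_le (N : ℕ) :
    ∑ i ∈ Finset.range N, (1 / (i : ℝ) + 1 / ((N : ℝ) - i)) ≤ 2 * (1 + Real.log N) := by
  have hN := harmonic_le_one_add_log N
  rw [harmonic_eq] at hN
  rw [Finset.sum_add_distrib]
  have h1 : ∑ i ∈ Finset.range N, 1 / ((N : ℝ) - i) =
      ∑ i ∈ Finset.range N, 1 / ((i : ℝ) + 1) := by
    rw [← Finset.sum_range_reflect]
    refine Finset.sum_congr rfl fun i hi ↦ ?_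
    rw [Finset.mem_range] at hi
    rw [show N - 1 - i = N - (i + 1) by omega, Nat.cast_sub (by omega)]
    push_cast
    ring_nf
  have h2 : ∑ i ∈ Finset.range N, 1 / (i : ℝ) ≤ ∑ i ∈ Finset.range N, 1 / ((i : ℝ) + 1) := by
    rcases N with _ | N
    · simp
    rw [Finset.sum_range_succ', Finset.sum_range_succ]
    simp only [Nat.cast_zero, div_zero, add_zero, Nat.cast_add, Nat.cast_one]
    have : 0 ≤ 1 / ((N : ℝ) + 1) := by positivity
    linarith
  linarith

lemma sum_range_one_div_mul_le {N : ℕ} (hN : 0 < N) (M : ℕ) :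
    ∑ m ∈ Finset.range M, 1 / (((m : ℝ) + 1) * (m + 1 + N)) ≤ (1 + Real.log N) / N := by
  have hN' : (0 : ℝ) < N := Nat.cast_pos.mpr hN
  have key : ∑ m ∈ Finset.range M, 1 / (((m : ℝ) + 1) * (m + 1 + N)) =
      (∑ j ∈ Finset.range N, 1 / ((j : ℝ) + 1) -
        ∑ j ∈ Finset.range N, 1 / ((M : ℝ) + 1 + j)) / N := by
    induction M with
    | zero => simp [add_comm]
    | succ M ih =>
      have h1 := Finset.sum_range_sub' (fun j : ℕ ↦ 1 / ((M : ℝ) + 1 + j)) N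
      rw [Finset.sum_sub_distrib] at h1
      have h2 : ∑ j ∈ Finset.range N, 1 / (((M + 1 : ℕ) : ℝ) + 1 + j) =
          ∑ j ∈ Finset.range N, 1 / ((M : ℝ) + 1 + ((j + 1 : ℕ) : ℝ)) :=
        Finset.sum_congr rfl fun j _ ↦ by push_cast; ring_nf
      have h3 : 1 / (((M : ℝ) + 1) * (M + 1 + N)) =
          (1 / ((M : ℝ) + 1 + ((0 : ℕ) : ℝ)) - 1 / ((M : ℝ) + 1 + N)) / N := by
        push_cast
        field_simp
        ring
      rw [Finset.sum_range_succ, ih, h3, h2, ← h1]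
      ring
  have h := harmonic_le_one_add_log N
  rw [harmonic_eq] at h
  rw [key]
  gcongr
  have : 0 ≤ ∑ j ∈ Finset.range N, 1 / ((M : ℝ) + 1 + j) :=
    Finset.sum_nonneg fun j _ ↦ by positivity
  linarith

/-- Uniform bounds for the difference between `smoothStep` and the unit step. -/
lemma exists_smoothStep_bound : ∃ K : ℝ, 1 ≤ K ∧ ∀ α T : ℝ, |α| ≤ 1 → 1 ≤ T →
    (∀ L, |smoothStep α T L| ≤ K) ∧
    (∀ y, 1 < y → |smoothStep α T (Real.log y) - 1| ≤ K / T * (1 + 1 / (y * (y - 1)))) ∧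
    (∀ y, 1 < y → |smoothStep α T (-Real.log y)| ≤ K / T * (1 / (y * (y - 1)))) := by
  obtain ⟨K, hK0, hK⟩ := exists_abs_smoothStep_le
  refine ⟨K + 16 + 2 * Real.exp 16, by linarith [Real.exp_pos 16], fun α T hα hT ↦
    ⟨fun L ↦ ?_, fun y hy ↦ ?_, fun y hy ↦ ?_⟩⟩
  · linarith [hK α T L hα hT, Real.exp_pos 16]
  · have hL := Real.log_pos hy
    have h := abs_smoothStep_sub_one_le_of_pos hα hT hL
    rw [abs_of_pos hL] at h
    have hy' : 0 < y - 1 := by linarith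
    calc _ ≤ 16 / T + 2 * Real.exp 16 * (1 / (T * (y * (y - 1)))) := by
          refine h.trans ?_
          gcongr 16 / T + 2 * Real.exp 16 * ?_
          exact exp_log_div_le hT hy
      _ = 16 / T + 2 * Real.exp 16 / T * (1 / (y * (y - 1))) := by
          field_simp
      _ ≤ (K + 16 + 2 * Real.exp 16) / T +
          (K + 16 + 2 * Real.exp 16) / T * (1 / (y * (y - 1))) := by
          gcongr
          · linarith [Real.exp_pos 16]
          · linarith
      _ = _ := by ring
  · have hL := Real.log_pos hy
    have h := abs_smoothStep_le_of_neg hα hT (neg_lt_zero.mpr hL)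
    rw [abs_neg, abs_of_pos hL] at h
    have hy' : 0 < y - 1 := by linarith
    calc _ ≤ 2 * Real.exp 16 * (1 / (T * (y * (y - 1)))) := by
          refine h.trans ?_
          gcongr 2 * Real.exp 16 * ?_
          exact exp_log_div_le hT hy
      _ = 2 * Real.exp 16 / T * (1 / (y * (y - 1))) := by
          field_simp
      _ ≤ _ := by
          gcongr
          linarith

/-- The main estimate of Perron type: the partial sum and the smoothed sum differ little. -/
lemma exists_norm_Mweight_sub_le : ∃ K : ℝ, 0 ≤ K ∧ ∀ α T x : ℝ, 0 < α → α ≤ 1 → 1 ≤ T → 1 < x →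
    ‖(Mweight α x : ℂ) - 1 / (2 * Real.pi) *
      ∫ t : ℝ, (x : ℂ) ^ ((2 : ℝ) + t * I - α : ℂ) * gaussCutoff T ((2 : ℝ) + t * I) /
        (((2 : ℝ) + t * I - α) * riemannZeta ((2 : ℝ) + t * I))‖ ≤
      K * (x ^ (1 - α) * (1 + Real.log x) / T + x ^ (-α)) := by
  obtain ⟨K, hK1, hK⟩ := exists_smoothStep_bound
  refine ⟨8 * K, by linarith, fun α T x hα0 hα1 hT hx ↦ ?_⟩
  obtain ⟨hKu, hKp, hKn⟩ := hK α T (by rw [abs_of_pos hα0]; exact hα1) hT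
  have hx0 : 0 < x := by linarith
  have hT0 : 0 < T := by linarith
  have hlog : 0 < Real.log x := Real.log_pos hx
  set N := ⌊x⌋₊ with hN
  have hNx : (N : ℝ) ≤ x := Nat.floor_le hx0.le
  have hxN : x < N + 1 := Nat.lt_floor_add_one x
  have hN1 : 1 ≤ N := Nat.le_floor (by exact_mod_cast hx.le)
  have hN1' : (1 : ℝ) ≤ N := by exact_mod_cast hN1
  have hlogN : Real.log N ≤ Real.log x := Real.log_le_log (by linarith) hNx
  have hxα : x ^ (1 - α) = x * x ^ (-α) := by
    rw [sub_eq_add_neg, Real.rpow_add hx0, Real.rpow_one]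
  have hxα0 := Real.rpow_pos_of_pos hx0 (-α)
  set a : ℕ → ℝ := fun n ↦ (ArithmeticFunction.moebius n : ℝ) / (n : ℝ) ^ α with ha
  set S : ℕ → ℝ := fun n ↦ smoothStep α T (Real.log (x / n)) with hS
  have ha_le : ∀ n : ℕ, |a n| ≤ (n : ℝ) ^ (-α) := by
    intro n
    rw [ha, abs_div, abs_of_nonneg (Real.rpow_nonneg (Nat.cast_nonneg n) α),
      Real.rpow_neg (Nat.cast_nonneg n), ← one_div]
    gcongr
    exact_mod_cast ArithmeticFunction.abs_moebius_le_one
  have hsum : HasSum (fun n ↦ ((a n * S n : ℝ) : ℂ)) (1 / (2 * Real.pi) *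
      ∫ t : ℝ, (x : ℂ) ^ ((2 : ℝ) + t * I - α : ℂ) * gaussCutoff T ((2 : ℝ) + t * I) /
        (((2 : ℝ) + t * I - α) * riemannZeta ((2 : ℝ) + t * I))) := by
    have h := (hasSum_moebius_mul_smoothStep hα1 hT0.le hx0).mul_left (1 / (2 * Real.pi) : ℂ)
    refine Eq.mp (congrArg (HasSum · _) (funext fun n ↦ ?_)) h
    have hpi : (Real.pi : ℂ) ≠ 0 := ofReal_ne_zero.mpr Real.pi_ne_zero
    rw [ha, hS]
    push_cast
    field_simp
  have hsummable : Summable fun n ↦ a n * S n := by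
    exact_mod_cast hsum.summable
  rw [← hsum.tsum_eq, ← ofReal_tsum, ← ofReal_sub, norm_real, Real.norm_eq_abs]
  have hM : Mweight α x = ∑ i ∈ Finset.range (N + 1), a i := by
    rw [Mweight, Finset.range_eq_Ico, Finset.sum_eq_sum_Ico_succ_bot (by omega)]
    simp [ha]
    rfl
  rw [hM, ← hsummable.sum_add_tsum_nat_add (N + 2), Finset.sum_range_succ _ (N + 1),
    Finset.sum_range_succ a N, Finset.sum_range_succ _ N]
  -- the terms far below `x`
  have hlow : |∑ i ∈ Finset.range N, (a i - a i * S i)| ≤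
      K / T * x ^ (1 - α) * (2 * (1 + Real.log x)) := by
    refine (Finset.abs_sum_le_sum_abs _ _).trans ?_
    have h1 : ∀ i ∈ Finset.range N, |a i - a i * S i| ≤
        K / T * x ^ (1 - α) * (1 / (i : ℝ) + 1 / ((N : ℝ) - i)) := by
      intro i hi
      rw [Finset.mem_range] at hi
      have hiN : (i : ℝ) + 1 ≤ N := by exact_mod_cast hi
      rcases Nat.eq_zero_or_pos i with rfl | hi0
      · simp only [ha, ArithmeticFunction.map_zero, Int.cast_zero, zero_div, zero_mul, sub_zero,
          abs_zero]
        have : (0 : ℝ) ≤ 1 / ((0 : ℕ) : ℝ) + 1 / ((N : ℝ) - ((0 : ℕ) : ℝ)) := by simp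
        positivity
      have hi0' : (0 : ℝ) < i := Nat.cast_pos.mpr hi0
      have hy : 1 < x / i := by rw [one_lt_div hi0']; linarith
      have h2 := hKp (x / i) hy
      have h3 : (i : ℝ) ^ (-α) ≤ x ^ (1 - α) / i := by
        rw [le_div_iff₀ hi0', ← Real.rpow_add_one hi0'.ne', show -α + 1 = 1 - α by ring]
        exact Real.rpow_le_rpow hi0'.le (by linarith) (by linarith)
      have hxi : 0 < x - i := by linarith
      have hNi : 0 < (N : ℝ) - i := by linarith
      rw [show a i - a i * S i = -(a i * (S i - 1)) by ring, abs_neg, abs_mul]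
      calc _ ≤ x ^ (1 - α) / i * (K / T * (1 + 1 / (x / i * (x / i - 1)))) := by
            gcongr
            exact (ha_le i).trans h3
        _ = K / T * x ^ (1 - α) * (1 / i + i / x * (1 / (x - i))) := by
            rw [show x / i - 1 = (x - i) / i by field_simp]
            field_simp
        _ ≤ K / T * x ^ (1 - α) * (1 / i + 1 * (1 / ((N : ℝ) - i))) := by
            gcongr
            rw [div_le_one hx0]; linarith
        _ = _ := by ring
    refine (Finset.sum_le_sum h1).trans ?_
    rw [← Finset.mul_sum]
    gcongr
    exact (sum_one_div_le N).trans (by linarith)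
  -- the terms next to `x`
  have hnear : ∀ i : ℕ, N ≤ i → |a i| ≤ 2 * x ^ (-α) := by
    intro i hi
    have hi' : (N : ℝ) ≤ i := by exact_mod_cast hi
    refine (ha_le i).trans ?_
    have h1 : (i : ℝ) ^ (-α) ≤ (x / 2) ^ (-α) :=
      Real.rpow_le_rpow_of_nonpos (by linarith) (by linarith) (by linarith)
    rw [Real.div_rpow hx0.le (by norm_num), Real.rpow_neg (by norm_num : (0 : ℝ) ≤ 2),
      div_inv_eq_mul] at h1
    have h2 : (2 : ℝ) ^ α ≤ 2 := by
      calc (2 : ℝ) ^ α ≤ 2 ^ (1 : ℝ) := Real.rpow_le_rpow_of_exponent_le (by norm_num) hα1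
        _ = 2 := Real.rpow_one 2
    nlinarith
  have hnear1 : |a N - a N * S N| ≤ 4 * K * x ^ (-α) := by
    rw [show a N - a N * S N = a N * (1 - S N) by ring, abs_mul]
    have h1 : |1 - S N| ≤ 2 * K := by
      have h0 := hKu (Real.log (x / N))
      rw [abs_le] at h0 ⊢
      constructor <;> simp only [hS] <;> linarith
    calc _ ≤ 2 * x ^ (-α) * (2 * K) := by gcongr; exact hnear N le_rfl
      _ = _ := by ring
  have hnear2 : |a (N + 1) * S (N + 1)| ≤ 2 * K * x ^ (-α) := by
    rw [abs_mul]
    calc _ ≤ 2 * x ^ (-α) * K := by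
          gcongr
          · exact hnear (N + 1) (by omega)
          · exact hKu _
      _ = _ := by ring
  -- the terms far above `x`
  have hhigh : |∑' i, a (i + (N + 2)) * S (i + (N + 2))| ≤
      K / T * x ^ (1 - α) * (2 * (1 + Real.log x)) := by
    have hg0 : ∀ m : ℕ, 0 ≤ 1 / (((m : ℝ) + 1) * (m + 1 + N)) := fun m ↦ by positivity
    have hgs := summable_of_sum_range_le hg0 (sum_range_one_div_mul_le (by omega : 0 < N))
    have hgt := Real.tsum_le_of_sum_range_le hg0 (sum_range_one_div_mul_le (by omega : 0 < N))
    have h1 : ∀ m : ℕ, ‖a (m + (N + 2)) * S (m + (N + 2))‖ ≤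
        K / T * (x ^ (-α) * x ^ 2) * (1 / (((m : ℝ) + 1) * (m + 1 + N))) := by
      intro m
      have hn : ((m + (N + 2) : ℕ) : ℝ) = m + N + 2 := by push_cast; ring
      set n : ℝ := m + N + 2 with hn'
      have hm0 : (0 : ℝ) ≤ m := Nat.cast_nonneg m
      have hnx : m + 1 ≤ n - x := by rw [hn']; linarith
      have hn0 : 0 < n := by linarith
      have hxn : 0 < n - x := by linarith
      have hy : 1 < n / x := by rw [one_lt_div hx0]; linarith
      have h2 := hKn (n / x) hy
      have h3 : S (m + (N + 2)) = smoothStep α T (-Real.log (n / x)) := by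
        simp only [hS]
        rw [hn, ← Real.log_inv, inv_div]
      have h4 : |a (m + (N + 2))| ≤ x ^ (-α) := by
        refine (ha_le _).trans ?_
        rw [hn]
        exact Real.rpow_le_rpow_of_nonpos hx0 (by linarith) (by linarith)
      rw [norm_mul, Real.norm_eq_abs, Real.norm_eq_abs, h3]
      calc _ ≤ x ^ (-α) * (K / T * (1 / (n / x * (n / x - 1)))) := by gcongr
        _ = K / T * (x ^ (-α) * x ^ 2) * (1 / ((n - x) * n)) := by
            rw [show n / x - 1 = (n - x) / x by field_simp]
            field_simp
        _ ≤ _ := by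
            gcongr
            rw [hn']; linarith
    have h5 := tsum_of_norm_bounded (hgs.hasSum.mul_left (K / T * (x ^ (-α) * x ^ 2))) h1
    rw [Real.norm_eq_abs] at h5
    refine h5.trans ?_
    have h6 : x / N ≤ 2 := by rw [div_le_iff₀ (by linarith)]; linarith
    calc _ ≤ K / T * (x ^ (-α) * x ^ 2) * ((1 + Real.log x) / N) := by
          gcongr
          exact hgt.trans (by gcongr)
      _ = K / T * x ^ (1 - α) * (x / N * (1 + Real.log x)) := by
          rw [hxα]; field_simp
      _ ≤ _ := by gcongr
  have hsplit : ∑ i ∈ Finset.range N, a i + a N - (∑ i ∈ Finset.range N, a i * S i + a N * S N +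
      a (N + 1) * S (N + 1) + ∑' i, a (i + (N + 2)) * S (i + (N + 2))) =
      ∑ i ∈ Finset.range N, (a i - a i * S i) + (a N - a N * S N) - a (N + 1) * S (N + 1) -
        ∑' i, a (i + (N + 2)) * S (i + (N + 2)) := by
    rw [Finset.sum_sub_distrib]; ring
  rw [hsplit]
  calc _ ≤ K / T * x ^ (1 - α) * (2 * (1 + Real.log x)) + 4 * K * x ^ (-α) + 2 * K * x ^ (-α) +
        K / T * x ^ (1 - α) * (2 * (1 + Real.log x)) := by
        refine (abs_sub _ _).trans (add_le_add ((abs_sub _ _).trans (add_le_add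
          ((abs_add_le _ _).trans (add_le_add hlow hnear1)) hnear2)) hhigh)
    _ = 4 * K * (x ^ (1 - α) * (1 + Real.log x) / T) + 6 * K * x ^ (-α) := by ring
    _ ≤ 8 * K * (x ^ (1 - α) * (1 + Real.log x) / T) + 8 * K * x ^ (-α) := by
        gcongr <;> norm_num
    _ = _ := by ring

/-- The integral over the boundary of `[a, b] × [c, d]`, traversed counterclockwise. -/
noncomputable def rectIntegral (f : ℂ → ℂ) (a b c d : ℝ) : ℂ :=
  (((∫ x : ℝ in a..b, f (x + c * I)) - ∫ x : ℝ in a..b, f (x + d * I)) +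
    I • ∫ y : ℝ in c..d, f (b + y * I)) - I • ∫ y : ℝ in c..d, f (a + y * I)

/-- The boundary of `[a, b] × [c, d]`. -/
def rectBoundary (a b c d : ℝ) : Set ℂ := (Icc a b ×ℂ Icc c d) \ (Ioo a b ×ℂ Ioo c d)

variable {a b c d : ℝ}

lemma horizontal_mem_rectBoundary (hcd : c < d) {x y : ℝ} (hx : x ∈ Icc a b) (hy : y = c ∨ y = d) :
    (x + y * I : ℂ) ∈ rectBoundary a b c d := by
  refine ⟨⟨by simpa using hx, ?_⟩, fun h ↦ ?_⟩
  · rcases hy with rfl | rfl <;> simp [hcd.le]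
  · have h2 := h.2
    rcases hy with rfl | rfl <;> simp at h2

lemma vertical_mem_rectBoundary (hab : a < b) {x y : ℝ} (hx : x = a ∨ x = b) (hy : y ∈ Icc c d) :
    (x + y * I : ℂ) ∈ rectBoundary a b c d := by
  refine ⟨⟨?_, by simpa using hy⟩, fun h ↦ ?_⟩
  · rcases hx with rfl | rfl <;> simp [hab.le]
  · have h2 := h.1
    rcases hx with rfl | rfl <;> simp at h2

lemma intervalIntegrable_horizontal {f : ℂ → ℂ} (hab : a < b) (hcd : c < d)
    (hf : ContinuousOn f (rectBoundary a b c d)) {y : ℝ} (hy : y = c ∨ y = d) :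
    IntervalIntegrable (fun x : ℝ ↦ f (x + y * I)) volume a b := by
  refine ContinuousOn.intervalIntegrable (hf.comp (by fun_prop) fun x hx ↦ ?_)
  rw [uIcc_of_le hab.le] at hx
  exact horizontal_mem_rectBoundary hcd hx hy

lemma intervalIntegrable_vertical {f : ℂ → ℂ} (hab : a < b) (hcd : c < d)
    (hf : ContinuousOn f (rectBoundary a b c d)) {x : ℝ} (hx : x = a ∨ x = b) :
    IntervalIntegrable (fun y : ℝ ↦ f (x + y * I)) volume c d := by
  refine ContinuousOn.intervalIntegrable (hf.comp (by fun_prop) fun y hy ↦ ?_)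
  rw [uIcc_of_le hcd.le] at hy
  exact vertical_mem_rectBoundary hab hx hy

lemma rectIntegral_add {f g : ℂ → ℂ} (hab : a < b) (hcd : c < d)
    (hf : ContinuousOn f (rectBoundary a b c d)) (hg : ContinuousOn g (rectBoundary a b c d)) :
    rectIntegral (fun s ↦ f s + g s) a b c d = rectIntegral f a b c d + rectIntegral g a b c d := by
  unfold rectIntegral
  rw [intervalIntegral.integral_add (intervalIntegrable_horizontal hab hcd hf (.inl rfl))
      (intervalIntegrable_horizontal hab hcd hg (.inl rfl)),
    intervalIntegral.integral_add (intervalIntegrable_horizontal hab hcd hf (.inr rfl))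
      (intervalIntegrable_horizontal hab hcd hg (.inr rfl)),
    intervalIntegral.integral_add (intervalIntegrable_vertical hab hcd hf (.inr rfl))
      (intervalIntegrable_vertical hab hcd hg (.inr rfl)),
    intervalIntegral.integral_add (intervalIntegrable_vertical hab hcd hf (.inl rfl))
      (intervalIntegrable_vertical hab hcd hg (.inl rfl))]
  simp only [smul_eq_mul]
  ring

lemma rectIntegral_const_mul (f : ℂ → ℂ) (k : ℂ) :
    rectIntegral (fun s ↦ k * f s) a b c d = k * rectIntegral f a b c d := by
  unfold rectIntegral
  simp only [intervalIntegral.integral_const_mul, smul_eq_mul]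
  ring

lemma rectIntegral_sum {ι : Type*} [DecidableEq ι] {f : ι → ℂ → ℂ} (hab : a < b) (hcd : c < d)
    (S : Finset ι) (hf : ∀ i ∈ S, ContinuousOn (f i) (rectBoundary a b c d)) :
    rectIntegral (fun s ↦ ∑ i ∈ S, f i s) a b c d = ∑ i ∈ S, rectIntegral (f i) a b c d := by
  induction S using Finset.induction_on with
  | empty => simp [rectIntegral]
  | insert i S hi ih =>
    have hS : ∀ j ∈ S, ContinuousOn (f j) (rectBoundary a b c d) := fun j hj ↦
      hf j (Finset.mem_insert_of_mem hj)
    simp only [Finset.sum_insert hi]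
    rw [rectIntegral_add hab hcd (hf i (Finset.mem_insert_self i S))
      (continuousOn_finsetSum S hS), ih hS]

lemma rectIntegral_congr {f g : ℂ → ℂ} (hab : a < b) (hcd : c < d)
    (h : EqOn f g (rectBoundary a b c d)) : rectIntegral f a b c d = rectIntegral g a b c d := by
  have hh : ∀ y, (y = c ∨ y = d) → ∫ x : ℝ in a..b, f (x + y * I) = ∫ x : ℝ in a..b, g (x + y * I) :=
    fun y hy ↦ intervalIntegral.integral_congr fun x hx ↦ by
      rw [uIcc_of_le hab.le] at hx
      exact h (horizontal_mem_rectBoundary hcd hx hy)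
  have hv : ∀ x, (x = a ∨ x = b) → ∫ y : ℝ in c..d, f (x + y * I) = ∫ y : ℝ in c..d, g (x + y * I) :=
    fun x hx ↦ intervalIntegral.integral_congr fun y hy ↦ by
      rw [uIcc_of_le hcd.le] at hy
      exact h (vertical_mem_rectBoundary hab hx hy)
  unfold rectIntegral
  rw [hh c (.inl rfl), hh d (.inr rfl), hv a (.inl rfl), hv b (.inr rfl)]

lemma log_sub_log_neg_of_im_pos {z : ℂ} (hz : 0 < z.im) : log z - log (-z) = Real.pi * I := by
  rw [log, log, norm_neg, arg_neg_eq_arg_sub_pi_of_im_pos hz]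
  push_cast
  ring

lemma log_sub_log_neg_of_im_neg {z : ℂ} (hz : z.im < 0) : log z - log (-z) = -(Real.pi * I) := by
  rw [log, log, norm_neg, arg_neg_eq_arg_add_pi_of_im_neg hz]
  push_cast
  ring

lemma sub_ne_zero_of_mem_rectBoundary {p s : ℂ} (hp : p ∈ Ioo a b ×ℂ Ioo c d)
    (hs : s ∈ rectBoundary a b c d) : s - p ≠ 0 := by
  intro h
  rw [sub_eq_zero] at h
  exact hs.2 (h ▸ hp)

lemma hasDerivAt_log_horizontal (p : ℂ) (x y : ℝ) (h : y ≠ p.im) :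
    HasDerivAt (fun x : ℝ ↦ log (x + y * I - p)) (1 / (x + y * I - p)) x := by
  have h1 : HasDerivAt (fun x : ℝ ↦ (x + y * I - p : ℂ)) 1 x :=
    ((hasDerivAt_id x).ofReal_comp.add_const _).sub_const _
  refine h1.clog_real ?_
  rw [mem_slitPlane_iff]
  right
  simpa [sub_eq_zero] using h

lemma hasDerivAt_log_vertical (p : ℂ) (x y : ℝ) (h : p.re < x) :
    HasDerivAt (fun y : ℝ ↦ log (x + y * I - p)) (I * (1 / (x + y * I - p))) y := by
  have h1 : HasDerivAt (fun y : ℝ ↦ (x + y * I - p : ℂ)) I y := by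
    simpa using (((hasDerivAt_id y).ofReal_comp.mul_const I).const_add (x : ℂ)).sub_const p
  have h2 := h1.clog_real (by rw [mem_slitPlane_iff]; left; simpa using h)
  rwa [mul_one_div]

lemma hasDerivAt_log_neg_vertical (p : ℂ) (x y : ℝ) (h : x < p.re) :
    HasDerivAt (fun y : ℝ ↦ log (-(x + y * I - p))) (I * (1 / (x + y * I - p))) y := by
  have h1 : HasDerivAt (fun y : ℝ ↦ (x + y * I - p : ℂ)) I y := by
    simpa using (((hasDerivAt_id y).ofReal_comp.mul_const I).const_add (x : ℂ)).sub_const p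
  have h2 := h1.fun_neg.clog_real (by rw [mem_slitPlane_iff]; left; simpa using h)
  rw [neg_div_neg_eq] at h2
  rwa [mul_one_div]

lemma continuousOn_one_div_sub {p : ℂ} (hp : p ∈ Ioo a b ×ℂ Ioo c d) :
    ContinuousOn (fun s ↦ 1 / (s - p)) (rectBoundary a b c d) :=
  ContinuousOn.div (by fun_prop) (by fun_prop) fun _ hs ↦ sub_ne_zero_of_mem_rectBoundary hp hs

lemma rectIntegral_one_div_sub {p : ℂ} (hp : p ∈ Ioo a b ×ℂ Ioo c d) :
    rectIntegral (fun s ↦ 1 / (s - p)) a b c d = 2 * Real.pi * I := by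
  obtain ⟨⟨hpa, hpb⟩, hpc, hpd⟩ := hp
  have hab : a < b := hpa.trans hpb
  have hcd : c < d := hpc.trans hpd
  have hcont := continuousOn_one_div_sub (show p ∈ Ioo a b ×ℂ Ioo c d from ⟨⟨hpa, hpb⟩, hpc, hpd⟩)
  have h1 := intervalIntegral.integral_eq_sub_of_hasDerivAt
    (fun x _ ↦ hasDerivAt_log_horizontal p x c hpc.ne)
    (intervalIntegrable_horizontal hab hcd hcont (.inl rfl))
  have h2 := intervalIntegral.integral_eq_sub_of_hasDerivAt
    (fun x _ ↦ hasDerivAt_log_horizontal p x d hpd.ne')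
    (intervalIntegrable_horizontal hab hcd hcont (.inr rfl))
  have h3 := intervalIntegral.integral_eq_sub_of_hasDerivAt
    (fun y _ ↦ hasDerivAt_log_vertical p b y hpb)
    ((intervalIntegrable_vertical hab hcd hcont (.inr rfl)).const_mul I)
  have h4 := intervalIntegral.integral_eq_sub_of_hasDerivAt
    (fun y _ ↦ hasDerivAt_log_neg_vertical p a y hpa)
    ((intervalIntegrable_vertical hab hcd hcont (.inl rfl)).const_mul I)
  rw [intervalIntegral.integral_const_mul] at h3 h4
  rw [rectIntegral, h1, h2, smul_eq_mul, smul_eq_mul, h3, h4]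
  have h5 := log_sub_log_neg_of_im_pos (z := a + d * I - p) (by simpa using hpd)
  have h6 := log_sub_log_neg_of_im_neg (z := a + c * I - p) (by simpa using hpc)
  linear_combination h5 - h6

/-- The residue theorem on a rectangle, for simple poles. -/
lemma rectIntegral_eq_sum_residues {f : ℂ → ℂ} {r q : ℂ → ℂ} (hab : a < b) (hcd : c < d)
    (S : Finset ℂ) (hS : ∀ p ∈ S, p ∈ Ioo a b ×ℂ Ioo c d)
    (hf : ∀ s ∈ Icc a b ×ℂ Icc c d, s ∉ S → DifferentiableAt ℂ f s)
    (hr : ∀ p ∈ S, Tendsto (fun s ↦ f s - r p / (s - p)) (𝓝[≠] p) (𝓝 (q p))) :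
    rectIntegral f a b c d = 2 * Real.pi * I * ∑ p ∈ S, r p := by
  classical
  have hpole : ∀ p s : ℂ, s ≠ p → DifferentiableAt ℂ (fun s ↦ r p / (s - p)) s := fun p s h ↦
    (differentiableAt_const _).div (by fun_prop) (sub_ne_zero.mpr h)
  set h : ℂ → ℂ := fun s ↦ if s ∈ S then q s - ∑ p ∈ S.erase s, r p / (s - p)
    else f s - ∑ p ∈ S, r p / (s - p) with hh
  have hoff : ∀ s, s ∉ S → ∀ᶠ z in 𝓝 s, z ∉ S := fun s hs ↦
    S.finite_toSet.isClosed.isOpen_compl.mem_nhds hs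
  have hdiff : ∀ s ∈ Icc a b ×ℂ Icc c d, s ∉ S → DifferentiableAt ℂ h s := by
    intro s hs hsS
    have h1 : DifferentiableAt ℂ (fun s ↦ f s - ∑ p ∈ S, r p / (s - p)) s :=
      (hf s hs hsS).sub (DifferentiableAt.fun_sum fun p hp ↦
        hpole p s (fun he ↦ hsS (he ▸ hp)))
    refine h1.congr_of_eventuallyEq ?_
    filter_upwards [hoff s hsS] with z hz
    simp only [hh, if_neg hz]
  have hcont : ∀ s ∈ Icc a b ×ℂ Icc c d, ContinuousAt h s := by
    intro s hs
    by_cases hsS : s ∈ S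
    · rw [← continuousWithinAt_compl_self]
      have h1 : ContinuousAt (fun z ↦ ∑ p ∈ S.erase s, r p / (z - p)) s :=
        (DifferentiableAt.fun_sum fun p hp ↦ hpole p s (Finset.ne_of_mem_erase hp).symm).continuousAt
      have h2 := (hr s hsS).sub (h1.tendsto.mono_left nhdsWithin_le_nhds)
      have h3 : h s = q s - ∑ p ∈ S.erase s, r p / (s - p) := by simp only [hh, if_pos hsS]
      rw [ContinuousWithinAt, h3]
      refine h2.congr' ?_
      have h4 : ∀ᶠ z in 𝓝 s, z ∉ S.erase s :=
        (S.erase s).finite_toSet.isClosed.isOpen_compl.mem_nhds (Finset.notMem_erase s S)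
      filter_upwards [self_mem_nhdsWithin, nhdsWithin_le_nhds h4] with z hz hz4
      have hzS : z ∉ S := fun hmem ↦ hz4 (Finset.mem_erase.mpr ⟨hz, hmem⟩)
      simp only [hh, if_neg hzS]
      rw [← Finset.add_sum_erase S _ hsS]
      ring
    · exact (hdiff s hs hsS).continuousAt
  have hzero : rectIntegral h a b c d = 0 := by
    have := Complex.integral_boundary_rect_eq_zero_of_differentiable_on_off_countable h
      (a + c * I) (b + d * I) S S.countable_toSet ?_ ?_
    · simpa [rectIntegral] using this
    · simp only [add_re, ofReal_re, mul_re, I_re, mul_zero, ofReal_im, I_im, mul_one, sub_self,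
        add_zero, add_im, mul_im, zero_add, uIcc_of_le hab.le, uIcc_of_le hcd.le]
      exact fun s hs ↦ (hcont s hs).continuousWithinAt
    · simp only [add_re, ofReal_re, mul_re, I_re, mul_zero, ofReal_im, I_im, mul_one, sub_self,
        add_zero, add_im, mul_im, zero_add, min_eq_left hab.le, max_eq_right hab.le,
        min_eq_left hcd.le, max_eq_right hcd.le]
      exact fun s hs ↦ hdiff s ⟨Ioo_subset_Icc_self hs.1.1, Ioo_subset_Icc_self hs.1.2⟩ hs.2
  have hcong : rectIntegral f a b c d =
      rectIntegral (fun s ↦ h s + ∑ p ∈ S, r p * (1 / (s - p))) a b c d := by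
    refine rectIntegral_congr hab hcd fun s hs ↦ ?_
    have hsS : s ∉ S := fun hmem ↦ hs.2 (hS s hmem)
    simp only [hh, if_neg hsS, mul_one_div]
    ring
  have hc1 : ∀ p ∈ S, ContinuousOn (fun s ↦ r p * (1 / (s - p))) (rectBoundary a b c d) :=
    fun p hp ↦ continuousOn_const.mul (continuousOn_one_div_sub (hS p hp))
  rw [hcong, rectIntegral_add hab hcd (fun s hs ↦ (hcont s hs.1).continuousWithinAt)
    (continuousOn_finsetSum S hc1), hzero, rectIntegral_sum hab hcd S hc1, zero_add, Finset.mul_sum]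
  refine Finset.sum_congr rfl fun p hp ↦ ?_
  rw [rectIntegral_const_mul, rectIntegral_one_div_sub (hS p hp)]
  ring

lemma tendsto_div_sub_residue {N D : ℂ → ℂ} (hN : Differentiable ℂ N) (hD : Differentiable ℂ D)
    {p : ℂ} (hp : D p = 0) (hp' : deriv D p ≠ 0) :
    Tendsto (fun s ↦ N s / D s - N p / deriv D p / (s - p)) (𝓝[≠] p)
      (𝓝 (deriv (fun s ↦ N s / dslope D p s) p)) := by
  set Q : ℂ → ℂ := fun s ↦ N s / dslope D p s with hQ
  have hd : Differentiable ℂ (dslope D p) := differentiableOn_univ.mp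
    ((Complex.differentiableOn_dslope univ_mem).mpr hD.differentiableOn)
  have hQd : DifferentiableAt ℂ Q p := (hN p).div (hd p) (by rwa [dslope_same])
  have h := (continuousAt_dslope_same.mpr hQd).tendsto.mono_left (nhdsWithin_le_nhds (s := {p}ᶜ))
  rw [dslope_same] at h
  refine h.congr' ?_
  filter_upwards [self_mem_nhdsWithin] with s hs
  have hs' : s - p ≠ 0 := sub_ne_zero.mpr hs
  rw [dslope_of_ne _ hs, slope_def_field, hQ]
  simp only
  rw [dslope_of_ne _ hs, slope_def_field, hp, dslope_same, sub_zero, sub_div]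
  congr 1
  rw [div_div_eq_mul_div, div_right_comm, mul_div_cancel_right₀ _ hs']

/-- The ordinates of the zeros of `ζ` on the critical line up to height `V`. -/
noncomputable def zeroOrdinates (V : ℝ) : Finset ℝ := (finite_zeros V).toFinset

lemma mem_zeroOrdinates {V γ : ℝ} :
    γ ∈ zeroOrdinates V ↔ |γ| ≤ V ∧ riemannZeta (1 / 2 + γ * I) = 0 := by
  simp [zeroOrdinates]

/-- The integrand in Perron's formula, with cutoff. -/
noncomputable def perronIntegrand (α T x : ℝ) (s : ℂ) : ℂ :=
  (x : ℂ) ^ (s - α) * gaussCutoff T s / ((s - α) * riemannZeta s)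

lemma perronIntegrand_eq {α T x : ℝ} {s : ℂ} (hs : s ≠ 1) :
    perronIntegrand α T x s =
      (x : ℂ) ^ (s - α) * gaussCutoff T s * (s - 1) / ((s - α) * riemannZeta₁ s) := by
  have h1 : s - 1 ≠ 0 := sub_ne_zero.mpr hs
  rw [perronIntegrand, riemannZeta_eq_inv_sub_mul hs,
    show (s - α) * ((s - 1)⁻¹ * riemannZeta₁ s) = (s - α) * riemannZeta₁ s / (s - 1) by
      field_simp, div_div_eq_mul_div]

lemma riemannZeta₁_eq_zero_iff {s : ℂ} :
    riemannZeta₁ s = 0 ↔ s ≠ 1 ∧ riemannZeta s = 0 := by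
  constructor
  · intro h
    have hs : s ≠ 1 := by
      rintro rfl
      rw [riemannZeta₁_one] at h
      exact one_ne_zero h
    exact ⟨hs, by rw [riemannZeta_eq_inv_sub_mul hs, h, mul_zero]⟩
  · rintro ⟨hs, h⟩
    rw [riemannZeta_eq_inv_sub_mul hs] at h
    exact (mul_eq_zero.mp h).resolve_left (inv_ne_zero (sub_ne_zero.mpr hs))

lemma deriv_riemannZeta₁_of_zero {s : ℂ} (hs : s ≠ 1) (h : riemannZeta s = 0) :
    deriv riemannZeta₁ s = (s - 1) * deriv riemannZeta s := by
  have h1 : riemannZeta₁ =ᶠ[𝓝 s] fun z ↦ (z - 1) * riemannZeta z := by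
    filter_upwards [isOpen_ne.mem_nhds hs] with z hz
    rw [riemannZeta_eq_inv_sub_mul hz, mul_inv_cancel_left₀ (sub_ne_zero.mpr hz)]
  rw [h1.deriv_eq]
  have h2 := (((hasDerivAt_id s).sub_const 1).mul (differentiableAt_riemannZeta hs).hasDerivAt).deriv
  simp only [id, h, mul_zero, zero_add] at h2
  exact h2

lemma one_half_add_mul_I_ne_ofReal {α γ : ℝ} (hγ : riemannZeta (1 / 2 + γ * I) = 0) :
    (1 / 2 + γ * I : ℂ) ≠ α := by
  intro h
  have h1 : γ = 0 := by simpa using congrArg Complex.im h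
  rw [h1, ofReal_zero, zero_mul, add_zero] at hγ
  exact riemannZeta_one_half_ne_zero hγ

lemma riemannZeta_ofReal_ne_zero
    (hRH : ∀ ρ : ℂ, riemannZeta ρ = 0 → 0 < ρ.re → ρ.re < 1 → ρ.re = 1 / 2)
    {α : ℝ} (h0 : 0 < α) (h1 : α < 1) : riemannZeta α ≠ 0 := by
  intro h
  have h2 := hRH α h (by simpa) (by simpa)
  rw [ofReal_re] at h2
  rw [h2] at h
  push_cast at h
  exact riemannZeta_one_half_ne_zero h

lemma riemannZeta₁_ofReal_ne_zero
    (hRH : ∀ ρ : ℂ, riemannZeta ρ = 0 → 0 < ρ.re → ρ.re < 1 → ρ.re = 1 / 2)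
    {α : ℝ} (h0 : 0 < α) (h1 : α ≤ 1) : riemannZeta₁ α ≠ 0 := by
  intro h
  rw [riemannZeta₁_eq_zero_iff] at h
  exact riemannZeta_ofReal_ne_zero hRH h0 (lt_of_le_of_ne h1 fun he ↦ h.1 (by simp [he])) h.2

lemma rectIntegral_perronIntegrand
    (hRH : ∀ ρ : ℂ, riemannZeta ρ = 0 → 0 < ρ.re → ρ.re < 1 → ρ.re = 1 / 2)
    (hsimple : ∀ ρ : ℂ, riemannZeta ρ = 0 → 0 < ρ.re → ρ.re < 1 → deriv riemannZeta ρ ≠ 0)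
    {α T x V : ℝ} (hα0 : 0 < α) (hα1 : α ≤ 1) (hx : 0 < x)
    (hV : 0 < V) (hne : ∀ σ : ℝ, -1 ≤ σ → σ ≤ 2 →
      riemannZeta (σ + V * I) ≠ 0 ∧ riemannZeta (σ - V * I) ≠ 0) :
    rectIntegral (perronIntegrand α T x) (-1) 2 (-V) V =
      2 * Real.pi * I * (gaussCutoff T α * (if α = 1 then 0 else 1 / riemannZeta α) +
        ∑ γ ∈ zeroOrdinates V, (x : ℂ) ^ (1 / 2 + γ * I - α : ℂ) * gaussCutoff T (1 / 2 + γ * I) /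
          ((1 / 2 + γ * I - α) * deriv riemannZeta (1 / 2 + γ * I))) := by
  set N : ℂ → ℂ := fun s ↦ (x : ℂ) ^ (s - α) * gaussCutoff T s * (s - 1) with hN
  set D : ℂ → ℂ := fun s ↦ (s - α) * riemannZeta₁ s with hD
  have hxC : (x : ℂ) ≠ 0 := ofReal_ne_zero.mpr hx.ne'
  have hNd : Differentiable ℂ N := by
    have h1 := differentiable_gaussCutoff T
    have h2 : Differentiable ℂ fun s : ℂ ↦ (x : ℂ) ^ (s - α) := fun s ↦
      DifferentiableAt.const_cpow (by fun_prop) (.inl hxC)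
    fun_prop
  have hDd : Differentiable ℂ D := by
    have := differentiable_riemannZeta₁
    fun_prop
  have hab : (-1 : ℝ) < 2 := by norm_num
  have hcd : -V < V := by linarith
  have hDα : deriv D α = riemannZeta₁ α := by
    have h := (((hasDerivAt_id (α : ℂ)).sub_const (α : ℂ)).mul
      (differentiable_riemannZeta₁ α).hasDerivAt).deriv
    simp only [id, sub_self, zero_mul, one_mul, add_zero] at h
    exact h
  have hζα := riemannZeta₁_ofReal_ne_zero hRH hα0 hα1
  have hzero1 : ∀ γ : ℝ, riemannZeta (1 / 2 + γ * I) = 0 → (1 / 2 + γ * I : ℂ) ≠ 1 := by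
    intro γ _ h
    have := congrArg Complex.re h
    norm_num at this
  have hDρ : ∀ γ : ℝ, riemannZeta (1 / 2 + γ * I) = 0 → deriv D (1 / 2 + γ * I) =
      (1 / 2 + γ * I - α) * ((1 / 2 + γ * I - 1) * deriv riemannZeta (1 / 2 + γ * I)) := by
    intro γ hγ
    have h := (((hasDerivAt_id (1 / 2 + γ * I : ℂ)).sub_const (α : ℂ)).mul
      (differentiable_riemannZeta₁ (1 / 2 + γ * I)).hasDerivAt).deriv
    rw [← deriv_riemannZeta₁_of_zero (hzero1 γ hγ) hγ]
    have h0 : riemannZeta₁ (1 / 2 + γ * I) = 0 :=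
      riemannZeta₁_eq_zero_iff.mpr ⟨hzero1 γ hγ, hγ⟩
    simp only [id, h0, mul_zero, zero_add] at h
    exact h
  have hsimple' : ∀ γ : ℝ, riemannZeta (1 / 2 + γ * I) = 0 →
      deriv riemannZeta (1 / 2 + γ * I) ≠ 0 := fun γ hγ ↦
    hsimple _ hγ (by norm_num) (by norm_num)
  classical
  have hlt : ∀ γ ∈ zeroOrdinates V, |γ| < V := by
    intro γ hγ
    rw [mem_zeroOrdinates] at hγ
    refine lt_of_le_of_ne hγ.1 fun he ↦ ?_
    have h := hne (1 / 2) (by norm_num) (by norm_num)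
    push_cast at h
    rcases (abs_eq hV.le).mp he with h1 | h1
    · rw [h1] at hγ; exact h.1 hγ.2
    · rw [h1] at hγ
      refine h.2 ?_
      rw [← hγ.2]
      push_cast
      ring_nf
  set S : Finset ℂ := insert (α : ℂ) ((zeroOrdinates V).image fun γ : ℝ ↦ (1 / 2 + γ * I : ℂ))
    with hSdef
  have hcases : ∀ p ∈ S, p = α ∨ ∃ γ ∈ zeroOrdinates V, p = 1 / 2 + γ * I := by
    intro p hp
    rw [hSdef, Finset.mem_insert, Finset.mem_image] at hp
    rcases hp with rfl | ⟨γ, hγ, rfl⟩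
    · exact .inl rfl
    · exact .inr ⟨γ, hγ, rfl⟩
  have hmem : ∀ p ∈ S, p ∈ Ioo (-1 : ℝ) 2 ×ℂ Ioo (-V) V := by
    intro p hp
    rcases hcases p hp with rfl | ⟨γ, hγ, rfl⟩
    · refine ⟨⟨?_, ?_⟩, ?_, ?_⟩ <;> simp <;> linarith
    · have := abs_lt.mp (hlt γ hγ)
      refine ⟨⟨?_, ?_⟩, ?_, ?_⟩ <;> norm_num <;> linarith
  have hDzero : ∀ p ∈ S, D p = 0 ∧ deriv D p ≠ 0 := by
    intro p hp
    rcases hcases p hp with rfl | ⟨γ, hγ, rfl⟩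
    · exact ⟨by simp [hD], by rwa [hDα]⟩
    · have hγ' := (mem_zeroOrdinates.mp hγ).2
      refine ⟨?_, ?_⟩
      · simp only [hD]
        rw [riemannZeta₁_eq_zero_iff.mpr ⟨hzero1 γ hγ', hγ'⟩, mul_zero]
      · rw [hDρ γ hγ']
        exact mul_ne_zero (sub_ne_zero.mpr (one_half_add_mul_I_ne_ofReal hγ'))
          (mul_ne_zero (sub_ne_zero.mpr (hzero1 γ hγ')) (hsimple' γ hγ'))
  have hDne : ∀ s ∈ Icc (-1 : ℝ) 2 ×ℂ Icc (-V) V, s ∉ S → D s ≠ 0 := by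
    intro s hs hsS h
    rcases mul_eq_zero.mp h with h | h
    · exact hsS (by rw [hSdef, sub_eq_zero.mp h]; exact Finset.mem_insert_self _ _)
    · obtain ⟨hs1, hζ⟩ := riemannZeta₁_eq_zero_iff.mp h
      have h2 := re_mem_of_riemannZeta_eq_zero hs.1.1 hζ
      have h3 := hRH s hζ h2.1 h2.2
      have h4 : s = 1 / 2 + s.im * I := by
        apply Complex.ext <;> simp [h3]
      refine hsS (Finset.mem_insert_of_mem (Finset.mem_image.mpr ⟨s.im, ?_, h4.symm⟩))
      rw [mem_zeroOrdinates, ← h4]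
      exact ⟨abs_le.mpr hs.2, hζ⟩
  have hmain := rectIntegral_eq_sum_residues (f := fun s ↦ N s / D s)
    (r := fun p ↦ N p / deriv D p) hab hcd S hmem
    (fun s hs hsS ↦ (hNd s).div (hDd s) (hDne s hs hsS))
    (fun p hp ↦ tendsto_div_sub_residue hNd hDd (hDzero p hp).1 (hDzero p hp).2)
  have hcongr : rectIntegral (perronIntegrand α T x) (-1) 2 (-V) V =
      rectIntegral (fun s ↦ N s / D s) (-1) 2 (-V) V := by
    refine rectIntegral_congr hab hcd fun s hs ↦ perronIntegrand_eq ?_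
    rintro rfl
    exact hs.2 ⟨by norm_num, by simpa using hV⟩
  have hnot : (α : ℂ) ∉ (zeroOrdinates V).image fun γ : ℝ ↦ (1 / 2 + γ * I : ℂ) := by
    intro h
    obtain ⟨γ, hγ, h⟩ := Finset.mem_image.mp h
    exact one_half_add_mul_I_ne_ofReal (mem_zeroOrdinates.mp hγ).2 h
  rw [hcongr, hmain, hSdef, Finset.sum_insert hnot, Finset.sum_image]
  · congr 2
    · rw [hDα, hN]
      simp only [sub_self, cpow_zero, one_mul]
      split_ifs with h
      · simp [h]
      · have hα1' : (α : ℂ) ≠ 1 := by exact_mod_cast h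
        have h1 : (α : ℂ) - 1 ≠ 0 := sub_ne_zero.mpr hα1'
        rw [riemannZeta_eq_inv_sub_mul hα1']
        field_simp
    · refine Finset.sum_congr rfl fun γ hγ ↦ ?_
      have hγ' := (mem_zeroOrdinates.mp hγ).2
      have h1 : (1 / 2 + γ * I - 1 : ℂ) ≠ 0 := sub_ne_zero.mpr (hzero1 γ hγ')
      rw [hDρ γ hγ', mul_left_comm, mul_comm (1 / 2 + γ * I - 1 : ℂ), hN]
      exact mul_div_mul_right _ _ h1
  · intro γ _ γ' _ h
    simpa using congrArg Complex.im h

lemma norm_perronIntegrand_left_le {α T x : ℝ} (hα0 : 0 < α) (hT : 0 ≤ T) (hx : 0 < x) (t : ℝ) :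
    ‖perronIntegrand α T x ((-1 : ℝ) + t * I)‖ ≤ 600 * x ^ (-1 - α) * (1 + t ^ 2)⁻¹ := by
  set s : ℂ := (-1 : ℝ) + t * I with hs
  have h1 : ‖(x : ℂ) ^ (s - α)‖ = x ^ (-1 - α) := by
    rw [norm_cpow_eq_rpow_re_of_pos hx]
    simp [hs]
  have h2 : ‖gaussCutoff T s‖ ≤ 3 / 2 * 3 := by
    have h := norm_gaussCutoff_le hT (-1) t le_rfl (.inr rfl)
    refine h.trans ?_
    have e1 : √2 ≤ 3 / 2 := by rw [Real.sqrt_le_left (by norm_num)]; norm_num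
    have e2 : Real.exp ((-1) ^ 2) ≤ 3 := by
      norm_num; linarith [Real.exp_one_lt_d9]
    norm_num at e2 ⊢
    calc √2 * Real.exp 1 ≤ 3 / 2 * 3 := by gcongr
      _ = _ := by norm_num
  have hsq : √(1 + t ^ 2) * √(1 + t ^ 2) = 1 + t ^ 2 := Real.mul_self_sqrt (by positivity)
  have h3 : √(1 + t ^ 2) ≤ ‖s - α‖ := by
    rw [Complex.norm_def]
    refine Real.sqrt_le_sqrt ?_
    simp [hs, normSq_apply]
    nlinarith
  have h4 : 1 / 128 * √(1 + t ^ 2) ≤ ‖riemannZeta s‖ := by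
    have := norm_riemannZeta_neg_one_ge t
    simpa [hs] using this
  have hpos : 0 < √(1 + t ^ 2) := Real.sqrt_pos.mpr (by positivity)
  rw [perronIntegrand, norm_div, norm_mul, norm_mul, h1]
  calc _ ≤ x ^ (-1 - α) * (3 / 2 * 3) / (√(1 + t ^ 2) * (1 / 128 * √(1 + t ^ 2))) := by gcongr
    _ = 576 * x ^ (-1 - α) * (1 + t ^ 2)⁻¹ := by
      rw [show √(1 + t ^ 2) * (1 / 128 * √(1 + t ^ 2)) = 1 / 128 * (1 + t ^ 2) by
        linear_combination (1 / 128) * hsq]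
      field_simp
      norm_num
    _ ≤ _ := by gcongr; norm_num

lemma norm_integral_perronIntegrand_left_le {α T x V : ℝ} (hα0 : 0 < α) (hT : 0 ≤ T) (hx : 0 < x)
    (hV : 0 ≤ V) :
    ‖∫ t in (-V)..V, perronIntegrand α T x ((-1 : ℝ) + t * I)‖ ≤
      600 * x ^ (-1 - α) * Real.pi := by
  have hi : Integrable fun t : ℝ ↦ 600 * x ^ (-1 - α) * (1 + t ^ 2)⁻¹ :=
    integrable_inv_one_add_sq.const_mul _
  have h := intervalIntegral.norm_integral_le_of_norm_le (a := -V) (b := V) (by linarith)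
    (ae_of_all _ fun t _ ↦ norm_perronIntegrand_left_le hα0 hT hx t) hi.intervalIntegrable
  refine h.trans ?_
  rw [intervalIntegral.integral_of_le (by linarith), ← integral_univ_inv_one_add_sq,
    ← integral_const_mul]
  exact setIntegral_le_integral hi (ae_of_all _ fun t ↦ by positivity)

lemma integrable_perronIntegrand_right {α T x : ℝ} (hα : α ≤ 1) (hT : 0 ≤ T) (hx : 0 < x) :
    Integrable fun t : ℝ ↦ perronIntegrand α T x ((2 : ℝ) + t * I) := by
  have hζ : ∀ t : ℝ, 1 / 2 ≤ ‖riemannZeta ((2 : ℝ) + t * I)‖ := fun t ↦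
    norm_riemannZeta_ge (by simp)
  refine ((integrable_gaussCutoff hT 2).norm.const_mul (2 * x ^ (2 - α))).mono' ?_
    (ae_of_all _ fun t ↦ ?_)
  · refine Continuous.aestronglyMeasurable ?_
    have hc := (differentiable_gaussCutoff T).continuous
    have hxC : (x : ℂ) ≠ 0 := ofReal_ne_zero.mpr hx.ne'
    have h1 : Continuous fun t : ℝ ↦ riemannZeta ((2 : ℝ) + t * I) := by
      rw [continuous_iff_continuousAt]
      intro t
      have hne : ((2 : ℝ) + t * I : ℂ) ≠ 1 := fun h ↦ by
        have := congrArg Complex.re h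
        norm_num at this
      exact ContinuousAt.comp (f := fun t : ℝ ↦ ((2 : ℝ) + t * I : ℂ))
        (differentiableAt_riemannZeta hne).continuousAt (by fun_prop)
    have h2 : Continuous fun t : ℝ ↦ (x : ℂ) ^ ((2 : ℝ) + t * I - α : ℂ) :=
      Continuous.const_cpow (by fun_prop) (.inl hxC)
    refine Continuous.div (h2.mul (by fun_prop)) (Continuous.mul (by fun_prop) h1) fun t h ↦ ?_
    rcases mul_eq_zero.mp h with h | h
    · have := one_le_norm_two_add_sub hα t
      rw [h, norm_zero] at this
      linarith
    · have := hζ t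
      rw [h, norm_zero] at this
      linarith
  · have h1 := one_le_norm_two_add_sub hα t
    have h2 : ‖(x : ℂ) ^ ((2 : ℝ) + t * I - α : ℂ)‖ = x ^ (2 - α) := by
      rw [norm_cpow_eq_rpow_re_of_pos hx]
      simp
    rw [perronIntegrand, norm_div, norm_mul, norm_mul, h2]
    calc _ ≤ x ^ (2 - α) * ‖gaussCutoff T ((2 : ℝ) + t * I)‖ / (1 * (1 / 2)) := by
          gcongr
          exact hζ t
      _ = _ := by ring

lemma norm_perronIntegrand_horizontal_le {α T x σ t : ℝ} (hα0 : 0 < α) (hT : 0 ≤ T) (hx : 1 < x)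
    (hσ : -1 ≤ σ) (hσ' : σ ≤ 2) (ht : 1 ≤ |t|)
    (hζ : Real.exp (-8000 * |t|) ≤ ‖riemannZeta (σ + t * I)‖) :
    ‖perronIntegrand α T x (σ + t * I)‖ ≤
      x ^ 2 * (√2 * Real.exp 4 * Real.exp (T ^ 2 / 2)) * Real.exp (8000 * |t| - t ^ 2 / 4) := by
  have h1 : ‖(x : ℂ) ^ (σ + t * I - α : ℂ)‖ ≤ x ^ 2 := by
    rw [norm_cpow_eq_rpow_re_of_pos (by linarith), ← Real.rpow_two]
    refine Real.rpow_le_rpow_of_exponent_le hx.le ?_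
    simp; linarith
  have h2 : ‖gaussCutoff T (σ + t * I)‖ ≤
      √2 * Real.exp 4 * Real.exp (T ^ 2 / 2) * Real.exp (-(1 / 4) * t ^ 2) := by
    refine (norm_gaussCutoff_le_exp hT σ t).trans ?_
    have : σ ^ 2 ≤ 4 := by nlinarith
    gcongr
  have h3 : 1 ≤ ‖(σ + t * I - α : ℂ)‖ := by
    refine ht.trans ?_
    have := abs_im_le_norm (σ + t * I - α : ℂ)
    simpa using this
  rw [perronIntegrand, norm_div, norm_mul, norm_mul]
  calc _ ≤ x ^ 2 * (√2 * Real.exp 4 * Real.exp (T ^ 2 / 2) * Real.exp (-(1 / 4) * t ^ 2)) /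
        (1 * Real.exp (-8000 * |t|)) := by gcongr
    _ = x ^ 2 * (√2 * Real.exp 4 * Real.exp (T ^ 2 / 2)) *
        (Real.exp (-(1 / 4) * t ^ 2) / Real.exp (-8000 * |t|)) := by
        rw [one_mul]; ring
    _ = _ := by
        rw [← Real.exp_sub]
        ring_nf

lemma tendsto_exp_linear_sub_sq :
    Tendsto (fun t : ℝ ↦ Real.exp (8000 * t - t ^ 2 / 4)) atTop (𝓝 0) := by
  refine Real.tendsto_exp_atBot.comp ?_
  have h1 : Tendsto (fun t : ℝ ↦ 8000 - t / 4) atTop atBot := by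
    simp only [sub_eq_add_neg]
    exact tendsto_atBot_add_const_left _ _
      (tendsto_neg_atTop_atBot.comp (tendsto_id.atTop_div_const (by norm_num)))
  refine (tendsto_id.atTop_mul_atBot₀ h1).congr fun t ↦ ?_
  simp only [id]
  ring

lemma exists_perron_approx
    (hRH : ∀ ρ : ℂ, riemannZeta ρ = 0 → 0 < ρ.re → ρ.re < 1 → ρ.re = 1 / 2)
    (hsimple : ∀ ρ : ℂ, riemannZeta ρ = 0 → 0 < ρ.re → ρ.re < 1 → deriv riemannZeta ρ ≠ 0)
    {α T x : ℝ} (hα0 : 0 < α) (hα1 : α ≤ 1) (hT : 0 ≤ T) (hx : 1 < x) {δ : ℝ} (hδ : 0 < δ)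
    (V₀ : ℝ) : ∃ V : ℝ, V₀ ≤ V ∧
      ‖1 / (2 * Real.pi) * (∫ t : ℝ, perronIntegrand α T x ((2 : ℝ) + t * I)) -
        (gaussCutoff T α * (if α = 1 then 0 else 1 / riemannZeta α) +
        ∑ γ ∈ zeroOrdinates V, (x : ℂ) ^ (1 / 2 + γ * I - α : ℂ) * gaussCutoff T (1 / 2 + γ * I) /
          ((1 / 2 + γ * I - α) * deriv riemannZeta (1 / 2 + γ * I)))‖ ≤
        300 * x ^ (-1 - α) + δ := by
  have hx0 : 0 < x := by linarith
  choose v hv1 hv2 hv3 using fun n : ℕ ↦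
    exists_good_height hRH hsimple (show 2 ≤ n + 2 by omega)
  have hv0 : ∀ n, 2 ≤ v n := fun n ↦ le_trans (by push_cast; linarith [Nat.cast_nonneg (α := ℝ) n]) (hv1 n)
  have hvtop : Tendsto v atTop atTop := by
    refine tendsto_atTop_mono (fun n ↦ ?_) (tendsto_natCast_atTop_atTop (R := ℝ))
    refine le_trans ?_ (hv1 n)
    push_cast
    linarith
  set K := x ^ 2 * (√2 * Real.exp 4 * Real.exp (T ^ 2 / 2)) with hK
  set R := ∫ t : ℝ, perronIntegrand α T x ((2 : ℝ) + t * I) with hR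
  have hRtend : Tendsto (fun n ↦ ∫ t in (-v n)..(v n), perronIntegrand α T x ((2 : ℝ) + t * I))
      atTop (𝓝 R) :=
    intervalIntegral_tendsto_integral (integrable_perronIntegrand_right hα1 hT hx0)
      (tendsto_neg_atTop_atBot.comp hvtop) hvtop
  have hexp : Tendsto (fun n ↦ K * Real.exp (8000 * v n - v n ^ 2 / 4) * 6) atTop (𝓝 0) := by
    simpa using ((tendsto_exp_linear_sub_sq.comp hvtop).const_mul K).mul_const 6
  have hhor : ∀ n, ∀ w : ℝ, (w = v n ∨ w = -v n) →
      ‖∫ y : ℝ in (-1)..2, perronIntegrand α T x (y + w * I)‖ ≤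
        K * Real.exp (8000 * v n - v n ^ 2 / 4) * 3 := by
    intro n w hw
    have hvn := hv0 n
    have habs : |w| = v n := by
      rcases hw with rfl | rfl
      · exact abs_of_pos (by linarith)
      · rw [abs_neg, abs_of_pos (by linarith)]
    have h := intervalIntegral.norm_integral_le_of_norm_le_const (a := -1) (b := 2)
      (f := fun y : ℝ ↦ perronIntegrand α T x (y + w * I))
      (C := K * Real.exp (8000 * v n - v n ^ 2 / 4)) fun y hy ↦ ?_
    · refine h.trans (le_of_eq ?_)
      norm_num
    · rw [uIoc_of_le (by norm_num)] at hy
      rw [← habs, sq_abs]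
      refine norm_perronIntegrand_horizontal_le hα0 hT hx hy.1.le hy.2 (by rw [habs]; linarith) ?_
      rw [habs]
      rcases hw with rfl | rfl
      · exact (hv3 n y hy.1.le hy.2).1
      · have := (hv3 n y hy.1.le hy.2).2
        rwa [ofReal_neg, neg_mul (v n : ℂ) I, ← sub_eq_add_neg]
  have hev := (hvtop.eventually_ge_atTop V₀).and
    (((tendsto_iff_norm_sub_tendsto_zero.mp hRtend).eventually_le_const
      (by linarith : 0 < δ / 2)).and (hexp.eventually_le_const (by linarith : 0 < δ / 2)))
  obtain ⟨n, hn1, hn2, hn3⟩ := hev.exists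
  refine ⟨v n, hn1, ?_⟩
  have hvn : 0 < v n := by linarith [hv0 n]
  have hrect := rectIntegral_perronIntegrand hRH hsimple (T := T) hα0 hα1 hx0 hvn fun σ h1 h2 ↦
    ⟨norm_pos_iff.mp ((Real.exp_pos _).trans_le (hv3 n σ h1 h2).1),
      norm_pos_iff.mp ((Real.exp_pos _).trans_le (hv3 n σ h1 h2).2)⟩
  set Sn := gaussCutoff T α * (if α = 1 then 0 else 1 / riemannZeta α) +
        ∑ γ ∈ zeroOrdinates (v n), (x : ℂ) ^ (1 / 2 + γ * I - α : ℂ) *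
          gaussCutoff T (1 / 2 + γ * I) /
          ((1 / 2 + γ * I - α) * deriv riemannZeta (1 / 2 + γ * I)) with hSn
  rw [rectIntegral] at hrect
  have hB := hhor n (-v n) (.inr rfl)
  have hTp := hhor n (v n) (.inl rfl)
  have hLf := norm_integral_perronIntegrand_left_le hα0 hT hx0 hvn.le
  set B := ∫ y : ℝ in (-1)..2, perronIntegrand α T x (y + (-v n : ℝ) * I)
  set Tp := ∫ y : ℝ in (-1)..2, perronIntegrand α T x (y + v n * I)
  set Rn := ∫ t in (-v n)..(v n), perronIntegrand α T x ((2 : ℝ) + t * I)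
  set Ln := ∫ t in (-v n)..(v n), perronIntegrand α T x ((-1 : ℝ) + t * I)
  have hpi : (Real.pi : ℂ) ≠ 0 := ofReal_ne_zero.mpr Real.pi_ne_zero
  have hid : 1 / (2 * Real.pi) * R - Sn =
      1 / (2 * Real.pi) * (R - Rn) + 1 / (2 * Real.pi) * (I * (B - Tp)) + 1 / (2 * Real.pi) * Ln := by
    simp only [smul_eq_mul] at hrect
    have h5 : Sn = (B - Tp + I * Rn - I * Ln) / (2 * Real.pi * I) := by
      rw [hrect]
      field_simp [I_ne_zero]
    rw [h5]
    field_simp [I_ne_zero]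
    linear_combination (Tp - B) * I_sq
  have hcoef : ‖(1 / (2 * Real.pi) : ℂ)‖ = 1 / (2 * Real.pi) := by
    rw [show (1 / (2 * Real.pi) : ℂ) = ((1 / (2 * Real.pi) : ℝ) : ℂ) by push_cast; rfl, norm_real,
      Real.norm_of_nonneg (by positivity)]
  have hcoef1 : 1 / (2 * Real.pi) ≤ 1 := by
    rw [div_le_one (by positivity)]
    linarith [Real.pi_gt_three]
  rw [hid]
  calc _ ≤ 1 / (2 * Real.pi) * ‖R - Rn‖ + 1 / (2 * Real.pi) * ‖B - Tp‖ +
        1 / (2 * Real.pi) * ‖Ln‖ := by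
        refine (norm_add₃_le).trans (le_of_eq ?_)
        simp only [norm_mul, hcoef, norm_I, one_mul]
    _ ≤ 1 * (δ / 2) + 1 * (δ / 2) + 1 / (2 * Real.pi) * (600 * x ^ (-1 - α) * Real.pi) := by
        gcongr
        · rwa [norm_sub_rev]
        · refine (norm_sub_le _ _).trans ?_
          linarith
    _ = _ := by
        have := Real.pi_ne_zero
        field_simp
        ring

lemma deriv_riemannZeta_conj (s : ℂ) :
    deriv riemannZeta (starRingEnd ℂ s) = starRingEnd ℂ (deriv riemannZeta s) := by
  have h : (starRingEnd ℂ) ∘ riemannZeta ∘ (starRingEnd ℂ) = riemannZeta := by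
    funext z
    simp [riemannZeta_conj]
  have h2 := congrFun (deriv_conj_conj (f := riemannZeta)) (starRingEnd ℂ s)
  rw [h, Function.comp_apply, Function.comp_apply, conj_conj] at h2
  exact h2

lemma conj_one_half_add (γ : ℝ) :
    (1 / 2 + (-γ : ℝ) * I : ℂ) = starRingEnd ℂ (1 / 2 + γ * I) := by
  apply Complex.ext <;> simp

lemma riemannZeta_neg_ordinate {γ : ℝ} (h : riemannZeta (1 / 2 + γ * I) = 0) :
    riemannZeta (1 / 2 + (-γ : ℝ) * I) = 0 := by
  rw [conj_one_half_add, riemannZeta_conj, h, map_zero]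

lemma norm_deriv_riemannZeta_neg_ordinate (γ : ℝ) :
    ‖deriv riemannZeta (1 / 2 + (-γ : ℝ) * I)‖ = ‖deriv riemannZeta (1 / 2 + γ * I)‖ := by
  rw [conj_one_half_add, deriv_riemannZeta_conj, norm_conj]

lemma ordinate_ne_zero {γ : ℝ} (h : riemannZeta (1 / 2 + γ * I) = 0) : γ ≠ 0 := by
  rintro rfl
  rw [ofReal_zero, zero_mul, add_zero] at h
  exact riemannZeta_one_half_ne_zero h

lemma tsum_pos_ordinates (T : ℝ) (f : ℝ → ℝ) :
    (∑' γ : {γ : ℝ // 0 < γ ∧ γ ≤ T ∧ riemannZeta (1 / 2 + γ * I) = 0}, f γ) =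
      ∑ γ ∈ (zeroOrdinates T).filter (0 < ·), f γ := by
  have h : {γ : ℝ | 0 < γ ∧ γ ≤ T ∧ riemannZeta (1 / 2 + γ * I) = 0} =
      ((zeroOrdinates T).filter (0 < ·) : Finset ℝ) := by
    ext γ
    simp only [mem_ofPred_eq, Finset.coe_filter, mem_zeroOrdinates]
    constructor
    · rintro ⟨h1, h2, h3⟩
      exact ⟨⟨by rwa [abs_of_pos h1], h3⟩, h1⟩
    · rintro ⟨⟨h1, h2⟩, h3⟩
      exact ⟨h3, by rwa [abs_of_pos h3] at h1, h2⟩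
  rw [← Finset.tsum_subtype', ← h]
  rfl

lemma tsum_ordinates (T : ℝ) (f : ℝ → ℂ) :
    (∑' γ : {γ : ℝ // |γ| ≤ T ∧ riemannZeta (1 / 2 + γ * I) = 0}, f γ) =
      ∑ γ ∈ zeroOrdinates T, f γ := by
  have h : {γ : ℝ | |γ| ≤ T ∧ riemannZeta (1 / 2 + γ * I) = 0} = (zeroOrdinates T : Finset ℝ) := by
    ext γ
    simp [mem_zeroOrdinates]
  rw [← Finset.tsum_subtype', ← h]
  rfl

lemma sum_inv_norm_deriv_sq_le {θ C : ℝ}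
    (hJ : ∀ T : ℝ, 1 ≤ T →
      (∑' γ : {γ : ℝ // 0 < γ ∧ γ ≤ T ∧ riemannZeta (1 / 2 + γ * I) = 0},
        1 / ‖deriv riemannZeta (1 / 2 + (γ : ℝ) * I)‖ ^ 2) ≤ C * T ^ θ) {T : ℝ} (hT : 1 ≤ T) :
    ∑ γ ∈ zeroOrdinates T, 1 / ‖deriv riemannZeta (1 / 2 + γ * I)‖ ^ 2 ≤ 2 * C * T ^ θ := by
  have h := hJ T hT
  rw [tsum_pos_ordinates T fun γ ↦ 1 / ‖deriv riemannZeta (1 / 2 + γ * I)‖ ^ 2] at h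
  rw [← Finset.sum_filter_add_sum_filter_not _ (0 < ·)]
  have h2 : ∑ γ ∈ (zeroOrdinates T).filter (¬ 0 < ·),
      1 / ‖deriv riemannZeta (1 / 2 + γ * I)‖ ^ 2 =
      ∑ γ ∈ (zeroOrdinates T).filter (0 < ·), 1 / ‖deriv riemannZeta (1 / 2 + γ * I)‖ ^ 2 := by
    refine Finset.sum_nbij' (fun γ ↦ -γ) (fun γ ↦ -γ) ?_ ?_ (by simp) (by simp) ?_
    · intro γ hγ
      simp only [Finset.mem_filter, mem_zeroOrdinates, not_lt] at hγ ⊢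
      exact ⟨⟨by rw [abs_neg]; exact hγ.1.1, riemannZeta_neg_ordinate hγ.1.2⟩,
        neg_pos.mpr (lt_of_le_of_ne hγ.2 (ordinate_ne_zero hγ.1.2))⟩
    · intro γ hγ
      simp only [Finset.mem_filter, mem_zeroOrdinates, not_lt] at hγ ⊢
      exact ⟨⟨by rw [abs_neg]; exact hγ.1.1, riemannZeta_neg_ordinate hγ.1.2⟩, by linarith⟩
    · intro γ _
      rw [norm_deriv_riemannZeta_neg_ordinate]
  rw [h2]
  linarith

lemma exists_le_abs_ordinate :
    ∃ c : ℝ, 0 < c ∧ ∀ γ : ℝ, riemannZeta (1 / 2 + γ * I) = 0 → c * (|γ| + 1) ≤ |γ| := by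
  have h1 : ContinuousAt (fun γ : ℝ ↦ riemannZeta (1 / 2 + γ * I)) 0 := by
    refine ContinuousAt.comp (g := riemannZeta) (f := fun γ : ℝ ↦ (1 / 2 + γ * I : ℂ))
      (differentiableAt_riemannZeta ?_).continuousAt (by fun_prop)
    norm_num
  have h2 : ∀ᶠ γ : ℝ in 𝓝 0, riemannZeta (1 / 2 + γ * I) ≠ 0 :=
    h1.eventually_ne (by simpa using riemannZeta_one_half_ne_zero)
  obtain ⟨m, hm, h⟩ := Metric.eventually_nhds_iff.mp h2
  refine ⟨m / (1 + m), by positivity, fun γ hγ ↦ ?_⟩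
  have h3 : m ≤ |γ| := by
    by_contra! hlt
    exact h (by simpa using hlt) hγ
  rw [div_mul_eq_mul_div, div_le_iff₀ (by positivity)]
  nlinarith

lemma exists_card_block_le : ∃ A : ℝ, 0 ≤ A ∧ ∀ (k : ℕ) (V : ℝ),
    (((zeroOrdinates V).filter fun γ ↦ ⌊|γ|⌋₊ = k).card : ℝ) ≤ A * Real.log (k + 2) := by
  have hlog2 : 0 < Real.log 2 := Real.log_pos (by norm_num)
  refine ⟨112 + (zeroOrdinates 2).card / Real.log 2, by positivity, fun k V ↦ ?_⟩
  have hk0 : (0 : ℝ) ≤ k := Nat.cast_nonneg k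
  have hfl : ∀ γ : ℝ, ⌊|γ|⌋₊ = k → (k : ℝ) ≤ |γ| ∧ |γ| < k + 1 := fun γ h ↦
    (Nat.floor_eq_iff (abs_nonneg γ)).mp h
  have hlog : Real.log 2 ≤ Real.log (k + 2) := Real.log_le_log (by norm_num) (by linarith)
  rcases lt_or_ge k 2 with hk | hk
  · have h1 : ((zeroOrdinates V).filter fun γ ↦ ⌊|γ|⌋₊ = k) ⊆ zeroOrdinates 2 := by
      intro γ hγ
      simp only [Finset.mem_filter, mem_zeroOrdinates] at hγ ⊢
      have hk' : (k : ℝ) ≤ 1 := by exact_mod_cast Nat.lt_succ_iff.mp hk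
      exact ⟨by linarith [(hfl γ hγ.2).2], hγ.1.2⟩
    calc (((zeroOrdinates V).filter fun γ ↦ ⌊|γ|⌋₊ = k).card : ℝ) ≤ (zeroOrdinates 2).card := by
          exact_mod_cast Finset.card_le_card h1
      _ = (zeroOrdinates 2).card / Real.log 2 * Real.log 2 := by field_simp
      _ ≤ (zeroOrdinates 2).card / Real.log 2 * Real.log (k + 2) := by gcongr
      _ ≤ _ := by
          have : 0 ≤ 112 * Real.log ((k : ℝ) + 2) := by linarith
          linarith
  · have hk2 : (2 : ℝ) ≤ k := by exact_mod_cast hk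
    set S := (zeroOrdinates V).filter fun γ ↦ ⌊|γ|⌋₊ = k with hS
    have hmem : ∀ γ ∈ S, riemannZeta (1 / 2 + γ * I) = 0 ∧ (k : ℝ) ≤ |γ| ∧ |γ| < k + 1 :=
      fun γ hγ ↦ by
        simp only [hS, Finset.mem_filter, mem_zeroOrdinates] at hγ
        exact ⟨hγ.1.2, hfl γ hγ.2⟩
    have hp := card_zeros_le (t := k + 1 / 2) (by rw [abs_of_pos (by linarith)]; linarith)
      (S.filter (0 ≤ ·)) fun γ hγ ↦ by
        rw [Finset.mem_filter] at hγ
        have := hmem γ hγ.1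
        rw [abs_of_nonneg hγ.2] at this
        exact ⟨by rw [abs_le]; constructor <;> linarith, this.1⟩
    have hn := card_zeros_le (t := -(k + 1 / 2)) (by rw [abs_neg, abs_of_pos (by linarith)]; linarith)
      (S.filter (¬ 0 ≤ ·)) fun γ hγ ↦ by
        rw [Finset.mem_filter, not_le] at hγ
        have := hmem γ hγ.1
        rw [abs_of_neg hγ.2] at this
        exact ⟨by rw [abs_le]; constructor <;> linarith, this.1⟩
    rw [abs_neg] at hn
    rw [abs_of_pos (by linarith : (0 : ℝ) < k + 1 / 2)] at hp hn
    have hc : ((S.filter (0 ≤ ·)).card : ℝ) + (S.filter (¬ 0 ≤ ·)).card = S.card := by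
      exact_mod_cast Finset.card_filter_add_card_filter_not (s := S) (0 ≤ ·)
    have hl : Real.log (16 * (4 + (k + 1 / 2))) ≤ 4 * Real.log (k + 2) := by
      rw [show (4 : ℝ) = ((4 : ℕ) : ℝ) by norm_num, ← Real.log_pow]
      refine Real.log_le_log (by positivity) ?_
      norm_num
      nlinarith [pow_pos (by linarith : (0 : ℝ) < k) 3, pow_pos (by linarith : (0 : ℝ) < k) 4]
    have hx : 0 ≤ (zeroOrdinates 2).card / Real.log 2 * Real.log (k + 2) := by
      have := hlog2.trans_le hlog
      positivity
    linarith

lemma exists_sum_exp_neg_abs_le : ∃ K : ℝ, 0 ≤ K ∧ ∀ (n : ℕ) (T : ℝ),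
    ∑ k ∈ Finset.range n, Real.exp (-|(k : ℝ) + 1 - T|) ≤ K := by
  have hs : Summable fun j : ℤ ↦ Real.exp (-|(j : ℝ)|) := by
    have h0 : Summable fun n : ℕ ↦ Real.exp (-(n : ℝ)) := Real.summable_exp_neg_nat
    refine Summable.of_nat_of_neg (h0.congr fun n ↦ ?_) (h0.congr fun n ↦ ?_) <;> simp
  refine ⟨Real.exp 2 * ∑' j : ℤ, Real.exp (-|(j : ℝ)|), mul_nonneg (Real.exp_pos _).le
    (tsum_nonneg fun j ↦ (Real.exp_pos _).le), fun n T ↦ ?_⟩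
  have hinj : Function.Injective fun k : ℕ ↦ (k : ℤ) - ⌊T⌋ := fun a b h ↦ by
    simpa using h
  calc ∑ k ∈ Finset.range n, Real.exp (-|(k : ℝ) + 1 - T|)
      ≤ ∑ k ∈ Finset.range n, Real.exp 2 * Real.exp (-|(((k : ℤ) - ⌊T⌋ : ℤ) : ℝ)|) := by
        refine Finset.sum_le_sum fun k _ ↦ ?_
        rw [← Real.exp_add, Real.exp_le_exp]
        push_cast
        have h1 := Int.floor_le T
        have h2 := Int.lt_floor_add_one T
        have h3 := abs_sub_abs_le_abs_sub ((k : ℝ) - ⌊T⌋) (k + 1 - T)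
        have h4 : |(k : ℝ) - ⌊T⌋ - (k + 1 - T)| ≤ 2 := by
          rw [abs_le]
          constructor <;> linarith
        linarith
    _ = Real.exp 2 * ∑ j ∈ (Finset.range n).map ⟨_, hinj⟩, Real.exp (-|(j : ℝ)|) := by
        rw [Finset.sum_map, Finset.mul_sum]
        rfl
    _ ≤ _ := by
        gcongr
        exact hs.sum_le_tsum _ fun j _ ↦ (Real.exp_pos _).le

/-- Slow variation of `y^(θ-2) log (y + 1)` on the exponential scale. -/
lemma rpow_mul_log_le {θ y T : ℝ} (hθ1 : 1 ≤ θ) (hθ2 : θ ≤ 2) (hy : 1 ≤ y) (hT : 1 ≤ T) :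
    y ^ (θ - 2) * Real.log (y + 1) ≤
      Real.exp |y - T| ^ 2 * (2 * (T ^ (θ - 2) * Real.log (T + 1))) := by
  set d := |y - T| with hd
  have hd0 : 0 ≤ d := abs_nonneg _
  have hexp : 1 + d ≤ Real.exp d := by linarith [Real.add_one_le_exp d]
  have hTy : T ≤ y * Real.exp d := by
    have : T - y ≤ d := by rw [hd, abs_sub_comm]; exact le_abs_self _
    nlinarith
  have hyT : y + 1 ≤ (T + 1) * Real.exp d := by
    have : y - T ≤ d := le_abs_self _
    nlinarith
  have h1 : y ^ (θ - 2) ≤ T ^ (θ - 2) * Real.exp d := by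
    have h2 : T ^ (2 - θ) ≤ y ^ (2 - θ) * Real.exp d := by
      calc T ^ (2 - θ) ≤ (y * Real.exp d) ^ (2 - θ) :=
            Real.rpow_le_rpow (by linarith) hTy (by linarith)
        _ = y ^ (2 - θ) * Real.exp d ^ (2 - θ) := Real.mul_rpow (by linarith) (Real.exp_pos _).le
        _ ≤ y ^ (2 - θ) * Real.exp d ^ (1 : ℝ) := by
            gcongr
            · linarith
            · linarith
        _ = _ := by rw [Real.rpow_one]
    rw [show θ - 2 = -(2 - θ) by ring, Real.rpow_neg (by linarith), Real.rpow_neg (by linarith)]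
    have hy0 : 0 < y ^ (2 - θ) := by positivity
    have hT0 : 0 < T ^ (2 - θ) := by positivity
    rw [inv_mul_eq_div, le_div_iff₀ hT0, inv_mul_le_iff₀ hy0]
    exact h2
  have h3 : Real.log (y + 1) ≤ 2 * Real.log (T + 1) * Real.exp d := by
    have h4 : Real.log (y + 1) ≤ Real.log (T + 1) + d := by
      refine (Real.log_le_log (by linarith) hyT).trans (le_of_eq ?_)
      rw [Real.log_mul (by linarith) (Real.exp_pos _).ne', Real.log_exp]
    have h5 : 1 / 2 ≤ Real.log (T + 1) := by
      have := Real.log_le_log (by norm_num : (0 : ℝ) < 2) (by linarith : 2 ≤ T + 1)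
      linarith [Real.log_two_gt_d9]
    nlinarith
  have h6 : 0 ≤ Real.log (y + 1) := Real.log_nonneg (by linarith)
  calc _ ≤ T ^ (θ - 2) * Real.exp d * (2 * Real.log (T + 1) * Real.exp d) := by gcongr
    _ = _ := by ring

lemma norm_gaussCutoff_sub_ite_le {T : ℝ} (hT : 0 ≤ T) {γ : ℝ} {k : ℕ} (hk : ⌊|γ|⌋₊ = k) :
    ‖gaussCutoff T (1 / 2 + γ * I) - (if |γ| ≤ T then 1 else 0)‖ ≤
      3 * Real.exp 4 * Real.exp (-|(k : ℝ) + 1 - T|) ^ 2 := by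
  obtain ⟨hk1, hk2⟩ := (Nat.floor_eq_iff (abs_nonneg γ)).mp hk
  have hcast : (1 / 2 + γ * I : ℂ) = ((1 / 2 : ℝ) : ℂ) + γ * I := by push_cast; ring
  have hmain : ‖gaussCutoff T (1 / 2 + γ * I) - (if |γ| ≤ T then 1 else 0)‖ ≤
      √2 * Real.exp ((1 / 2) ^ 2) * Real.exp (-(|γ| - T) ^ 2 / 2) := by
    rw [hcast]
    split_ifs with h
    · have := norm_gaussCutoff_sub_one_le hT (1 / 2) γ h
      rwa [sub_sq_comm] at this
    · rw [sub_zero]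
      exact norm_gaussCutoff_le hT (1 / 2) γ (by linarith) (.inl le_rfl)
  refine hmain.trans ?_
  have h1 : √2 * Real.exp ((1 / 2) ^ 2) ≤ 3 := by
    have e1 : √2 ≤ 3 / 2 := by rw [Real.sqrt_le_left (by norm_num)]; norm_num
    have e2 : Real.exp ((1 / 2) ^ 2) ≤ 2 := by
      rw [← Real.le_log_iff_exp_le (by norm_num)]
      norm_num
      linarith [Real.log_two_gt_d9]
    nlinarith [Real.sqrt_nonneg 2, Real.exp_pos ((1 / 2 : ℝ) ^ 2)]
  have h2 : Real.exp (-(|γ| - T) ^ 2 / 2) ≤ Real.exp 4 * Real.exp (-|(k : ℝ) + 1 - T|) ^ 2 := by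
    rw [← Real.exp_nat_mul, ← Real.exp_add, Real.exp_le_exp]
    have h3 := abs_sub_abs_le_abs_sub ((k : ℝ) + 1 - T) (|γ| - T)
    have h4 : |(k : ℝ) + 1 - T - (|γ| - T)| ≤ 1 := by
      rw [abs_le]
      constructor <;> linarith
    have h5 := sq_nonneg (|(|γ| - T)| - 2)
    have h6 := sq_abs (|γ| - T)
    push_cast
    nlinarith
  calc _ ≤ 3 * (Real.exp 4 * Real.exp (-|(k : ℝ) + 1 - T|) ^ 2) := by gcongr
    _ = _ := by ring

lemma exists_sum_block_le {θ C : ℝ}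
    (hJ : ∀ T : ℝ, 1 ≤ T →
      (∑' γ : {γ : ℝ // 0 < γ ∧ γ ≤ T ∧ riemannZeta (1 / 2 + γ * I) = 0},
        1 / ‖deriv riemannZeta (1 / 2 + (γ : ℝ) * I)‖ ^ 2) ≤ C * T ^ θ) :
    ∃ D : ℝ, 0 ≤ D ∧ ∀ (α : ℝ) (k : ℕ) (V : ℝ),
      ∑ γ ∈ (zeroOrdinates V).filter fun γ ↦ ⌊|γ|⌋₊ = k,
        1 / (‖(1 / 2 + γ * I - α : ℂ)‖ * ‖deriv riemannZeta (1 / 2 + γ * I)‖) ≤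
        D * √(((k : ℝ) + 1) ^ (θ - 2) * Real.log (k + 1 + 1)) := by
  obtain ⟨c, hc, hcγ⟩ := exists_le_abs_ordinate
  obtain ⟨A, hA, hcard⟩ := exists_card_block_le
  refine ⟨√(A * (2 * C)) / c, by positivity, fun α k V ↦ ?_⟩
  set S := (zeroOrdinates V).filter fun γ ↦ ⌊|γ|⌋₊ = k with hS
  have hk0 : (0 : ℝ) ≤ k := Nat.cast_nonneg k
  have hmem : ∀ γ ∈ S, riemannZeta (1 / 2 + γ * I) = 0 ∧ (k : ℝ) ≤ |γ| ∧ |γ| < k + 1 :=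
    fun γ hγ ↦ by
      simp only [hS, Finset.mem_filter, mem_zeroOrdinates] at hγ
      exact ⟨hγ.1.2, (Nat.floor_eq_iff (abs_nonneg γ)).mp hγ.2⟩
  have h1 : ∀ γ ∈ S, 1 / (‖(1 / 2 + γ * I - α : ℂ)‖ * ‖deriv riemannZeta (1 / 2 + γ * I)‖) ≤
      1 / (c * (k + 1)) * (1 / ‖deriv riemannZeta (1 / 2 + γ * I)‖) := fun γ hγ ↦ by
    obtain ⟨hz, hk1, -⟩ := hmem γ hγ
    have h2 : c * (k + 1) ≤ ‖(1 / 2 + γ * I - α : ℂ)‖ := by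
      have h3 := abs_im_le_norm (1 / 2 + γ * I - α : ℂ)
      have h4 : (1 / 2 + γ * I - α : ℂ).im = γ := by simp
      rw [h4] at h3
      refine le_trans ?_ ((hcγ γ hz).trans h3)
      gcongr
    rw [one_div_mul_one_div_rev, mul_comm, ← one_div_mul_one_div_rev, ← one_div_mul_one_div_rev]
    gcongr
  have h2 : (∑ γ ∈ S, 1 / ‖deriv riemannZeta (1 / 2 + γ * I)‖) ^ 2 ≤
      A * Real.log (k + 2) * (2 * C * (k + 1) ^ θ) := by
    refine (sq_sum_le_card_mul_sum_sq).trans ?_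
    refine mul_le_mul (hcard k V) ?_ (by positivity) ?_
    · refine le_trans ?_ (sum_inv_norm_deriv_sq_le hJ (T := k + 1) (by linarith))
      simp only [div_pow, one_pow]
      refine Finset.sum_le_sum_of_subset_of_nonneg (fun γ hγ ↦ ?_) fun _ _ _ ↦ by positivity
      exact mem_zeroOrdinates.mpr ⟨(hmem γ hγ).2.2.le, (hmem γ hγ).1⟩
    · exact mul_nonneg hA (Real.log_nonneg (by linarith))
  calc _ ≤ ∑ γ ∈ S, 1 / (c * (k + 1)) * (1 / ‖deriv riemannZeta (1 / 2 + γ * I)‖) :=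
        Finset.sum_le_sum h1
    _ = 1 / (c * (k + 1)) * ∑ γ ∈ S, 1 / ‖deriv riemannZeta (1 / 2 + γ * I)‖ := by
        rw [Finset.mul_sum]
    _ ≤ 1 / (c * (k + 1)) * √(A * Real.log (k + 2) * (2 * C * (k + 1) ^ θ)) := by
        gcongr
        exact Real.le_sqrt_of_sq_le h2
    _ = _ := by
        have hk1 : (0 : ℝ) < k + 1 := by linarith
        have hl : 0 ≤ Real.log ((k : ℝ) + 2) := Real.log_nonneg (by linarith)
        have h3 : A * Real.log (k + 2) * (2 * C * (k + 1) ^ θ) =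
            (((k : ℝ) + 1) ^ (θ - 2) * Real.log (k + 1 + 1)) * (A * (2 * C)) * (k + 1) ^ 2 := by
          rw [show (k : ℝ) + 1 + 1 = k + 2 by ring, Real.rpow_sub hk1, Real.rpow_two]
          field_simp
        rw [h3, Real.sqrt_mul' _ (by positivity), Real.sqrt_sq hk1.le, Real.sqrt_mul]
        · field_simp
        · rw [show (k : ℝ) + 1 + 1 = k + 2 by ring]
          positivity

lemma exists_sum_cutoff_error_le {θ C : ℝ} (hθ1 : 1 ≤ θ) (hθ2 : θ ≤ 2)
    (hJ : ∀ T : ℝ, 1 ≤ T →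
      (∑' γ : {γ : ℝ // 0 < γ ∧ γ ≤ T ∧ riemannZeta (1 / 2 + γ * I) = 0},
        1 / ‖deriv riemannZeta (1 / 2 + (γ : ℝ) * I)‖ ^ 2) ≤ C * T ^ θ) :
    ∃ K : ℝ, 0 ≤ K ∧ ∀ α T V : ℝ, 1 ≤ T →
      ∑ γ ∈ zeroOrdinates V, ‖gaussCutoff T (1 / 2 + γ * I) - (if |γ| ≤ T then 1 else 0)‖ *
        (1 / (‖(1 / 2 + γ * I - α : ℂ)‖ * ‖deriv riemannZeta (1 / 2 + γ * I)‖)) ≤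
        K * √(T ^ (θ - 2) * Real.log (T + 1)) := by
  obtain ⟨D, hD, hblock⟩ := exists_sum_block_le hJ
  obtain ⟨L, hL, hsum⟩ := exists_sum_exp_neg_abs_le
  refine ⟨3 * Real.exp 4 * D * √2 * L, by positivity, fun α T V hT ↦ ?_⟩
  set F := √(T ^ (θ - 2) * Real.log (T + 1)) with hF
  have hmaps : ∀ γ ∈ zeroOrdinates V, ⌊|γ|⌋₊ ∈ Finset.range (⌊V⌋₊ + 1) := fun γ hγ ↦ by
    rw [Finset.mem_range, Nat.lt_succ_iff]
    exact Nat.floor_le_floor (mem_zeroOrdinates.mp hγ).1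
  rw [← Finset.sum_fiberwise_of_maps_to hmaps]
  have hk : ∀ k : ℕ, ∑ γ ∈ (zeroOrdinates V).filter (fun γ ↦ ⌊|γ|⌋₊ = k),
      ‖gaussCutoff T (1 / 2 + γ * I) - (if |γ| ≤ T then 1 else 0)‖ *
        (1 / (‖(1 / 2 + γ * I - α : ℂ)‖ * ‖deriv riemannZeta (1 / 2 + γ * I)‖)) ≤
      3 * Real.exp 4 * D * √2 * F * Real.exp (-|(k : ℝ) + 1 - T|) := fun k ↦ by
    have hk0 : (0 : ℝ) ≤ k := Nat.cast_nonneg k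
    set e := Real.exp (-|(k : ℝ) + 1 - T|) with he
    have hee : e * Real.exp |(k : ℝ) + 1 - T| = 1 := by rw [he, ← Real.exp_add]; simp
    have hφ : √(((k : ℝ) + 1) ^ (θ - 2) * Real.log (k + 1 + 1)) ≤
        Real.exp |(k : ℝ) + 1 - T| * (√2 * F) := by
      refine (Real.sqrt_le_sqrt (rpow_mul_log_le hθ1 hθ2 (by linarith) hT)).trans (le_of_eq ?_)
      rw [Real.sqrt_mul (by positivity), Real.sqrt_sq (Real.exp_pos _).le,
        Real.sqrt_mul (by norm_num)]
    calc _ ≤ ∑ γ ∈ (zeroOrdinates V).filter (fun γ ↦ ⌊|γ|⌋₊ = k), 3 * Real.exp 4 * e ^ 2 *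
          (1 / (‖(1 / 2 + γ * I - α : ℂ)‖ * ‖deriv riemannZeta (1 / 2 + γ * I)‖)) := by
          refine Finset.sum_le_sum fun γ hγ ↦ ?_
          gcongr
          exact norm_gaussCutoff_sub_ite_le (by linarith) (Finset.mem_filter.mp hγ).2
      _ = 3 * Real.exp 4 * e ^ 2 * ∑ γ ∈ (zeroOrdinates V).filter (fun γ ↦ ⌊|γ|⌋₊ = k),
          (1 / (‖(1 / 2 + γ * I - α : ℂ)‖ * ‖deriv riemannZeta (1 / 2 + γ * I)‖)) := by
          rw [Finset.mul_sum]
      _ ≤ 3 * Real.exp 4 * e ^ 2 * (D * (Real.exp |(k : ℝ) + 1 - T| * (√2 * F))) := by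
          gcongr
          exact (hblock α k V).trans (by gcongr)
      _ = 3 * Real.exp 4 * D * √2 * F * e * (e * Real.exp |(k : ℝ) + 1 - T|) := by ring
      _ = _ := by rw [hee, mul_one]
  calc _ ≤ ∑ k ∈ Finset.range (⌊V⌋₊ + 1),
        3 * Real.exp 4 * D * √2 * F * Real.exp (-|(k : ℝ) + 1 - T|) :=
        Finset.sum_le_sum fun k _ ↦ hk k
    _ = 3 * Real.exp 4 * D * √2 * F * ∑ k ∈ Finset.range (⌊V⌋₊ + 1),
        Real.exp (-|(k : ℝ) + 1 - T|) := by rw [Finset.mul_sum]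
    _ ≤ 3 * Real.exp 4 * D * √2 * F * L := by
        gcongr
        exact hsum _ _
    _ = _ := by ring

lemma norm_sum_residues_sub_le {α T V x K F : ℝ} (hx : 0 < x) (hTV : T ≤ V)
    (h : ∑ γ ∈ zeroOrdinates V, ‖gaussCutoff T (1 / 2 + γ * I) - (if |γ| ≤ T then 1 else 0)‖ *
        (1 / (‖(1 / 2 + γ * I - α : ℂ)‖ * ‖deriv riemannZeta (1 / 2 + γ * I)‖)) ≤ K * F) :
    ‖∑ γ ∈ zeroOrdinates V, (x : ℂ) ^ (1 / 2 + γ * I - α : ℂ) * gaussCutoff T (1 / 2 + γ * I) /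
          ((1 / 2 + γ * I - α) * deriv riemannZeta (1 / 2 + γ * I)) -
      ∑ γ ∈ zeroOrdinates T, (x : ℂ) ^ (1 / 2 + γ * I - α : ℂ) /
          ((1 / 2 + γ * I - α) * deriv riemannZeta (1 / 2 + γ * I))‖ ≤
      x ^ (1 / 2 - α) * (K * F) := by
  have hsub : zeroOrdinates T = (zeroOrdinates V).filter (|·| ≤ T) := by
    ext γ
    simp only [Finset.mem_filter, mem_zeroOrdinates]
    exact ⟨fun h ↦ ⟨⟨h.1.trans hTV, h.2⟩, h.1⟩, fun h ↦ ⟨h.2, h.1.2⟩⟩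
  rw [hsub, Finset.sum_filter, ← Finset.sum_sub_distrib]
  refine (norm_sum_le _ _).trans ?_
  refine le_trans (le_of_eq ?_) (mul_le_mul_of_nonneg_left h (by positivity))
  rw [Finset.mul_sum]
  refine Finset.sum_congr rfl fun γ _ ↦ ?_
  have h1 : ‖(x : ℂ) ^ (1 / 2 + γ * I - α : ℂ)‖ = x ^ (1 / 2 - α) := by
    rw [norm_cpow_eq_rpow_re_of_pos hx]
    simp
  rw [← h1, ← norm_mul (1 / 2 + γ * I - α : ℂ), ← norm_one (α := ℂ), ← norm_div, ← norm_mul,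
    ← norm_mul]
  congr 1
  split_ifs <;> ring

lemma div_le_add_of_log {x T ε P : ℝ} (hx : 1 < x) (hT : 1 ≤ T) (hε : 0 < ε) (hP : 0 ≤ P) :
    P / T ≤ P * Real.log x / T + P / (T ^ (1 - ε) * Real.log x) := by
  have hL : 0 < Real.log x := Real.log_pos hx
  have hT0 : 0 < T := by linarith
  have h1 : T ^ (1 - ε) ≤ T := by
    conv_rhs => rw [← Real.rpow_one T]
    exact Real.rpow_le_rpow_of_exponent_le hT (by linarith)
  have h2 : 1 ≤ Real.log x + 1 / Real.log x := by
    rcases le_total 1 (Real.log x) with h | h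
    · have : 0 ≤ 1 / Real.log x := by positivity
      linarith
    · have : 1 ≤ 1 / Real.log x := by rwa [le_div_iff₀ hL, one_mul]
      linarith
  calc P / T = P / T * 1 := (mul_one _).symm
    _ ≤ P / T * (Real.log x + 1 / Real.log x) := by gcongr
    _ = P * Real.log x / T + P / (T * Real.log x) := by field_simp
    _ ≤ _ := by gcongr

lemma rpow_mul_sqrt_le {x T θ α E : ℝ} (hx : 1 < x) (hT : 1 ≤ T) (hθ : θ ≤ 2)
    (h1 : x ^ (1 - α) / T ≤ E)
    (h2 : x ^ (1 / 2 - α) * (T ^ (θ - 2) * Real.log T) ^ ((1 : ℝ) / 2) ≤ E) :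
    x ^ (1 / 2 - α) * √(T ^ (θ - 2) * Real.log (T + 1)) ≤ 4 * E := by
  have hT0 : 0 < T := by linarith
  rw [← Real.sqrt_eq_rpow] at h2
  have hE : 0 ≤ E := le_trans (by positivity) h1
  rcases le_total 2 T with h | h
  · have h3 : Real.log (T + 1) ≤ 2 ^ 2 * Real.log T := by
      have : Real.log (T + 1) ≤ Real.log (T ^ 2) := Real.log_le_log (by linarith) (by nlinarith)
      rw [Real.log_pow] at this
      push_cast at this
      linarith [Real.log_nonneg hT]
    calc _ ≤ x ^ (1 / 2 - α) * √(2 ^ 2 * (T ^ (θ - 2) * Real.log T)) := by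
          refine mul_le_mul_of_nonneg_left (Real.sqrt_le_sqrt ?_) (by positivity)
          rw [mul_left_comm]
          gcongr
      _ = 2 * (x ^ (1 / 2 - α) * √(T ^ (θ - 2) * Real.log T)) := by
          rw [Real.sqrt_mul (by norm_num), Real.sqrt_sq (by norm_num)]
          ring
      _ ≤ _ := by linarith
  · have h3 : √(T ^ (θ - 2) * Real.log (T + 1)) ≤ 2 := by
      rw [Real.sqrt_le_left (by norm_num)]
      have h4 : T ^ (θ - 2) ≤ 1 := Real.rpow_le_one_of_one_le_of_nonpos hT (by linarith)
      have h5 : Real.log (T + 1) ≤ 2 := by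
        linarith [Real.log_le_sub_one_of_pos (by linarith : 0 < T + 1)]
      have h6 : 0 ≤ Real.log (T + 1) := Real.log_nonneg (by linarith)
      have : T ^ (θ - 2) * Real.log (T + 1) ≤ 1 * 2 := by gcongr
      linarith
    calc _ ≤ x ^ (1 - α) * 2 := by
          gcongr
          · exact hx.le
          · norm_num
      _ = 2 * T * (x ^ (1 - α) / T) := by field_simp
      _ ≤ 4 * E := by
          gcongr
          linarith

end MobiusExplicit

open MobiusExplicit

/-- Explicit formula for `M_α(x)` under RH, simplicity of the zeros and the negative
second moment bound `J_{-1}(T) ≪ T^θ`; the constant `1/ζ(α)` is interpreted as `0` at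
`α = 1`, where `ζ` has its pole. -/
theorem statement19
    (hRH : ∀ ρ : ℂ, riemannZeta ρ = 0 → 0 < ρ.re → ρ.re < 1 → ρ.re = 1 / 2)
    (hsimple : ∀ ρ : ℂ, riemannZeta ρ = 0 → 0 < ρ.re → ρ.re < 1 →
      deriv riemannZeta ρ ≠ 0)
    (θ C : ℝ) (hθ1 : 1 ≤ θ) (hθ2 : θ < 3 - Real.sqrt 3)
    (hJ : ∀ T : ℝ, 1 ≤ T →
      (∑' γ : {γ : ℝ // 0 < γ ∧ γ ≤ T ∧ riemannZeta (1 / 2 + γ * Complex.I) = 0},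
        1 / ‖deriv riemannZeta (1 / 2 + (γ : ℝ) * Complex.I)‖ ^ 2) ≤ C * T ^ θ)
    (α : ℝ) (hα0 : 0 < α) (hα1 : α ≤ 1)
    (b : ℝ) (hb0 : 0 < b) (hb1 : b < min (1 / 2) α)
    (ε : ℝ) (hε0 : 0 < ε) (hε1 : ε < 1 / 2 - b) :
    ∃ C' : ℝ, ∀ x : ℝ, 1 < x → ∀ T : ℝ, 1 ≤ T →
      ‖(Mweight α x : ℂ) -
          (if α = 1 then 0 else 1 / riemannZeta (α : ℂ)) -
          (∑' γ : {γ : ℝ // |γ| ≤ T ∧ riemannZeta (1 / 2 + γ * Complex.I) = 0},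
            (x : ℂ) ^ ((1 / 2 : ℂ) + (γ : ℝ) * Complex.I - (α : ℂ)) /
              ((((1 / 2 : ℂ) + (γ : ℝ) * Complex.I) - (α : ℂ)) *
                deriv riemannZeta (1 / 2 + (γ : ℝ) * Complex.I)))‖
        ≤ C' * (x ^ (1 - α) * Real.log x / T +
            x ^ (1 - α) / (T ^ (1 - ε) * Real.log x) +
            x ^ (1 / 2 - α) * (T ^ (θ - 2) * Real.log T) ^ ((1 : ℝ) / 2) +
            x ^ (b - α)) := by
  have hθ : θ ≤ 2 := by
    have : (1 : ℝ) ≤ √3 := by rw [Real.one_le_sqrt]; norm_num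
    linarith
  obtain ⟨K₁, hK₁, hM⟩ := exists_norm_Mweight_sub_le
  obtain ⟨K₂, hK₂, hZ⟩ := exists_sum_cutoff_error_le hθ1 hθ hJ
  set c : ℂ := if α = 1 then 0 else 1 / riemannZeta (α : ℂ) with hc
  refine ⟨2 * K₁ + 301 + 16 * ‖c‖ + 4 * K₂, fun x hx T hT ↦ ?_⟩
  have hx0 : 0 < x := by linarith
  have hT0 : 0 < T := by linarith
  have hL : 0 < Real.log x := Real.log_pos hx
  have hLT : 0 ≤ Real.log T := Real.log_nonneg hT
  rw [tsum_ordinates T fun γ ↦ (x : ℂ) ^ ((1 / 2 : ℂ) + γ * Complex.I - (α : ℂ)) /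
    ((((1 / 2 : ℂ) + γ * Complex.I) - (α : ℂ)) * deriv riemannZeta (1 / 2 + γ * Complex.I))]
  obtain ⟨V, hTV, hV⟩ := exists_perron_approx hRH hsimple hα0 hα1 hT0.le hx
    (δ := x ^ (b - α)) (by positivity) T
  have hMx := hM α T x hα0 hα1 hT hx
  have hZx := norm_sum_residues_sub_le hx0 hTV (hZ α T V hT)
  have hg := norm_gaussCutoff_ofReal_sub_one_le (α := α) (abs_le.mpr ⟨by linarith, hα1⟩) hT
  rw [← hc] at hV
  set R : ℂ := 1 / (2 * Real.pi) * ∫ t : ℝ, perronIntegrand α T x ((2 : ℝ) + t * Complex.I) with hR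
  set S := ∑ γ ∈ zeroOrdinates V, (x : ℂ) ^ (1 / 2 + γ * Complex.I - α : ℂ) *
    gaussCutoff T (1 / 2 + γ * Complex.I) /
    ((1 / 2 + γ * Complex.I - α) * deriv riemannZeta (1 / 2 + γ * Complex.I))
  set Z := ∑ γ ∈ zeroOrdinates T, (x : ℂ) ^ (1 / 2 + γ * Complex.I - α : ℂ) /
    ((1 / 2 + γ * Complex.I - α) * deriv riemannZeta (1 / 2 + γ * Complex.I))
  have hMR : ‖(Mweight α x : ℂ) - R‖ ≤
      K₁ * (x ^ (1 - α) * (1 + Real.log x) / T + x ^ (-α)) := hMx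
  set E := x ^ (1 - α) * Real.log x / T + x ^ (1 - α) / (T ^ (1 - ε) * Real.log x) +
    x ^ (1 / 2 - α) * (T ^ (θ - 2) * Real.log T) ^ ((1 : ℝ) / 2) + x ^ (b - α) with hE
  have e1 : 0 ≤ x ^ (1 - α) * Real.log x / T := by positivity
  have e2 : 0 ≤ x ^ (1 - α) / (T ^ (1 - ε) * Real.log x) := by positivity
  have e3 : 0 ≤ x ^ (1 / 2 - α) * (T ^ (θ - 2) * Real.log T) ^ ((1 : ℝ) / 2) := by positivity
  have e4 : 0 ≤ x ^ (b - α) := by positivity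
  have hP := div_le_add_of_log (P := x ^ (1 - α)) hx hT hε0 (by positivity)
  have hP1 : 1 / T ≤ x ^ (1 - α) / T := by
    gcongr
    exact Real.one_le_rpow hx.le (by linarith)
  have hx1 : x ^ (-α) ≤ x ^ (b - α) := Real.rpow_le_rpow_of_exponent_le hx.le (by linarith)
  have hx2 : x ^ (-1 - α) ≤ x ^ (b - α) := Real.rpow_le_rpow_of_exponent_le hx.le (by linarith)
  have hsq := rpow_mul_sqrt_le (E := E) hx hT hθ (by linarith) (by linarith)
  have b1 : ‖(Mweight α x : ℂ) - R‖ ≤ 2 * K₁ * E := by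
    have : x ^ (1 - α) * (1 + Real.log x) / T =
      x ^ (1 - α) / T + x ^ (1 - α) * Real.log x / T := by ring
    refine hMR.trans ?_
    rw [mul_comm 2, mul_assoc]
    gcongr
    linarith
  have b3 : ‖(gaussCutoff T α - 1) * c‖ ≤ 16 * ‖c‖ * E := by
    rw [norm_mul]
    have : 16 / T ≤ 16 * E := by
      rw [← mul_one_div]
      linarith
    calc _ ≤ 16 * E * ‖c‖ := by
          gcongr
          exact hg.trans this
      _ = _ := by ring
  have b4 : ‖S - Z‖ ≤ 4 * K₂ * E := by
    refine hZx.trans ?_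
    have := mul_le_mul_of_nonneg_left hsq hK₂
    linarith
  calc _ = ‖((Mweight α x : ℂ) - R) + (R - (gaussCutoff T α * c + S)) +
        (gaussCutoff T α - 1) * c + (S - Z)‖ := by
        congr 1
        ring
    _ ≤ 2 * K₁ * E + (300 * x ^ (-1 - α) + x ^ (b - α)) + 16 * ‖c‖ * E + 4 * K₂ * E :=
        norm_add₄_le.trans (by gcongr)
    _ ≤ _ := by
        linarith
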